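/- Let Ω ⊂ ℂ be a bounded lemniscate domain with γ := ∂Ω, let z₀ ∈ Ω, let ε > 0, and let U be an open neighborhood of γ. Then there exists δ > 0 such that every continuous injective map h : γ → ℂ with sup_{z ∈ γ} |h(z) − z| < δ admits an extension to a homeomorphism h̃ : closure(Ω) → closure(Ω_h) with h̃ = h on γ, sup_{z ∈ closure(Ω)} |h̃(z) − z| < ε, and h̃(z) = z for all z ∈ closure(Ω) \ U, where Ω_h denotes the connected component of ℂ \ h(γ) containing z₀. -/

import Mathlib

open Set Metric Topology Filter Polynomial

noncomputable section

/-- A Jordan curve: a set homeomorphic to the unit circle. -/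
def IsJordanCurve {X : Type*} [TopologicalSpace X] (E : Set X) : Prop :=
  Nonempty (E ≃ₜ (Metric.sphere (0 : ℂ) 1 : Set ℂ))

/-- A simple arc: a set homeomorphic to the open unit interval `(0,1)`. -/
def IsSimpleArc {X : Type*} [TopologicalSpace X] (E : Set X) : Prop :=
  Nonempty (E ≃ₜ (Set.Ioo (0 : ℝ) 1 : Set ℝ))

/-- The connected components of a set. -/
def setComponents {X : Type*} [TopologicalSpace X] (A : Set X) : Set (Set X) :=
  {C | ∃ x ∈ A, C = connectedComponentIn A x}

/-- The edges of the pair `(G, V)`: the connected components of `G \ V`. -/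
def graphEdges {X : Type*} [TopologicalSpace X] (G V : Set X) : Set (Set X) :=
  setComponents (G \ V)

/-- The degree of a vertex `v`: the number of edges `e` with `v ∈ closure e \ e`,
where an edge is counted twice if `closure e \ e = {v}`. -/
def vertexDegree {X : Type*} [TopologicalSpace X] (G V : Set X) (v : X) : ℕ :=
  {e ∈ graphEdges G V | v ∈ closure e \ e}.ncard +
    {e ∈ graphEdges G V | closure e \ e = {v}}.ncard

/-- `G` is a lemniscate graph with (finite) vertex set `V`. -/
structure IsLemniscateGraphWith {X : Type*} [TopologicalSpace X] (G V : Set X) : Prop where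
  vertex_subset : V ⊆ G
  vertex_finite : V.Finite
  edges_finite : (graphEdges G V).Finite
  edge_shape : ∀ e ∈ graphEdges G V, IsJordanCurve e ∨ (IsSimpleArc e ∧ closure e \ e ⊆ V)
  degree_even : ∀ v ∈ V, Even (vertexDegree G V v)
  degree_ge_four : ∀ v ∈ V, 4 ≤ vertexDegree G V v

/-- `G` is a lemniscate graph (for some finite vertex set). -/
def IsLemniscateGraph {X : Type*} [TopologicalSpace X] (G : Set X) : Prop :=
  ∃ V, IsLemniscateGraphWith G V

/-- The faces of `G`: the connected components of the complement of `G`. -/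
def graphFaces {X : Type*} [TopologicalSpace X] (G : Set X) : Set (Set X) :=
  setComponents Gᶜ

/-- A 2-coloring of the faces of `G`, recorded by the set `grey` of grey faces:
two distinct faces whose closures share a common edge get different colors. -/
def IsTwoColoring {X : Type*} [TopologicalSpace X] (G V : Set X) (grey : Set (Set X)) : Prop :=
  grey ⊆ graphFaces G ∧
    ∀ F₁ ∈ graphFaces G, ∀ F₂ ∈ graphFaces G, F₁ ≠ F₂ →
      (∃ e ∈ graphEdges G V, e ⊆ closure F₁ ∧ e ⊆ closure F₂) →
      (F₁ ∈ grey ↔ F₂ ∉ grey)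

/-- The distance function of a metric space structure on the Riemann sphere. -/
def mdist (m : MetricSpace (OnePoint ℂ)) : OnePoint ℂ → OnePoint ℂ → ℝ :=
  m.toPseudoMetricSpace.toDist.dist

/-- The metric space structure `m` induces the standard topology of the Riemann sphere. -/
def InducesSphereTopology (m : MetricSpace (OnePoint ℂ)) : Prop :=
  m.toPseudoMetricSpace.toUniformSpace.toTopologicalSpace =
    (inferInstance : TopologicalSpace (OnePoint ℂ))

/-- `E` and `F` are `ε`-homeomorphic with respect to the metric `m`: there is a
homeomorphism of the sphere carrying `E` to `F` and moving points less than `ε`. -/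
def EpsHomeomorphic (m : MetricSpace (OnePoint ℂ)) (ε : ℝ) (E F : Set (OnePoint ℂ)) : Prop :=
  ∃ φ : OnePoint ℂ ≃ₜ OnePoint ℂ, φ '' E = F ∧ ∃ c < ε, ∀ z, mdist m (φ z) z ≤ c

/-- `r` is a rational map on the Riemann sphere: the continuous extension of `p/q`
for coprime polynomials `p`, `q`, not both constant. -/
def IsRationalMap (r : OnePoint ℂ → OnePoint ℂ) : Prop :=
  Continuous r ∧ ∃ p q : ℂ[X], IsCoprime p q ∧ ¬(p.natDegree = 0 ∧ q.natDegree = 0) ∧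
    ∀ z : ℂ, q.eval z ≠ 0 → r (z : OnePoint ℂ) = ((p.eval z / q.eval z : ℂ) : OnePoint ℂ)

/-- The lemniscate of `r` : the preimage of the unit circle. -/
def lemniscate (r : OnePoint ℂ → OnePoint ℂ) : Set (OnePoint ℂ) :=
  r ⁻¹' ((fun w : ℂ => (w : OnePoint ℂ)) '' {w : ℂ | ‖w‖ = 1})

/-- The copy of a planar set inside the Riemann sphere. -/
def toSphere (s : Set ℂ) : Set (OnePoint ℂ) := (fun z : ℂ => (z : OnePoint ℂ)) '' s


/-- A lemniscate domain: a simply connected open set whose boundary is a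
lemniscate graph. -/
def IsLemniscateDomain (Ω : Set ℂ) : Prop :=
  IsOpen Ω ∧ SimplyConnectedSpace Ω ∧ IsLemniscateGraph (frontier Ω)

/-! ### Continuous logarithms on subsets -/

/-- `u` has a continuous logarithm on `K`. -/
def HasLogOn {X : Type*} [TopologicalSpace X] (u : X → ℂ) (K : Set X) : Prop :=
  ∃ g : X → ℂ, ContinuousOn g K ∧ ∀ z ∈ K, Complex.exp (g z) = u z

namespace HasLogOn

variable {X Y : Type*} [TopologicalSpace X] [TopologicalSpace Y] {u v : X → ℂ} {K L : Set X}

lemma congr (h : HasLogOn u K) (huv : ∀ z ∈ K, u z = v z) : HasLogOn v K := by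
  obtain ⟨g, hg, hgu⟩ := h
  exact ⟨g, hg, fun z hz => (hgu z hz).trans (huv z hz)⟩

lemma mul (h : HasLogOn u K) (h' : HasLogOn v K) : HasLogOn (fun z => u z * v z) K := by
  obtain ⟨g, hg, hgu⟩ := h
  obtain ⟨g', hg', hgv⟩ := h'
  exact ⟨fun z => g z + g' z, hg.add hg', fun z hz => by
    rw [Complex.exp_add, hgu z hz, hgv z hz]⟩

lemma inv (h : HasLogOn u K) : HasLogOn (fun z => (u z)⁻¹) K := by
  obtain ⟨g, hg, hgu⟩ := h
  exact ⟨fun z => -g z, hg.neg, fun z hz => by rw [Complex.exp_neg, hgu z hz]⟩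

lemma comp (h : HasLogOn u K) {φ : Y → X} {S : Set Y} (hφ : ContinuousOn φ S)
    (hS : MapsTo φ S K) : HasLogOn (fun y => u (φ y)) S := by
  obtain ⟨g, hg, hgu⟩ := h
  exact ⟨fun y => g (φ y), hg.comp hφ hS, fun y hy => hgu _ (hS hy)⟩

lemma of_norm_sub_one_lt (hu : ContinuousOn u K) (h1 : ∀ z ∈ K, ‖u z - 1‖ < 1) :
    HasLogOn u K := by
  have hs : ∀ z ∈ K, u z ∈ Complex.slitPlane := fun z hz =>
    Complex.ball_one_subset_slitPlane (by simpa [dist_eq_norm] using h1 z hz)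
  exact ⟨fun z => Complex.log (u z), hu.clog hs, fun z hz =>
    Complex.exp_log (Complex.slitPlane_ne_zero (hs z hz))⟩

lemma of_norm_sub_lt (hu : ContinuousOn u K) (hv : ContinuousOn v K)
    (h1 : ∀ z ∈ K, ‖v z - u z‖ < ‖u z‖) (h : HasLogOn u K) : HasLogOn v K := by
  have hu0 : ∀ z ∈ K, u z ≠ 0 := fun z hz h0 => by
    have := h1 z hz
    rw [h0, norm_zero] at this
    exact absurd this (not_lt.2 (norm_nonneg _))
  have : HasLogOn (fun z => v z / u z) K := by
    refine of_norm_sub_one_lt (hv.div hu hu0) fun z hz => ?_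
    rw [div_sub_one (hu0 z hz), norm_div, div_lt_one (norm_pos_iff.2 (hu0 z hz))]
    exact h1 z hz
  exact (this.mul h).congr fun z hz => div_mul_cancel₀ _ (hu0 z hz)

end HasLogOn

/-- Two continuous logarithms of the same function differ by a constant on a preconnected set. -/
lemma sub_eq_sub_of_exp_eq_exp {X : Type*} [TopologicalSpace X] {S : Set X}
    (hS : IsPreconnected S) {g₁ g₂ : X → ℂ} (h₁ : ContinuousOn g₁ S) (h₂ : ContinuousOn g₂ S)
    (h : ∀ x ∈ S, Complex.exp (g₁ x) = Complex.exp (g₂ x)) {x y : X} (hx : x ∈ S) (hy : y ∈ S) :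
    g₁ x - g₂ x = g₁ y - g₂ y := by
  have key : ∀ z ∈ S, ∃ n : ℤ, g₁ z - g₂ z = n * (2 * Real.pi * Complex.I) := fun z hz => by
    obtain ⟨n, hn⟩ := Complex.exp_eq_exp_iff_exists_int.1 (h z hz)
    exact ⟨n, by rw [hn]; ring⟩
  let φ : X → ℝ := fun z => (g₁ z - g₂ z).im / (2 * Real.pi)
  have hφ : ContinuousOn φ S :=
    (Complex.continuous_im.comp_continuousOn (h₁.sub h₂)).div_const _
  have hpi : (2 * Real.pi) ≠ 0 := by positivity
  have hφn : ∀ z ∈ S, ∀ n : ℤ, g₁ z - g₂ z = n * (2 * Real.pi * Complex.I) → φ z = n := by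
    intro z _ n hn
    simp only [φ, hn]
    simp
  have aux : ∀ x ∈ S, ∀ y ∈ S, ∀ m n : ℤ, φ x = m → φ y = n → ¬ m < n := by
    intro x hx y hy m n hm hn hmn
    have hmid : ((m : ℝ) + 1 / 2) ∈ Icc (φ x) (φ y) := by
      rw [hm, hn]
      have : (m : ℝ) + 1 ≤ n := by exact_mod_cast hmn
      constructor <;> linarith
    obtain ⟨z, hz, hzm⟩ := hS.intermediate_value hx hy hφ hmid
    obtain ⟨k, hk⟩ := key z hz
    have := (hφn z hz k hk).symm.trans hzm
    have h2 : (2 * k : ℝ) = 2 * m + 1 := by linarith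
    have h3 : 2 * k = 2 * m + 1 := by exact_mod_cast h2
    omega
  obtain ⟨m, hm⟩ := key x hx
  obtain ⟨n, hn⟩ := key y hy
  have := aux x hx y hy m n (hφn x hx m hm) (hφn y hy n hn)
  have := aux y hy x hx n m (hφn y hy n hn) (hφn x hx m hm)
  have : m = n := by omega
  rw [hm, hn, this]

lemma HasLogOn.union {X : Type*} [TopologicalSpace X] {u : X → ℂ} {K L : Set X}
    (hK : IsClosed K) (hL : IsClosed L) (hKL : IsPreconnected (K ∩ L))
    (h₁ : HasLogOn u K) (h₂ : HasLogOn u L) : HasLogOn u (K ∪ L) := by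
  classical
  obtain ⟨g₁, hg₁, hu₁⟩ := h₁
  obtain ⟨g₂, hg₂, hu₂⟩ := h₂
  obtain ⟨c, hc, hgc⟩ : ∃ c : ℂ, Complex.exp c = 1 ∧ ∀ x ∈ K ∩ L, g₁ x = g₂ x + c := by
    rcases (K ∩ L).eq_empty_or_nonempty with h0 | ⟨x₀, hx₀⟩
    · exact ⟨0, Complex.exp_zero, fun x hx => absurd hx (by simp [h0])⟩
    · refine ⟨g₁ x₀ - g₂ x₀, ?_, fun x hx => ?_⟩
      · rw [Complex.exp_sub, hu₁ _ hx₀.1, ← hu₂ _ hx₀.2, div_self (Complex.exp_ne_zero _)]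
      · have := sub_eq_sub_of_exp_eq_exp hKL (hg₁.mono inter_subset_left)
          (hg₂.mono inter_subset_right)
          (fun z hz => (hu₁ z hz.1).trans (hu₂ z hz.2).symm) hx hx₀
        rw [← this]; ring
  refine ⟨fun x => if x ∈ K then g₁ x else g₂ x + c, ?_, ?_⟩
  · refine ContinuousOn.union_of_isClosed ?_ ?_ hK hL
    · exact hg₁.congr fun x hx => if_pos hx
    · refine (hg₂.add (continuousOn_const (c := c))).congr fun x hx => ?_
      by_cases hxK : x ∈ K
      · simpa [hxK] using hgc x ⟨hxK, hx⟩
      · simp [hxK]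
  · intro x hx
    by_cases hxK : x ∈ K
    · simpa [hxK] using hu₁ x hxK
    · simpa [hxK, Complex.exp_add, hc] using hu₂ x (hx.resolve_left hxK)

lemma hasLogOn_univ {u : ℂ → ℂ} (hu : Continuous u) (h0 : ∀ z, u z ≠ 0) :
    HasLogOn u univ := by
  have hs : IsSimplyConnected (univ : Set ℂ) := by
    unfold IsSimplyConnected
    have : ContractibleSpace (univ : Set ℂ) :=
      (Homeomorph.Set.univ ℂ).contractibleSpace
    infer_instance
  obtain ⟨f, hf, hfu⟩ := Complex.exists_continuousOn_eqOn_exp_comp hs isOpen_univ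
    hu.continuousOn (by simpa using h0)
  exact ⟨f, hf, fun z hz => hfu hz⟩

lemma not_eq_sub_outside {G : ℂ → ℂ} (hG : Continuous G) (h0 : ∀ z, G z ≠ 0) (a : ℂ) (R : ℝ)
    (hR : ∀ z, R ≤ ‖z‖ → G z = z - a) : False := by
  obtain ⟨l, hl, hlG⟩ := hasLogOn_univ hG h0
  rw [continuousOn_univ] at hl
  set r : ℝ := max R (‖a‖ + 1) with hr
  have hr0 : 0 < r := lt_of_lt_of_le (by positivity) (le_max_right _ _)
  have har : ‖a‖ < r := lt_of_lt_of_le (by linarith) (le_max_right _ _)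
  let e : ℝ → ℂ := fun x => Complex.exp (x * Complex.I)
  have he : Continuous e := by fun_prop
  have hne : ∀ x, ‖e x‖ = 1 := fun x => Complex.norm_exp_ofReal_mul_I x
  have he0 : ∀ x, e x ≠ 0 := fun x => Complex.exp_ne_zero _
  let w : ℝ → ℂ := fun x => 1 - a / (r * e x)
  have hrC : (r : ℂ) ≠ 0 := by exact_mod_cast hr0.ne'
  have hw : Continuous w :=
    continuous_const.sub (continuous_const.div (continuous_const.mul he) fun x =>
      mul_ne_zero hrC (he0 x))
  have hws : ∀ x, w x ∈ Complex.slitPlane := fun x =>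
    Complex.ball_one_subset_slitPlane (by
      simp only [w, mem_ball, dist_eq_norm]
      rw [show (1 : ℂ) - a / (r * e x) - 1 = -(a / (r * e x)) by ring, norm_neg, norm_div,
        norm_mul, hne, mul_one, Complex.norm_real, Real.norm_of_nonneg hr0.le, div_lt_one hr0]
      exact har)
  let g₂ : ℝ → ℂ := fun x => x * Complex.I + Complex.log r + Complex.log (w x)
  have hg₂ : Continuous g₂ := by
    have : Continuous fun x => Complex.log (w x) := hw.clog hws
    fun_prop
  have hg₁ : Continuous fun x => l (r * e x) := by fun_prop
  have hexp : ∀ x ∈ (univ : Set ℝ), Complex.exp (l (r * e x)) = Complex.exp (g₂ x) := by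
    intro x _
    rw [hlG _ (mem_univ _), hR _ (by
      rw [norm_mul, hne, mul_one, Complex.norm_real, Real.norm_of_nonneg hr0.le]
      exact le_max_left _ _), Complex.exp_add, Complex.exp_add, Complex.exp_log hrC,
      Complex.exp_log (Complex.slitPlane_ne_zero (hws x))]
    simp only [w]
    change r * e x - a = e x * r * (1 - a / (r * e x))
    have := he0 x
    field_simp
  have hc := sub_eq_sub_of_exp_eq_exp isPreconnected_univ hg₁.continuousOn hg₂.continuousOn hexp
    (mem_univ 0) (mem_univ (2 * Real.pi))
  have e0 : e (2 * Real.pi) = e 0 := by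
    simp only [e]
    push_cast
    rw [Complex.exp_two_pi_mul_I]; simp
  have hw0 : w (2 * Real.pi) = w 0 := by simp only [w, e0]
  simp only [g₂, hw0, e0] at hc
  have : ((2 * Real.pi : ℝ) : ℂ) * Complex.I = 0 := by
    push_cast at hc ⊢
    linear_combination hc
  have h2 := mul_eq_zero.1 this
  rcases h2 with h2 | h2
  · have : 2 * Real.pi = 0 := by exact_mod_cast h2
    have := Real.pi_pos
    linarith
  · exact Complex.I_ne_zero h2


/-! ### Separation of points by compact plane sets -/

lemma frontier_connectedComponentIn_compl_subset {K : Set ℂ} (hK : IsClosed K) (a : ℂ) :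
    frontier (connectedComponentIn Kᶜ a) ⊆ K := by
  intro x hx
  by_contra hxK
  have ho : IsOpen (connectedComponentIn Kᶜ a) := hK.isOpen_compl.connectedComponentIn
  have hn : connectedComponentIn Kᶜ x ∈ 𝓝 x :=
    connectedComponentIn_mem_nhds (hK.isOpen_compl.mem_nhds hxK)
  obtain ⟨y, hy, hya⟩ := mem_closure_iff_nhds.1 hx.1 _ hn
  have := connectedComponentIn_eq hy
  rw [← connectedComponentIn_eq hya] at this
  rw [ho.frontier_eq] at hx
  exact hx.2 (this ▸ mem_connectedComponentIn hxK)

lemma IsPreconnected.subset_of_inter_frontier {S D : Set ℂ} (hS : IsPreconnected S)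
    (hD : IsOpen D) (hne : (S ∩ D).Nonempty) (hfr : S ∩ frontier D = ∅) : S ⊆ D := by
  refine hS.subset_left_of_subset_union hD isClosed_closure.isOpen_compl
    (disjoint_compl_right.mono_left subset_closure |>.mono_right le_rfl) ?_ hne
  intro x hx
  by_cases hxD : x ∈ closure D
  · left
    by_contra hxD'
    exact (hfr.subset ⟨hx, by rw [hD.frontier_eq]; exact ⟨hxD, hxD'⟩⟩ : x ∈ (∅ : Set ℂ))
  · exact Or.inr hxD

lemma isPreconnected_compl_closedBall (c : ℂ) {r : ℝ} (hr : 0 < r) :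
    IsPreconnected (closedBall c r)ᶜ := by
  have : (closedBall c r)ᶜ = (fun z => c + Complex.exp z) '' {z : ℂ | Real.log r < z.re} := by
    ext z
    simp only [mem_compl_iff, mem_closedBall, not_le, mem_image, mem_ofPred_eq]
    constructor
    · intro hz
      have hz0 : z - c ≠ 0 := by
        intro h
        rw [sub_eq_zero.1 h, dist_self] at hz
        linarith
      refine ⟨Complex.log (z - c), ?_, by rw [Complex.exp_log hz0]; ring⟩
      rw [Complex.log_re, ← dist_eq_norm]
      exact Real.log_lt_log hr hz
    · rintro ⟨w, hw, rfl⟩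
      rw [dist_eq_norm, add_sub_cancel_left, Complex.norm_exp]
      exact (Real.log_lt_iff_lt_exp hr).1 hw
  rw [this]
  refine IsPreconnected.image ?_ _ (by fun_prop)
  exact (convex_halfSpace_re_gt _).isPreconnected

lemma hasLogOn_div_of_mem_connectedComponentIn {K : Set ℂ} (hK : IsClosed K) {a b : ℂ}
    (hb : b ∈ connectedComponentIn Kᶜ a) : HasLogOn (fun z => (z - a) / (z - b)) K := by
  have ha : a ∈ Kᶜ := by
    by_contra h
    rw [connectedComponentIn_eq_empty h] at hb
    exact hb
  have hsub : connectedComponentIn Kᶜ a ⊆ Kᶜ := connectedComponentIn_subset _ _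
  have hne : ∀ x ∈ Kᶜ, ∀ z ∈ K, z - x ≠ 0 := fun x hx z hz h =>
    hx (by rwa [← sub_eq_zero.1 h])
  refine (isPreconnected_connectedComponentIn (F := Kᶜ) (x := a)).induction₂'
    (fun x y => HasLogOn (fun z => (z - x) / (z - y)) K) ?_ ?_
    (mem_connectedComponentIn ha) hb
  · intro x hx
    obtain ⟨d, hd, hdK⟩ := Metric.isOpen_iff.1 hK.isOpen_compl x (hsub hx)
    have hlog : ∀ y ∈ ball x (d / 2), HasLogOn (fun z => (z - x) / (z - y)) K := by
      intro y hy
      have hzy : ∀ z ∈ K, d / 2 < ‖z - y‖ := by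
        intro z hz
        have h1 : d ≤ dist z x := by
          by_contra h
          exact hdK (mem_ball.2 (not_le.1 h)) hz
        have h2 := dist_triangle z y x
        rw [← dist_eq_norm]
        linarith [mem_ball.1 hy]
      have hzy0 : ∀ z ∈ K, z - y ≠ 0 := fun z hz h => by
        have := hzy z hz
        rw [h, norm_zero] at this
        linarith
      refine HasLogOn.of_norm_sub_one_lt
        ((by fun_prop : ContinuousOn _ _).div (by fun_prop) hzy0) fun z hz => ?_
      rw [div_sub_one (hzy0 z hz), norm_div,
        div_lt_one (norm_pos_iff.2 (hzy0 z hz)), show z - x - (z - y) = y - x by ring,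
        ← dist_eq_norm]
      exact (mem_ball.1 hy).trans (hzy z hz)
    filter_upwards [mem_nhdsWithin_of_mem_nhds (ball_mem_nhds x (half_pos hd))] with y hy
    exact ⟨hlog y hy, (hlog y hy).inv.congr fun z _ => inv_div _ _⟩
  · intro x y z _ hy _ hxy hyz
    refine (hxy.mul hyz).congr fun w hw => ?_
    exact div_mul_div_cancel₀ (hne y (hsub hy) w hw)

lemma mem_connectedComponentIn_of_hasLogOn_of_isBounded {K : Set ℂ} (hK : IsCompact K) {a b : ℂ}
    (ha : a ∉ K) (hb : b ∉ K) (h : HasLogOn (fun z => (z - a) / (z - b)) K)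
    (hbd : Bornology.IsBounded (connectedComponentIn Kᶜ a)) :
    b ∈ connectedComponentIn Kᶜ a := by
  classical
  by_contra hbC
  set C := connectedComponentIn Kᶜ a
  have hfr : frontier C ⊆ K := frontier_connectedComponentIn_compl_subset hK.isClosed a
  have haC : a ∈ C := mem_connectedComponentIn ha
  obtain ⟨g, hg, hgu⟩ := h
  obtain ⟨G, hG⟩ := ContinuousMap.exists_restrict_eq hK.isClosed
    (⟨K.domRestrict g, hg.domRestrict⟩ : C(K, ℂ))
  have hGg : ∀ z ∈ K, G z = g z := fun z hz => by
    exact DFunLike.congr_fun hG ⟨z, hz⟩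
  obtain ⟨R, hR⟩ := hbd.subset_ball 0
  refine not_eq_sub_outside (G := fun z => if z ∈ C then Complex.exp (G z) * (z - b) else z - a)
    ?_ ?_ a R ?_
  · refine Continuous.if ?_ (by fun_prop) (by fun_prop)
    intro z hz
    have hzK := hfr hz
    rw [hGg z hzK, hgu z hzK, div_mul_cancel₀]
    intro h0
    exact hb (by rwa [← sub_eq_zero.1 h0])
  · intro z
    split_ifs with hz
    · refine mul_ne_zero (Complex.exp_ne_zero _) fun h0 => hbC ?_
      rwa [← sub_eq_zero.1 h0]
    · intro h0
      exact hz (by rwa [sub_eq_zero.1 h0])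
  · intro z hz
    refine if_neg fun hzC => ?_
    have := mem_ball_zero_iff.1 (hR hzC)
    linarith

lemma mem_connectedComponentIn_symm {K : Set ℂ} {a b : ℂ} (ha : a ∈ K)
    (h : b ∈ connectedComponentIn K a) : a ∈ connectedComponentIn K b := by
  rw [← connectedComponentIn_eq h]
  exact mem_connectedComponentIn ha

/-- Eilenberg's criterion: points whose quotient of distances functions has a continuous logarithm
on a compact set are not separated by that set. -/
lemma mem_connectedComponentIn_of_hasLogOn {K : Set ℂ} (hK : IsCompact K) {a b : ℂ}
    (ha : a ∉ K) (hb : b ∉ K) (h : HasLogOn (fun z => (z - a) / (z - b)) K) :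
    b ∈ connectedComponentIn Kᶜ a := by
  by_cases h1 : Bornology.IsBounded (connectedComponentIn Kᶜ a)
  · exact mem_connectedComponentIn_of_hasLogOn_of_isBounded hK ha hb h h1
  by_cases h2 : Bornology.IsBounded (connectedComponentIn Kᶜ b)
  · exact mem_connectedComponentIn_symm hb
      (mem_connectedComponentIn_of_hasLogOn_of_isBounded hK hb ha
        (h.inv.congr fun z _ => inv_div _ _) h2)
  obtain ⟨R, hR0, hR⟩ := hK.isBounded.subset_closedBall_lt 0 0
  have hsub : (closedBall (0 : ℂ) R)ᶜ ⊆ Kᶜ := compl_subset_compl.2 hR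
  have key : ∀ c, ¬ Bornology.IsBounded (connectedComponentIn Kᶜ c) →
      (closedBall (0 : ℂ) R)ᶜ ⊆ connectedComponentIn Kᶜ c := by
    intro c hc
    obtain ⟨x, hx, hxR⟩ : ∃ x ∈ connectedComponentIn Kᶜ c, x ∉ closedBall (0 : ℂ) R := by
      by_contra! hcon
      exact hc (isBounded_closedBall.subset hcon)
    rw [connectedComponentIn_eq hx]
    exact (isPreconnected_compl_closedBall 0 hR0).subset_connectedComponentIn hxR hsub
  obtain ⟨x, hx⟩ : ((closedBall (0 : ℂ) R)ᶜ).Nonempty := by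
    refine ⟨((R + 1 : ℝ) : ℂ), ?_⟩
    simp only [mem_compl_iff, mem_closedBall, dist_zero_right, Complex.norm_real, not_le]
    rw [Real.norm_of_nonneg (by linarith)]
    linarith
  rw [connectedComponentIn_eq (key a h1 hx), ← connectedComponentIn_eq (key b h2 hx)]
  exact mem_connectedComponentIn hb

/-- Janiszewski's theorem. -/
lemma mem_connectedComponentIn_compl_union {K L : Set ℂ} (hK : IsCompact K) (hL : IsCompact L)
    (hKL : IsPreconnected (K ∩ L)) {a b : ℂ} (h₁ : b ∈ connectedComponentIn Kᶜ a)
    (h₂ : b ∈ connectedComponentIn Lᶜ a) : b ∈ connectedComponentIn (K ∪ L)ᶜ a := by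
  have hm : ∀ {M : Set ℂ}, b ∈ connectedComponentIn Mᶜ a → a ∉ M ∧ b ∉ M := fun {M} hM => by
    refine ⟨fun h => ?_, fun h => connectedComponentIn_subset _ _ hM h⟩
    rw [connectedComponentIn_eq_empty (not_not.2 h)] at hM
    exact hM
  refine mem_connectedComponentIn_of_hasLogOn (hK.union hL) (not_or.2 ⟨(hm h₁).1, (hm h₂).1⟩)
    (not_or.2 ⟨(hm h₁).2, (hm h₂).2⟩) ?_
  exact HasLogOn.union hK.isClosed hL.isClosed hKL
    (hasLogOn_div_of_mem_connectedComponentIn hK.isClosed h₁)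
    (hasLogOn_div_of_mem_connectedComponentIn hL.isClosed h₂)

/-! ### Logarithms on domains bounded by continua -/

lemma exists_isCompact_isConnected_of_isOpen {D : Set ℂ} (hD : IsOpen D) (hc : IsConnected D)
    {x y : ℂ} (hx : x ∈ D) (hy : y ∈ D) :
    ∃ P ⊆ D, IsCompact P ∧ IsConnected P ∧ x ∈ P ∧ y ∈ P := by
  obtain ⟨p, hp⟩ := ((hD.isConnected_iff_isPathConnected.1 hc).joinedIn x hx y hy)
  refine ⟨range p, ?_, isCompact_range p.continuous, isConnected_range p.continuous,
    ⟨0, p.source⟩, ⟨1, p.target⟩⟩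
  rintro _ ⟨t, rfl⟩
  exact hp t

lemma hasLogOn_of_forall_isCompact {D : Set ℂ} (hD : IsOpen D) (hc : IsConnected D) {u : ℂ → ℂ}
    (h : ∀ L ⊆ D, IsCompact L → HasLogOn u L) : HasLogOn u D := by
  obtain ⟨z₀, hz₀⟩ := hc.nonempty
  have hP : ∀ z : ℂ, z ∈ D → ∃ P ⊆ D, IsCompact P ∧ IsConnected P ∧ z₀ ∈ P ∧ z ∈ P := fun z hz =>
    exists_isCompact_isConnected_of_isOpen hD hc hz₀ hz
  choose! P hPD hPc hPconn hPz₀ hPz using hP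
  have hlog : ∀ z : ℂ, z ∈ D → ∃ g : ℂ → ℂ, ContinuousOn g (P z) ∧
      ∀ w ∈ P z, Complex.exp (g w) = u w := fun z hz => h (P z) (hPD z hz) (hPc z hz)
  choose! g hg hgu using hlog
  have hu₀ : Complex.exp (Complex.log (u z₀)) = u z₀ :=
    Complex.exp_log (by rw [← hgu z₀ hz₀ z₀ (hPz₀ _ hz₀)]; exact Complex.exp_ne_zero _)
  set c := Complex.log (u z₀)
  let l : ℂ → ℂ := fun z => g z z - g z z₀ + c
  have hl : ∀ z ∈ D, ∀ L ⊆ D, IsCompact L → IsConnected L → z₀ ∈ L → z ∈ L → ∀ k : ℂ → ℂ,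
      ContinuousOn k L → (∀ w ∈ L, Complex.exp (k w) = u w) → l z = k z - k z₀ + c := by
    intro z hz L hLD hLc hLconn hzL₀ hzL k hk hku
    obtain ⟨m, hm, hmu⟩ := h (P z ∪ L) (union_subset (hPD z hz) hLD) ((hPc z hz).union hLc)
    have e1 := sub_eq_sub_of_exp_eq_exp (hPconn z hz).isPreconnected (hg z hz)
      (hm.mono subset_union_left)
      (fun x hx => (hgu z hz x hx).trans (hmu x (Or.inl hx)).symm) (hPz z hz) (hPz₀ z hz)
    have e2 := sub_eq_sub_of_exp_eq_exp hLconn.isPreconnected hk (hm.mono subset_union_right)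
      (fun x hx => (hku x hx).trans (hmu x (Or.inr hx)).symm) hzL hzL₀
    simp only [l]
    linear_combination e1 - e2
  refine ⟨l, fun z hz => ?_, fun z hz => ?_⟩
  · obtain ⟨r, hr, hrD⟩ := nhds_basis_closedBall.mem_iff.1 (hD.mem_nhds hz)
    have hLD : P z ∪ closedBall z r ⊆ D := union_subset (hPD z hz) hrD
    have hLc := (hPc z hz).union (isCompact_closedBall z r)
    have hLconn : IsConnected (P z ∪ closedBall z r) :=
      (hPconn z hz).union ⟨z, hPz z hz, mem_closedBall_self hr.le⟩
        ((convex_closedBall z r).isConnected ⟨z, mem_closedBall_self hr.le⟩)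
    obtain ⟨k, hk, hku⟩ := h _ hLD hLc
    have hk' : ContinuousAt k z :=
      (hk.mono subset_union_right).continuousAt (closedBall_mem_nhds z hr)
    have : ContinuousAt (fun w => k w - k z₀ + c) z := by fun_prop
    refine (this.congr ?_).continuousWithinAt
    filter_upwards [closedBall_mem_nhds z hr] with w hw
    exact (hl w (hrD hw) _ hLD hLc hLconn (Or.inl (hPz₀ z hz)) (Or.inr hw) k hk hku).symm
  · simp only [l]
    rw [Complex.exp_add, Complex.exp_sub, hgu z hz z (hPz z hz), hgu z hz z₀ (hPz₀ z hz), hu₀]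
    refine div_mul_cancel₀ _ ?_
    rw [← hu₀]; exact Complex.exp_ne_zero _

lemma connectedComponentIn_inter_frontier_nonempty {M D : Set ℂ} (hM : IsCompact M)
    (hMne : M.Nonempty) (hD : IsOpen D) (hMD : M ⊆ D) {a : ℂ} (ha : a ∉ D) :
    (connectedComponentIn Mᶜ a ∩ frontier D).Nonempty := by
  have haM : a ∈ Mᶜ := fun h => ha (hMD h)
  by_contra hcon
  rw [not_nonempty_iff_eq_empty] at hcon
  set W := connectedComponentIn Mᶜ a
  have haW : a ∈ W := mem_connectedComponentIn haM
  have hne : (frontier W).Nonempty := by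
    rw [nonempty_iff_ne_empty, Ne, frontier_eq_empty_iff.not]
    push Not
    refine ⟨⟨a, haW⟩, fun h => ?_⟩
    obtain ⟨m, hm⟩ := hMne
    exact connectedComponentIn_subset _ _ (h ▸ mem_univ m : m ∈ W) hm
  obtain ⟨x, hx⟩ := hne
  have hxD : x ∈ D := hMD (frontier_connectedComponentIn_compl_subset hM.isClosed a hx)
  obtain ⟨y, hyD, hyW⟩ := mem_closure_iff.1 hx.1 D hD hxD
  exact ha (isPreconnected_connectedComponentIn.subset_of_inter_frontier hD ⟨y, hyW, hyD⟩ hcon haW)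

lemma isPreconnected_thickening {K : Set ℂ} (hK : IsPreconnected K) (τ : ℝ) :
    IsPreconnected (thickening τ K) := by
  rw [thickening_eq_biUnion_ball]
  rcases le_or_gt τ 0 with hτ | hτ
  · simp [ball_eq_empty.2 hτ, isPreconnected_empty]
  refine isPreconnected_of_forall_pair fun x hx y hy => ?_
  simp only [mem_iUnion] at hx hy
  obtain ⟨p, hp, hxp⟩ := hx
  obtain ⟨q, hq, hyq⟩ := hy
  refine ⟨ball p τ ∪ K ∪ ball q τ, ?_, Or.inl (Or.inl hxp), Or.inr hyq, ?_⟩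
  · refine union_subset (union_subset (subset_biUnion_of_mem (u := fun k => ball k τ) hp)
      fun k hk => ?_) (subset_biUnion_of_mem (u := fun k => ball k τ) hq)
    exact mem_biUnion hk (mem_ball_self hτ)
  · refine IsPreconnected.union q (Or.inr hq) (mem_ball_self hτ)
      (IsPreconnected.union p (mem_ball_self hτ) hp ?_ hK) ?_ <;>
    exact (convex_ball _ _).isPreconnected

/-- A domain cut out by a continuum: a bounded component of the complement of a compact
connected set. -/
structure IsContinuumDomain (D K : Set ℂ) : Prop where
  isCompact : IsCompact K
  isPreconnected : IsPreconnected K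
  isBounded : Bornology.IsBounded D
  eq_component : ∃ z, z ∉ K ∧ D = connectedComponentIn Kᶜ z

namespace IsContinuumDomain

variable {D K : Set ℂ}

lemma isOpen (h : IsContinuumDomain D K) : IsOpen D := by
  obtain ⟨z, -, rfl⟩ := h.eq_component
  exact h.isCompact.isClosed.isOpen_compl.connectedComponentIn

lemma isConnected (h : IsContinuumDomain D K) : IsConnected D := by
  obtain ⟨z, hz, rfl⟩ := h.eq_component
  exact ⟨⟨z, mem_connectedComponentIn hz⟩, isPreconnected_connectedComponentIn⟩

lemma frontier_subset (h : IsContinuumDomain D K) : frontier D ⊆ K := by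
  obtain ⟨z, -, rfl⟩ := h.eq_component
  exact frontier_connectedComponentIn_compl_subset h.isCompact.isClosed z

lemma subset_compl (h : IsContinuumDomain D K) : D ⊆ Kᶜ := by
  obtain ⟨z, -, rfl⟩ := h.eq_component
  exact connectedComponentIn_subset _ _

lemma eq_connectedComponentIn (h : IsContinuumDomain D K) {x : ℂ} (hx : x ∈ D) :
    D = connectedComponentIn Kᶜ x := by
  obtain ⟨z, -, rfl⟩ := h.eq_component
  exact connectedComponentIn_eq hx

lemma mem_connectedComponentIn_image (h : IsContinuumDomain D K) {g : ℂ → ℂ}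
    (hg : ContinuousOn g D) (hgD : IsOpen (g '' D)) {L : Set ℂ}
    (hL : IsCompact L) (hLD : L ⊆ D) (hLne : L.Nonempty) (hinj : InjOn g D) {a b : ℂ}
    (ha : a ∉ g '' D) (hb : b ∉ g '' D) : b ∈ connectedComponentIn (g '' L)ᶜ a := by
  have hLK : Disjoint L K := disjoint_left.2 fun x hx => h.subset_compl (hLD hx)
  obtain ⟨τ, hτ, hτd⟩ := hLK.exists_thickenings hL h.isCompact.isClosed
  have hτL : thickening τ K ⊆ Lᶜ := fun x hx hxL =>
    disjoint_left.1 hτd (self_subset_thickening hτ L hxL) hx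
  have hgL : ∀ S ⊆ D, IsCompact S → IsCompact (g '' S) := fun S hS hSc =>
    hSc.image_of_continuousOn (hg.mono hS)
  have hL2 : IsCompact (closure D \ thickening τ K) :=
    h.isBounded.isCompact_closure.diff isOpen_thickening
  have hL2D : closure D \ thickening τ K ⊆ D := by
    intro x hx
    by_contra hxD
    refine hx.2 (self_subset_thickening hτ K (h.frontier_subset ?_))
    rw [h.isOpen.frontier_eq]
    exact ⟨hx.1, hxD⟩
  have key : ∀ c ∉ g '' D, ∃ x ∈ D, x ∈ thickening τ K ∧
      g x ∈ connectedComponentIn (g '' L)ᶜ c := by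
    intro c hc
    obtain ⟨b, hbW, hbf⟩ := connectedComponentIn_inter_frontier_nonempty (hgL L hLD hL)
      (hLne.image g) hgD (image_mono hLD) hc
    have hbD : b ∉ g '' D := by
      rw [hgD.frontier_eq] at hbf
      exact hbf.2
    have ho : IsOpen (connectedComponentIn (g '' L)ᶜ c \ g '' (closure D \ thickening τ K)) :=
      (hgL L hLD hL).isClosed.isOpen_compl.connectedComponentIn.sdiff (hgL _ hL2D hL2).isClosed
    obtain ⟨y, ⟨hyW, hy⟩, x, hxD, rfl⟩ := mem_closure_iff.1 hbf.1 _ ho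
      ⟨hbW, fun hb' => hbD (image_mono hL2D hb')⟩
    refine ⟨x, hxD, ?_, hyW⟩
    by_contra hx
    exact hy ⟨x, ⟨subset_closure hxD, hx⟩, rfl⟩
  obtain ⟨x, hxD, hxτ, hx⟩ := key a ha
  obtain ⟨y, hyD, hyτ, hy⟩ := key b hb
  have h1 : y ∈ connectedComponentIn Kᶜ x := by rwa [← h.eq_connectedComponentIn hxD]
  have h2 : y ∈ connectedComponentIn Lᶜ x :=
    (isPreconnected_thickening h.isPreconnected τ).subset_connectedComponentIn hxτ hτL hyτ
  have h3 := mem_connectedComponentIn_compl_union h.isCompact hL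
    (by rw [inter_comm, hLK.inter_eq]; exact isPreconnected_empty) h1 h2
  set C := connectedComponentIn (K ∪ L)ᶜ x
  have hCD : C ⊆ D := by
    rw [h.eq_connectedComponentIn hxD]
    exact connectedComponentIn_mono x (compl_subset_compl.2 subset_union_left)
  have hxC : x ∈ C := mem_connectedComponentIn (by
    rintro (h' | h')
    · exact h.subset_compl hxD h'
    · exact hτL hxτ h')
  have h4 : g '' C ⊆ connectedComponentIn (g '' L)ᶜ (g x) := by
    refine (isPreconnected_connectedComponentIn.image g (hg.mono hCD)).subset_connectedComponentIn
      (mem_image_of_mem g hxC) ?_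
    rintro _ ⟨w, hw, rfl⟩ ⟨w', hw', hww⟩
    have : w' = w := hinj (hLD hw') (hCD hw) hww
    exact connectedComponentIn_subset _ _ hw (Or.inr (this ▸ hw'))
  have h5 := h4 (mem_image_of_mem g h3)
  rw [← connectedComponentIn_eq hx] at h5
  rw [connectedComponentIn_eq h5, ← connectedComponentIn_eq hy]
  exact mem_connectedComponentIn fun hb' => hb (image_mono hLD hb')

/-- Images of a continuum domain under embeddings into bounded open sets carry logarithms of the
linear functions without zeros. -/
lemma hasLogOn_sub (h : IsContinuumDomain D K) {g : ℂ → ℂ}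
    (hg : ContinuousOn g D) (hgD : IsOpen (g '' D)) (hinj : InjOn g D)
    (hbd : Bornology.IsBounded (g '' D)) {a : ℂ} (ha : a ∉ g '' D) :
    HasLogOn (fun z => g z - a) D := by
  refine hasLogOn_of_forall_isCompact h.isOpen h.isConnected fun L hLD hL => ?_
  rcases L.eq_empty_or_nonempty with rfl | hLne
  · exact ⟨fun _ => 0, continuousOn_empty _, by simp⟩
  obtain ⟨R, hR0, hR⟩ := hbd.subset_ball_lt 0 0
  have hR' : ∀ z ∈ D, ‖g z‖ < R := fun z hz => mem_ball_zero_iff.1 (hR (mem_image_of_mem g hz))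
  have hRC : (R : ℂ) ≠ 0 := by exact_mod_cast hR0.ne'
  have hRn : ‖(R : ℂ)‖ = R := by rw [Complex.norm_real, Real.norm_of_nonneg hR0.le]
  have hb : (R : ℂ) ∉ g '' D := by
    rintro ⟨z, hz, hzR⟩
    have := hR' z hz
    rw [hzR, hRn] at this
    exact lt_irrefl _ this
  have h1 := hasLogOn_div_of_mem_connectedComponentIn
    ((hL.image_of_continuousOn (hg.mono hLD)).isClosed)
    (h.mem_connectedComponentIn_image hg hgD hL hLD hLne hinj ha hb)
  have h2 := h1.comp (hg.mono hLD) (mapsTo_image g L)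
  have h3 : HasLogOn (fun z => g z - R) L := by
    refine HasLogOn.of_norm_sub_lt (u := fun _ => -(R : ℂ)) continuousOn_const
      ((hg.mono hLD).sub continuousOn_const) (fun z hz => ?_)
      ⟨fun _ => Complex.log (-R), continuousOn_const, fun _ _ => Complex.exp_log (neg_ne_zero.2 hRC)⟩
    simp only [norm_neg, hRn, sub_neg_eq_add, sub_add_cancel]
    exact hR' z (hLD hz)
  refine (h2.mul h3).congr fun z hz => div_mul_cancel₀ _ fun h0 => hb ?_
  exact ⟨z, hLD hz, sub_eq_zero.1 h0⟩

end IsContinuumDomain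

/-! ### Limits of holomorphic functions -/

lemma tendstoUniformlyOn_of_tendsto_of_equicontinuous {X ι : Type*} [PseudoMetricSpace X]
    {l : Filter ι} {F : ι → X → ℂ} {f : X → ℂ} {K : Set X} (hK : IsCompact K)
    (hF : ∀ x ∈ K, Tendsto (fun n => F n x) l (𝓝 (f x)))
    (heq : ∀ x ∈ K, ∀ ε > 0, ∃ δ > 0, ∀ᶠ n in l, ∀ y ∈ K, dist y x < δ →
      dist (F n y) (F n x) < ε) : TendstoUniformlyOn F f l K := by
  rcases l.eq_or_neBot with rfl | hl
  · exact fun _ _ => by simp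
  rw [Metric.tendstoUniformlyOn_iff]
  intro ε hε
  choose! δ hδ hδF using fun x hx => heq x hx (ε / 4) (by positivity)
  obtain ⟨t, htK⟩ := hK.elim_nhds_subcover' (fun x _ => ball x (δ x))
    (fun x hx => ball_mem_nhds x (hδ x hx))
  have h1 : ∀ᶠ n in l, ∀ x ∈ t, (∀ y ∈ K, dist y x < δ x → dist (F n y) (F n x) < ε / 4) ∧
      dist (F n x) (f x) < ε / 4 := by
    rw [Filter.eventually_all_finset]
    intro x _
    exact (hδF x x.2).and ((hF x x.2).eventually (ball_mem_nhds _ (by positivity)))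
  have h2 : ∀ x ∈ K, ∀ y ∈ K, dist y x < δ x → dist (f y) (f x) ≤ ε / 4 := by
    intro x hx y hy hyx
    refine le_of_tendsto ((hF y hy).dist (hF x hx)) ?_
    filter_upwards [hδF x hx] with n hn
    exact (hn y hy hyx).le
  filter_upwards [h1] with n hn y hy
  obtain ⟨x, hxt, hyx⟩ := mem_iUnion₂.1 (htK hy)
  have a1 := (hn x hxt).1 y hy hyx
  have a2 := (hn x hxt).2
  have a3 := h2 x x.2 y hy hyx
  have a4 := dist_triangle (f y) (f x) (F n y)
  have a5 := dist_triangle (f x) (F n x) (F n y)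
  rw [dist_comm] at a1 a2
  linarith

lemma dist_le_of_differentiableOn_of_bounded {f : ℂ → ℂ} {c z : ℂ} {r M : ℝ}
    (hf : DifferentiableOn ℂ f (ball c r)) (hM : ∀ w ∈ ball c r, ‖f w‖ ≤ M) (hz : z ∈ ball c r) :
    dist (f z) (f c) ≤ 2 * M / r * dist z c := by
  have hr : 0 < r := dist_nonneg.trans_lt hz
  refine Complex.dist_le_div_mul_dist_of_mapsTo_ball hf (fun w hw => ?_) hz
  rw [mem_closedBall, dist_eq_norm]
  exact (norm_sub_le _ _).trans (by linarith [hM w hw, hM c (mem_ball_self hr)])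

lemma tendstoLocallyUniformlyOn_of_bounded {ι : Type*} {l : Filter ι} {F : ι → ℂ → ℂ} {f : ℂ → ℂ}
    {D : Set ℂ} (hD : IsOpen D) {M : ℝ} (hFd : ∀ᶠ n in l, DifferentiableOn ℂ (F n) D)
    (hM : ∀ᶠ n in l, ∀ z ∈ D, ‖F n z‖ ≤ M)
    (hF : ∀ z ∈ D, Tendsto (fun n => F n z) l (𝓝 (f z))) :
    TendstoLocallyUniformlyOn F f l D := by
  rw [tendstoLocallyUniformlyOn_iff_forall_isCompact hD]
  intro K hKD hK
  refine tendstoUniformlyOn_of_tendsto_of_equicontinuous hK (fun x hx => hF x (hKD hx)) ?_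
  intro x hx ε hε
  obtain ⟨r, hr, hrD⟩ := Metric.isOpen_iff.1 hD x (hKD hx)
  refine ⟨min r (ε * r / (2 * |M| + 1)), by positivity, ?_⟩
  filter_upwards [hFd, hM] with n hn hnM y _ hyx
  have h1 := dist_le_of_differentiableOn_of_bounded (hn.mono hrD)
    (fun w hw => (hnM w (hrD hw)).trans (le_abs_self M)) (mem_ball.2 (hyx.trans_le (min_le_left _ _)))
  have h2 := hyx.trans_le (min_le_right _ _)
  rw [lt_div_iff₀ (by positivity)] at h2
  refine h1.trans_lt ?_
  rw [div_mul_eq_mul_div, div_lt_iff₀ hr]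
  nlinarith [dist_nonneg (x := y) (y := x), abs_nonneg M]

lemma exists_closedBall_forall_ne {f : ℂ → ℂ} {D : Set ℂ} (hD : IsOpen D) (hc : IsPreconnected D)
    (hf : DifferentiableOn ℂ f D) {x : ℂ} (hx : x ∈ D) (hne : ∃ y ∈ D, f y ≠ f x) {ρ : ℝ}
    (hρ : 0 < ρ) :
    ∃ r, 0 < r ∧ r ≤ ρ ∧ closedBall x r ⊆ D ∧ ∀ z ∈ closedBall x r, z ≠ x → f z ≠ f x := by
  have ha := hf.analyticOnNhd hD
  rcases (ha x hx).eventually_eq_or_eventually_ne analyticAt_const (g := fun _ => f x) with h | h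
  · obtain ⟨y, hy, hyx⟩ := hne
    exact absurd (ha.eqOn_of_preconnected_of_eventuallyEq analyticOnNhd_const hc hx h hy) hyx
  · have h1 : ∀ᶠ z in 𝓝 x, (z ≠ x → f z ≠ f x) ∧ z ∈ D :=
      (eventually_nhdsWithin_iff.1 h).and (hD.mem_nhds hx)
    obtain ⟨r, hr, hrs⟩ := nhds_basis_closedBall.mem_iff.1 h1
    refine ⟨min r ρ, lt_min hr hρ, min_le_right _ _, fun z hz => (hrs ?_).2,
      fun z hz => (hrs ?_).1⟩ <;>
    exact closedBall_subset_closedBall (min_le_left _ _) hz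

/-- A quantitative form of Hurwitz's theorem. -/
lemma eventually_ball_subset_image {ι : Type*} {l : Filter ι} {F : ι → ℂ → ℂ} {f : ℂ → ℂ} {x : ℂ}
    {r : ℝ} (hr : 0 < r) (hF : ∀ᶠ n in l, DiffContOnCl ℂ (F n) (ball x r))
    (hlim : TendstoUniformlyOn F f l (closedBall x r)) (hf : ContinuousOn f (sphere x r))
    (hne : ∀ z ∈ sphere x r, f z ≠ f x) :
    ∃ ρ > 0, ∀ᶠ n in l, ball (f x) ρ ⊆ F n '' closedBall x r := by
  obtain ⟨w, hw, hmin⟩ := (isCompact_sphere x r).exists_isMinOn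
    (NormedSpace.sphere_nonempty.2 hr.le)
    (continuous_norm.comp_continuousOn (hf.sub (continuousOn_const (c := f x))))
  set m := ‖f w - f x‖ with hm
  have hm0 : 0 < m := norm_pos_iff.2 (sub_ne_zero.2 (hne w hw))
  have hmin' : ∀ z ∈ sphere x r, m ≤ dist (f z) (f x) := fun z hz => by
    rw [dist_eq_norm]; exact hmin hz
  refine ⟨m / 8, by positivity, ?_⟩
  filter_upwards [hF, Metric.tendstoUniformlyOn_iff.1 hlim (m / 8) (by positivity)] with n hn hnl
  have hx := hnl x (mem_closedBall_self hr.le)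
  have hs : ∀ z ∈ sphere x r, m / 2 ≤ ‖F n z - F n x‖ := by
    intro z hz
    have h1 := hmin' z hz
    have h2 := hnl z (sphere_subset_closedBall hz)
    have h3 := dist_triangle4 (f z) (F n z) (F n x) (f x)
    rw [← dist_eq_norm]
    rw [dist_comm (F n x)] at h3
    linarith
  refine subset_trans (fun v hv => ?_) (hn.ball_subset_image_closedBall hr hs ?_)
  · have := dist_triangle v (f x) (F n x)
    rw [mem_ball] at hv ⊢
    linarith
  · intro hcon
    have hcon' : F n =ᶠ[𝓝 x] fun _ => F n x := by
      filter_upwards [hcon] with z hz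
      simpa using hz
    have hb := (hn.differentiableOn.analyticOnNhd isOpen_ball).eqOn_of_preconnected_of_eventuallyEq
      analyticOnNhd_const (convex_ball x r).isPreconnected (mem_ball_self hr) hcon'
    have hcl : EqOn (F n) (fun _ => F n x) (closedBall x r) := by
      rw [← closure_ball x hr.ne'] 
      exact hb.of_subset_closure hn.continuousOn continuousOn_const subset_closure subset_rfl
    have h1 := hs w hw
    rw [hcl (sphere_subset_closedBall hw), sub_self, norm_zero] at h1
    linarith

lemma injOn_of_tendstoLocallyUniformlyOn {ι : Type*} {l : Filter ι} [l.NeBot] {F : ι → ℂ → ℂ}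
    {f : ℂ → ℂ} {D : Set ℂ} (hD : IsOpen D) (hc : IsPreconnected D)
    (hFd : ∀ᶠ n in l, DifferentiableOn ℂ (F n) D) (hinj : ∀ᶠ n in l, InjOn (F n) D)
    (hF : TendstoLocallyUniformlyOn F f l D) (hne : ∃ x ∈ D, ∃ y ∈ D, f x ≠ f y) : InjOn f D := by
  have hfd := hF.differentiableOn hFd hD
  intro x hx y hy hxy
  by_contra hxy'
  have hnx : ∀ p ∈ D, ∃ q ∈ D, f q ≠ f p := by
    obtain ⟨u, hu, v, hv, huv⟩ := hne
    intro p _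
    by_cases h : f u = f p
    · exact ⟨v, hv, fun h' => huv (h.trans h'.symm)⟩
    · exact ⟨u, hu, h⟩
  have hd : 0 < dist x y / 3 := by have := dist_pos.2 hxy'; positivity
  have key : ∀ p ∈ D, ∃ r ≤ dist x y / 3, ∀ᶠ n in l, f p ∈ F n '' (closedBall p r ∩ D) := by
    intro p hp
    obtain ⟨r, hr, hrd, hrD, hrf⟩ := exists_closedBall_forall_ne hD hc hfd hp (hnx p hp) hd
    obtain ⟨ρ, hρ, hρF⟩ := eventually_ball_subset_image (l := l) (F := F) (f := f) hr
      (hFd.mono fun n hn => (hn.mono hrD).diffContOnCl_ball subset_rfl)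
      ((tendstoLocallyUniformlyOn_iff_forall_isCompact hD).1 hF _ hrD (isCompact_closedBall _ _))
      (hfd.continuousOn.mono (sphere_subset_closedBall.trans hrD))
      (fun z hz => hrf z (sphere_subset_closedBall hz) (ne_of_mem_sphere hz hr.ne'))
    refine ⟨r, hrd, hρF.mono fun n hn => ?_⟩
    rw [inter_eq_left.2 hrD]
    exact hn (mem_ball_self hρ)
  obtain ⟨r, hr, hrx⟩ := key x hx
  obtain ⟨s, hs, hsy⟩ := key y hy
  obtain ⟨n, hn, ⟨u, hu, hux⟩, v, hv, hvy⟩ := (hinj.and (hrx.and hsy)).exists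
  have : u = v := hn hu.2 hv.2 (by rw [hux, hvy, hxy])
  subst this
  have h1 := dist_triangle_left x y u
  linarith [mem_closedBall.1 hu.1, mem_closedBall.1 hv.1]

/-- Injective holomorphic functions are open. -/
lemma isOpen_image_of_injOn {f : ℂ → ℂ} {D : Set ℂ} (hD : IsOpen D)
    (hf : DifferentiableOn ℂ f D) (hinj : InjOn f D) : IsOpen (f '' D) := by
  rw [isOpen_iff_mem_nhds]
  rintro _ ⟨x, hx, rfl⟩
  rcases (hf.analyticAt (hD.mem_nhds hx)).eventually_constant_or_nhds_le_map_nhds with h | h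
  · exfalso
    obtain ⟨r, hr, hrs⟩ := Metric.eventually_nhds_iff_ball.1 (h.and (hD.mem_nhds hx))
    have hy : x + (r / 2 : ℝ) ∈ ball x r := by
      rw [mem_ball, dist_eq_norm, add_sub_cancel_left, Complex.norm_real,
        Real.norm_of_nonneg (by positivity)]
      linarith
    have := hinj (hrs _ hy).2 hx (hrs _ hy).1
    rw [add_eq_left] at this
    have : r / 2 = 0 := by exact_mod_cast this
    linarith
  · exact h (image_mem_map (hD.mem_nhds hx))

/-- The inverse of an injective holomorphic function is holomorphic. -/
lemma differentiableOn_of_leftInvOn {f g : ℂ → ℂ} {D : Set ℂ} (hD : IsOpen D)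
    (hf : DifferentiableOn ℂ f D) (hg : ∀ z ∈ D, g (f z) = z) :
    DifferentiableOn ℂ g (f '' D) := by
  have hinj : InjOn f D := fun x hx y hy hxy => by rw [← hg x hx, hxy, hg y hy]
  have hop : ∀ s ⊆ D, IsOpen s → IsOpen (f '' s) := fun s hs ho =>
    isOpen_image_of_injOn ho (hf.mono hs) (hinj.mono hs)
  have hgc : ∀ z ∈ D, ContinuousAt g (f z) := by
    intro z hz U hU
    rw [hg z hz] at hU
    obtain ⟨V, hVU, hV, hzV⟩ := _root_.mem_nhds_iff.1 (inter_mem hU (hD.mem_nhds hz))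
    rw [Filter.mem_map]
    refine mem_of_superset ((hop V (hVU.trans inter_subset_right) hV).mem_nhds
      (mem_image_of_mem f hzV)) ?_
    rintro _ ⟨y, hy, rfl⟩
    rw [mem_preimage, hg y (hVU hy).2]
    exact (hVU hy).1
  have hgd : ∀ z ∈ D, deriv f z ≠ 0 → DifferentiableAt ℂ g (f z) := by
    intro z hz hz'
    refine (HasDerivAt.of_local_left_inverse (f := f) (f' := deriv f z) (hgc z hz) ?_ hz' ?_).differentiableAt
    · rw [hg z hz]
      exact (hf.differentiableAt (hD.mem_nhds hz)).hasDerivAt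
    · filter_upwards [(hop D subset_rfl hD).mem_nhds (mem_image_of_mem f hz)]
      rintro _ ⟨y, hy, rfl⟩
      rw [hg y hy]
  have hda := (hf.analyticOnNhd hD).deriv
  rintro _ ⟨z, hz, rfl⟩
  refine DifferentiableAt.differentiableWithinAt ?_
  obtain ⟨U, hUD, hU, hzU, hUd⟩ : ∃ U ⊆ D, IsOpen U ∧ z ∈ U ∧ ∀ y ∈ U, y ≠ z → deriv f y ≠ 0 := by
    rcases (hda z hz).eventually_eq_zero_or_eventually_ne_zero with h | h
    · exfalso
      obtain ⟨r, hr, hrs⟩ := Metric.eventually_nhds_iff_ball.1 (h.and (hD.mem_nhds hz))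
      have hy : z + (r / 2 : ℝ) ∈ ball z r := by
        rw [mem_ball, dist_eq_norm, add_sub_cancel_left, Complex.norm_real,
          Real.norm_of_nonneg (by positivity)]
        linarith
      have hconst := (convex_ball z r).is_const_of_fderivWithin_eq_zero (𝕜 := ℂ)
        (hf.mono fun y hy => (hrs y hy).2) (fun y hy => by
          rw [fderivWithin_of_isOpen isOpen_ball hy]
          ext
          simpa using (hrs y hy).1) hy (mem_ball_self hr)
      have := hinj (hrs _ hy).2 hz hconst
      rw [add_eq_left] at this
      have : r / 2 = 0 := by exact_mod_cast this
      linarith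
    · obtain ⟨U, hUs, hU, hzU⟩ := _root_.mem_nhds_iff.1
        ((eventually_nhdsWithin_iff.1 h).and (hD.mem_nhds hz))
      exact ⟨U, fun y hy => (hUs hy).2, hU, hzU, fun y hy => (hUs hy).1⟩
  have hn : f '' U ∈ 𝓝 (f z) := (hop U hUD hU).mem_nhds (mem_image_of_mem f hzU)
  refine ((Complex.differentiableOn_compl_singleton_and_continuousAt_iff hn).1
    ⟨?_, hgc z hz⟩).differentiableAt hn
  rintro _ ⟨⟨y, hy, rfl⟩, hyz⟩
  exact (hgd y (hUD hy) (hUd y hy fun h => hyz (by rw [h]; rfl))).differentiableWithinAt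

/-! ### The Riemann mapping theorem for continuum domains -/

/-- The Möbius transformation of the disk sending `a` to zero. -/
def diskShift (a w : ℂ) : ℂ := (w - a) / (1 - starRingEnd ℂ a * w)

section diskShift

variable {a w : ℂ}

lemma one_sub_conj_mul_ne_zero (ha : ‖a‖ < 1) (hw : ‖w‖ ≤ 1) : 1 - starRingEnd ℂ a * w ≠ 0 := by
  intro h
  have h1 : ‖starRingEnd ℂ a * w‖ = 1 := by rw [← sub_eq_zero.1 h, norm_one]
  rw [norm_mul, RCLike.norm_conj] at h1
  nlinarith [norm_nonneg a, norm_nonneg w]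

lemma norm_diskShift_lt (ha : ‖a‖ < 1) (hw : ‖w‖ < 1) : ‖diskShift a w‖ < 1 := by
  have h0 := one_sub_conj_mul_ne_zero ha hw.le
  rw [diskShift, norm_div, div_lt_one (norm_pos_iff.2 h0), ← sq_lt_sq₀ (norm_nonneg _)
    (norm_nonneg _), ← sub_pos]
  have : ‖1 - starRingEnd ℂ a * w‖ ^ 2 - ‖w - a‖ ^ 2 = (1 - ‖a‖ ^ 2) * (1 - ‖w‖ ^ 2) := by
    simp only [← Complex.normSq_eq_norm_sq, Complex.normSq_apply, Complex.sub_re, Complex.sub_im,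
      Complex.mul_re, Complex.mul_im, Complex.conj_re, Complex.conj_im, Complex.one_re,
      Complex.one_im]
    ring
  rw [this]
  have h1 : ‖a‖ ^ 2 < 1 := by nlinarith [norm_nonneg a]
  have h2 : ‖w‖ ^ 2 < 1 := by nlinarith [norm_nonneg w]
  exact mul_pos (by linarith) (by linarith)

lemma diskShift_self : diskShift a a = 0 := by simp [diskShift]

lemma diskShift_neg_diskShift (ha : ‖a‖ < 1) (hw : ‖w‖ < 1) :
    diskShift (-a) (diskShift a w) = w := by
  have h0 := one_sub_conj_mul_ne_zero ha hw.le
  have h1 := one_sub_conj_mul_ne_zero ha ha.le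
  have h2 : 1 - starRingEnd ℂ (-a) * ((w - a) / (1 - starRingEnd ℂ a * w)) =
      (1 - starRingEnd ℂ a * a) / (1 - starRingEnd ℂ a * w) := by
    rw [map_neg]
    field_simp
    ring
  rw [diskShift, diskShift, h2, div_eq_iff (div_ne_zero h1 h0), mul_div_assoc', sub_neg_eq_add,
    div_add' _ _ _ h0, div_left_inj' h0]
  ring

lemma differentiableOn_diskShift (ha : ‖a‖ < 1) :
    DifferentiableOn ℂ (diskShift a) (ball 0 1) := by
  refine DifferentiableOn.div (by fun_prop) (by fun_prop) fun w hw => ?_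
  exact one_sub_conj_mul_ne_zero ha (mem_ball_zero_iff.1 hw).le

end diskShift

/-- The competitors in the extremal problem defining the Riemann map. -/
structure IsRiemannCandidate (D : Set ℂ) (z₀ : ℂ) (g : ℂ → ℂ) : Prop where
  differentiableOn : DifferentiableOn ℂ g D
  injOn : InjOn g D
  mapsTo : MapsTo g D (ball 0 1)
  map_eq_zero : g z₀ = 0

lemma hasDerivAt_of_sq_eq {s k : ℂ → ℂ} {D : Set ℂ} (hD : IsOpen D) (hs : ContinuousOn s D)
    (hk : DifferentiableOn ℂ k D) (hsk : ∀ z ∈ D, s z ^ 2 = k z) (h0 : ∀ z ∈ D, s z ≠ 0) :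
    DifferentiableOn ℂ s D := by
  intro z hz
  have hkd := (hk.differentiableAt (hD.mem_nhds hz)).hasDerivAt
  have hsc := hs.continuousAt (hD.mem_nhds hz)
  suffices HasDerivAt s (deriv k z / (s z + s z)) z from this.differentiableAt.differentiableWithinAt
  rw [hasDerivAt_iff_tendsto_slope] at hkd ⊢
  have hsum : Tendsto (fun w => s w + s z) (𝓝[≠] z) (𝓝 (s z + s z)) :=
    (hsc.tendsto.add_const _).mono_left nhdsWithin_le_nhds
  have hne : s z + s z ≠ 0 := by
    rw [← two_mul]
    exact mul_ne_zero two_ne_zero (h0 z hz)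
  refine (hkd.div hsum hne).congr' ?_
  filter_upwards [hsum.eventually_ne hne, mem_nhdsWithin_of_mem_nhds (hD.mem_nhds hz)] with w hw hwD
  rw [Pi.div_apply, slope_def_field, slope_def_field, ← hsk w hwD, ← hsk z hz, sq_sub_sq,
    div_right_comm, mul_div_cancel_left₀ _ hw]

lemma IsRiemannCandidate.exists_norm_lt {D K : Set ℂ} (h : IsContinuumDomain D K) {z₀ z₁ : ℂ}
    (hz₀ : z₀ ∈ D) (hz₁ : z₁ ∈ D) (hz : z₁ ≠ z₀) {g : ℂ → ℂ} (hg : IsRiemannCandidate D z₀ g)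
    {a : ℂ} (ha : ‖a‖ < 1) (haD : a ∉ g '' D) :
    ∃ g', IsRiemannCandidate D z₀ g' ∧ ‖g z₁‖ < ‖g' z₁‖ := by
  have hgn : ∀ z ∈ D, ‖g z‖ < 1 := fun z hz => mem_ball_zero_iff.1 (hg.mapsTo hz)
  let k : ℂ → ℂ := fun z => diskShift a (g z)
  have hkn : ∀ z ∈ D, ‖k z‖ < 1 := fun z hz => norm_diskShift_lt ha (hgn z hz)
  have hkd : DifferentiableOn ℂ k D := (differentiableOn_diskShift ha).comp hg.differentiableOn
    hg.mapsTo
  have hkg : ∀ z ∈ D, diskShift (-a) (k z) = g z := fun z hz =>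
    diskShift_neg_diskShift ha (hgn z hz)
  have hkinj : InjOn k D := fun x hx y hy hxy =>
    hg.injOn hx hy (by rw [← hkg x hx, hxy, hkg y hy])
  have hk0 : (0 : ℂ) ∉ k '' D := by
    rintro ⟨z, hz, hz0⟩
    refine haD ⟨z, hz, ?_⟩
    rw [← hkg z hz, hz0]
    simp [diskShift]
  obtain ⟨l, hl, hlk⟩ := h.hasLogOn_sub hkd.continuousOn (isOpen_image_of_injOn h.isOpen hkd hkinj)
    hkinj (isBounded_ball.subset (image_subset_iff.2 fun z hz =>
      mem_ball_zero_iff.2 (hkn z hz))) hk0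
  let s : ℂ → ℂ := fun z => Complex.exp (l z / 2)
  have hsk : ∀ z ∈ D, s z ^ 2 = k z := fun z hz => by
    have h1 : Complex.exp (l z) = k z := by simpa using hlk z hz
    rw [← Complex.exp_nat_mul, ← h1]
    congr 1
    push_cast
    ring
  have hsc : ContinuousOn s D := (hl.div_const 2).cexp
  have hsd : DifferentiableOn ℂ s D :=
    hasDerivAt_of_sq_eq h.isOpen hsc hkd hsk fun z _ => Complex.exp_ne_zero _
  have hsn : ∀ z ∈ D, ‖s z‖ < 1 := fun z hz => by
    rw [← pow_lt_one_iff_of_nonneg (norm_nonneg _) two_ne_zero, ← norm_pow, hsk z hz]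
    exact hkn z hz
  have hb := hsn z₀ hz₀
  set b := s z₀
  have hb' : ‖-b‖ < 1 := by rwa [norm_neg]
  have ha' : ‖-a‖ < 1 := by rwa [norm_neg]
  let g' : ℂ → ℂ := fun z => diskShift b (s z)
  let ψ : ℂ → ℂ := fun w => diskShift (-a) (diskShift (-b) w ^ 2)
  have hψg : ∀ z ∈ D, ψ (g' z) = g z := fun z hz => by
    simp only [ψ, g']
    rw [diskShift_neg_diskShift hb (hsn z hz), hsk z hz, hkg z hz]
  have hg' : IsRiemannCandidate D z₀ g' :=
    { differentiableOn := (differentiableOn_diskShift hb).comp hsd fun z hz =>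
        mem_ball_zero_iff.2 (hsn z hz)
      injOn := fun x hx y hy hxy => hg.injOn hx hy (by rw [← hψg x hx, hxy, hψg y hy])
      mapsTo := fun z hz => mem_ball_zero_iff.2 (norm_diskShift_lt hb (hsn z hz))
      map_eq_zero := diskShift_self }
  refine ⟨g', hg', ?_⟩
  have hsq : MapsTo (fun w => diskShift (-b) w ^ 2) (ball 0 1) (ball 0 1) := fun w hw => by
    rw [mem_ball_zero_iff, norm_pow]
    exact pow_lt_one₀ (norm_nonneg _) (norm_diskShift_lt hb' (mem_ball_zero_iff.1 hw)) two_ne_zero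
  have hψd : DifferentiableOn ℂ ψ (ball 0 1) :=
    (differentiableOn_diskShift ha').comp ((differentiableOn_diskShift hb').pow 2) hsq
  have hψm : MapsTo ψ (ball 0 1) (ball 0 1) := fun w hw =>
    mem_ball_zero_iff.2 (norm_diskShift_lt ha' (mem_ball_zero_iff.1 (hsq hw)))
  have hψ0 : ψ 0 = 0 := by
    have e := hψg z₀ hz₀
    rwa [hg'.map_eq_zero, hg.map_eq_zero] at e
  have hψm' : MapsTo ψ (ball 0 1) (closedBall (ψ 0) 1) := by
    rw [hψ0]
    exact fun w hw => ball_subset_closedBall (hψm hw)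
  have hw1 := hg'.mapsTo hz₁
  have hw0 : g' z₁ ≠ 0 := fun h0 => hz (hg'.injOn hz₁ hz₀ (h0.trans hg'.map_eq_zero.symm))
  have hds : dslope ψ 0 (g' z₁) = g z₁ / g' z₁ := by
    rw [dslope_of_ne _ hw0, slope_def_field, hψ0, sub_zero, sub_zero, hψg z₁ hz₁]
  have hle := Complex.norm_dslope_le_div_of_mapsTo_ball hψd hψm' hw1
  rw [div_one] at hle
  rcases hle.lt_or_eq with hlt | heq
  · rwa [hds, norm_div, div_lt_one (norm_pos_iff.2 hw0)] at hlt
  · exfalso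
    have hlin := Complex.affine_of_mapsTo_ball_of_norm_dslope_eq_div hψd hψm' hw1 (by simpa using heq)
    have hhalf : ‖(1 / 2 : ℂ)‖ < 1 := by norm_num
    have hhalf' : ‖-(1 / 2 : ℂ)‖ < 1 := by rwa [norm_neg]
    have hp := mem_ball_zero_iff.2 (norm_diskShift_lt hb hhalf)
    have hq := mem_ball_zero_iff.2 (norm_diskShift_lt hb hhalf')
    have hpq : ψ (diskShift b (1 / 2)) = ψ (diskShift b (-(1 / 2))) := by
      simp only [ψ]
      rw [diskShift_neg_diskShift hb hhalf, diskShift_neg_diskShift hb hhalf', neg_sq]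
    rw [hlin hp, hlin hq] at hpq
    have hd0 : dslope ψ 0 (g' z₁) ≠ 0 := by
      rw [← norm_pos_iff, heq]
      exact one_pos
    have hpq' : diskShift b (1 / 2) = diskShift b (-(1 / 2)) := by
      simpa [hψ0, hd0] using hpq
    have := congrArg (diskShift (-b)) hpq'
    rw [diskShift_neg_diskShift hb hhalf, diskShift_neg_diskShift hb hhalf'] at this
    norm_num at this

/-- The Riemann mapping theorem. -/
lemma IsContinuumDomain.exists_riemann_map {D K : Set ℂ} (h : IsContinuumDomain D K) {z₀ : ℂ}
    (hz₀ : z₀ ∈ D) : ∃ f g : ℂ → ℂ, DifferentiableOn ℂ f (ball 0 1) ∧ MapsTo f (ball 0 1) D ∧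
      DifferentiableOn ℂ g D ∧ MapsTo g D (ball 0 1) ∧ (∀ w ∈ ball (0 : ℂ) 1, g (f w) = w) ∧
      (∀ z ∈ D, f (g z) = z) ∧ f 0 = z₀ := by
  obtain ⟨r, hr, hrD⟩ := Metric.isOpen_iff.1 h.isOpen z₀ hz₀
  obtain ⟨z₁, hz₁, hz⟩ : ∃ z₁ ∈ D, z₁ ≠ z₀ := by
    refine ⟨z₀ + (r / 2 : ℝ), hrD ?_, ?_⟩
    · rw [mem_ball, dist_eq_norm, add_sub_cancel_left, Complex.norm_real,
        Real.norm_of_nonneg (by positivity)]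
      linarith
    · rw [Ne, add_eq_left]
      exact_mod_cast (half_pos hr).ne'
  obtain ⟨R, hR0, hR⟩ := h.isBounded.subset_ball_lt 0 z₀
  let S : Set ℝ := {t | ∃ g, IsRiemannCandidate D z₀ g ∧ ‖g z₁‖ = t}
  have hbase : IsRiemannCandidate D z₀ fun z => (z - z₀) / R :=
    { differentiableOn := by fun_prop
      injOn := fun x _ y _ hxy => by
        have : (R : ℂ) ≠ 0 := by exact_mod_cast hR0.ne'
        field_simp at hxy
        exact sub_left_inj.1 hxy
      mapsTo := fun z hz => by
        rw [mem_ball_zero_iff, norm_div, Complex.norm_real, Real.norm_of_nonneg hR0.le,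
          div_lt_one hR0, ← dist_eq_norm]
        exact hR hz
      map_eq_zero := by simp }
  have hSb : BddAbove S := ⟨1, by
    rintro _ ⟨g, hg, rfl⟩
    exact (mem_ball_zero_iff.1 (hg.mapsTo hz₁)).le⟩
  have hSne : S.Nonempty := ⟨_, _, hbase, rfl⟩
  obtain ⟨t, -, htm, hts⟩ := exists_seq_tendsto_sSup hSne hSb
  choose G hG hGt using hts
  have hGn : ∀ n : ℕ, ∀ z ∈ D, ‖G n z‖ ≤ 1 := fun n z hz =>
    (mem_ball_zero_iff.1 ((hG n).mapsTo hz)).le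
  let l : Ultrafilter ℕ := hyperfilter ℕ
  have hlim : ∀ z : ℂ, z ∈ D → ∃ y, Tendsto (fun n => G n z) l (𝓝 y) := by
    intro z hz
    obtain ⟨y, -, hy⟩ := (isCompact_closedBall (0 : ℂ) 1).ultrafilter_le_nhds
      (l.map fun n => G n z) (by
        rw [le_principal_iff, Ultrafilter.mem_coe, Ultrafilter.mem_map]
        exact univ_mem' fun n => mem_closedBall_zero_iff.2 (hGn n z hz))
    exact ⟨y, hy⟩
  choose! g hg using hlim
  have hloc : TendstoLocallyUniformlyOn G g l D :=
    tendstoLocallyUniformlyOn_of_bounded h.isOpen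
      (Eventually.of_forall fun n => (hG n).differentiableOn) (Eventually.of_forall hGn) hg
  have hgd : DifferentiableOn ℂ g D := hloc.differentiableOn
    (Eventually.of_forall fun n => (hG n).differentiableOn) h.isOpen
  have hg1 : ‖g z₁‖ = sSup S := by
    refine tendsto_nhds_unique (hg z₁ hz₁).norm ?_
    simp only [hGt]
    exact htm.mono_left (Nat.hyperfilter_le_atTop)
  have hg0 : g z₀ = 0 := by
    refine tendsto_nhds_unique (hg z₀ hz₀) ?_
    simp only [(hG _).map_eq_zero]
    exact tendsto_const_nhds
  have hg10 : g z₁ ≠ g z₀ := by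
    rw [hg0, ← norm_pos_iff, hg1]
    refine lt_of_lt_of_le ?_ (le_csSup hSb ⟨_, hbase, rfl⟩)
    rw [norm_pos_iff]
    exact div_ne_zero (sub_ne_zero.2 hz) (by exact_mod_cast hR0.ne')
  have hginj : InjOn g D := injOn_of_tendstoLocallyUniformlyOn h.isOpen
    h.isConnected.isPreconnected (Eventually.of_forall fun n => (hG n).differentiableOn)
    (Eventually.of_forall fun n => (hG n).injOn) hloc ⟨z₁, hz₁, z₀, hz₀, hg10⟩
  have hgo := isOpen_image_of_injOn h.isOpen hgd hginj
  have hgm : MapsTo g D (ball 0 1) := by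
    have h1 : g '' D ⊆ closedBall 0 1 := by
      rintro _ ⟨z, hz, rfl⟩
      rw [mem_closedBall_zero_iff]
      exact le_of_tendsto (hg z hz).norm (Eventually.of_forall fun n => hGn n z hz)
    have h2 := interior_maximal h1 hgo
    rw [interior_closedBall _ one_ne_zero] at h2
    exact fun z hz => h2 (mem_image_of_mem g hz)
  have hcand : IsRiemannCandidate D z₀ g := ⟨hgd, hginj, hgm, hg0⟩
  have hsurj : g '' D = ball 0 1 := by
    refine subset_antisymm (image_subset_iff.2 hgm) fun a ha => ?_
    by_contra haD
    obtain ⟨g', hg', hlt⟩ := hcand.exists_norm_lt h hz₀ hz₁ hz (mem_ball_zero_iff.1 ha) haD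
    rw [hg1] at hlt
    exact absurd (le_csSup hSb ⟨g', hg', rfl⟩) (not_le.2 hlt)
  have hinv : ∀ z ∈ D, Function.invFunOn g D (g z) = z := fun z hz =>
    hginj.leftInvOn_invFunOn hz
  refine ⟨Function.invFunOn g D, g, ?_, ?_, hgd, hgm, ?_, hinv, ?_⟩
  · rw [← hsurj]
    exact differentiableOn_of_leftInvOn h.isOpen hgd hinv
  · rw [← hsurj]
    exact fun w hw => Function.invFunOn_mem hw
  · rw [← hsurj]
    exact fun w hw => Function.invFunOn_eq hw
  · rw [← hg0]
    exact hinv z₀ hz₀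

section LengthArea

open MeasureTheory

lemma mem_ball_one_one_polar {r θ : ℝ} (hr : 0 < r) :
    (r * (Real.cos θ + Real.sin θ * Complex.I) : ℂ) ∈ ball (1 : ℂ) 1 ↔ r < 2 * Real.cos θ := by
  rw [mem_ball, dist_eq_norm, ← sq_lt_one_iff₀ (norm_nonneg _), ← Complex.normSq_eq_norm_sq,
    Complex.normSq_apply]
  simp only [Complex.sub_re, Complex.mul_re, Complex.ofReal_re, Complex.add_re, Complex.ofReal_im,
    Complex.I_re, Complex.I_im, Complex.mul_im, Complex.add_im, Complex.sub_im, Complex.one_re,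
    Complex.one_im]
  have h := Real.sin_sq_add_cos_sq θ
  have e : (r * (Real.cos θ + (Real.sin θ * 0 - 0 * 1)) -
      0 * (0 + (Real.sin θ * 1 + 0 * 0)) - 1) *
      (r * (Real.cos θ + (Real.sin θ * 0 - 0 * 1)) - 0 * (0 + (Real.sin θ * 1 + 0 * 0)) - 1) +
      (r * (0 + (Real.sin θ * 1 + 0 * 0)) + 0 * (Real.cos θ + (Real.sin θ * 0 - 0 * 1)) - 0) *
      (r * (0 + (Real.sin θ * 1 + 0 * 0)) + 0 * (Real.cos θ + (Real.sin θ * 0 - 0 * 1)) - 0) =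
      r * (r - 2 * Real.cos θ) + 1 := by
    linear_combination r ^ 2 * h
  rw [e, add_lt_iff_neg_right, mul_neg_iff]
  constructor
  · rintro (h | h) <;> linarith [h.1, h.2]
  · exact fun h => Or.inl ⟨hr, by linarith⟩

/-- The length–area inequality on a single circular arc. -/
lemma ofReal_le_lintegral_arc {k : ℂ → ℂ} (hk : DifferentiableOn ℂ k (ball 1 1)) {r l : ℝ}
    (hr : 0 < r) (hl : 0 ≤ l) {u v : ℂ} (hu : u ∈ ball (1 : ℂ) 1) (hv : v ∈ ball (1 : ℂ) 1)
    (hur : ‖u‖ = r) (hvr : ‖v‖ = r) (h : l ≤ dist (k u) (k v)) :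
    ENNReal.ofReal (l ^ 2 / (2 * Real.pi * r)) ≤ ∫⁻ θ in Ioo (-Real.pi) Real.pi, ENNReal.ofReal r *
      (ball (1 : ℂ) 1).indicator (fun u => ENNReal.ofReal (‖deriv k u‖ ^ 2))
        (r * (Real.cos θ + Real.sin θ * Complex.I)) := by
  wlog hα : u.arg ≤ v.arg generalizing u v
  · exact this hv hu hvr hur (by rwa [dist_comm]) (le_of_not_ge hα)
  set p : ℝ → ℂ := fun θ => r * (Real.cos θ + Real.sin θ * Complex.I) with hp
  have hpolar : ∀ w : ℂ, ‖w‖ = r → p w.arg = w := fun w hw => by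
    simp only [hp]
    rw [← hw]
    exact_mod_cast Complex.norm_mul_cos_add_sin_mul_I w
  have harg : ∀ w ∈ ball (1 : ℂ) 1, ‖w‖ = r → |w.arg| < Real.pi / 2 := by
    intro w hw hwr
    refine Complex.abs_arg_lt_pi_div_two_iff.2 (Or.inl ?_)
    have h1 := (Complex.abs_re_le_norm (w - 1)).trans_lt (by simpa [dist_eq_norm] using hw)
    rw [abs_lt] at h1
    simp at h1
    linarith [h1.1]
  have hα1 := abs_lt.1 (harg u hu hur)
  have hβ1 := abs_lt.1 (harg v hv hvr)
  set α := u.arg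
  set β := v.arg
  have hpi := Real.pi_pos
  have hmem : ∀ θ ∈ Icc α β, p θ ∈ ball (1 : ℂ) 1 := by
    intro θ hθ
    have h1 : r < 2 * Real.cos α := by
      rw [← mem_ball_one_one_polar hr]
      rw [← hpolar u hur] at hu
      exact hu
    have h2 : r < 2 * Real.cos β := by
      rw [← mem_ball_one_one_polar hr]
      rw [← hpolar v hvr] at hv
      exact hv
    refine (mem_ball_one_one_polar hr).2 ?_
    rcases le_total 0 θ with h0 | h0
    · linarith [Real.cos_le_cos_of_nonneg_of_le_pi h0 (by linarith [hβ1.2]) hθ.2]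
    · have := Real.cos_le_cos_of_nonneg_of_le_pi (neg_nonneg.2 h0) (by linarith [hα1.1])
        (neg_le_neg hθ.1)
      rw [Real.cos_neg, Real.cos_neg] at this
      linarith
  have hp' : ∀ θ, HasDerivAt p (r * (-Real.sin θ + Real.cos θ * Complex.I)) θ := by
    intro θ
    have h1 := (Real.hasDerivAt_cos θ).ofReal_comp
    have h2 := ((Real.hasDerivAt_sin θ).ofReal_comp).mul_const Complex.I
    have h3 := (h1.add h2).const_mul (r : ℂ)
    simpa [hp] using h3
  have hp'n : ∀ θ : ℝ, ‖(r * (-Real.sin θ + Real.cos θ * Complex.I) : ℂ)‖ = r := by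
    intro θ
    have : (-Real.sin θ + Real.cos θ * Complex.I : ℂ) =
        Complex.I * Complex.exp (θ * Complex.I) := by
      rw [Complex.exp_mul_I, ← Complex.ofReal_cos, ← Complex.ofReal_sin]
      ring_nf
      rw [Complex.I_sq]
      ring
    rw [this, norm_mul, norm_mul, Complex.norm_exp_ofReal_mul_I, Complex.norm_I, Complex.norm_real,
      Real.norm_of_nonneg hr.le]
    ring
  have hpc : Continuous p := by fun_prop
  have hdc : ContinuousOn (fun θ => deriv k (p θ)) (Icc α β) :=
    ((hk.deriv isOpen_ball).continuousOn).comp hpc.continuousOn hmem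
  set g : ℝ → ℝ := fun θ => ‖deriv k (p θ)‖ with hg
  have hgc : ContinuousOn g (Icc α β) := hdc.norm
  have hle : l ≤ ∫ θ in α..β, r * g θ := by
    have h1 : ∫ θ in α..β, deriv k (p θ) * (r * (-Real.sin θ + Real.cos θ * Complex.I)) =
        k (p β) - k (p α) := by
      refine intervalIntegral.integral_eq_sub_of_hasDerivAt (f := fun θ => k (p θ)) ?_ ?_
      · intro θ hθ
        rw [uIcc_of_le hα] at hθ
        exact (hk.differentiableAt (isOpen_ball.mem_nhds (hmem θ hθ))).hasDerivAt.comp θ (hp' θ)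
      · refine ContinuousOn.intervalIntegrable ?_
        rw [uIcc_of_le hα]
        exact hdc.mul (by fun_prop)
    have h2 := intervalIntegral.norm_integral_le_integral_norm (μ := volume)
      (f := fun θ : ℝ => deriv k (p θ) * (r * (-Real.sin θ + Real.cos θ * Complex.I))) hα
    rw [h1, hpolar u hur, hpolar v hvr, ← dist_eq_norm, dist_comm] at h2
    refine (h.trans h2).trans_eq ?_
    refine intervalIntegral.integral_congr fun θ _ => ?_
    simp only [norm_mul (deriv k (p θ)), hp'n, hg]
    ring
  have hlower : l ^ 2 / (2 * Real.pi * r) ≤ ∫ θ in α..β, r * g θ ^ 2 := by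
    set c := l / (2 * Real.pi) with hc
    have h1 : ∫ θ in α..β, 2 * c * (r * g θ) ≤ ∫ θ in α..β, (r * (r * g θ ^ 2) + c ^ 2) := by
      refine intervalIntegral.integral_mono_on hα ?_ ?_ ?_
      · refine ContinuousOn.intervalIntegrable ?_
        rw [uIcc_of_le hα]
        fun_prop
      · refine ContinuousOn.intervalIntegrable ?_
        rw [uIcc_of_le hα]
        fun_prop
      · intro θ _
        nlinarith [sq_nonneg (r * g θ - c)]
    rw [intervalIntegral.integral_const_mul (2 * c) fun θ => r * g θ, intervalIntegral.integral_add,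
      intervalIntegral.integral_const_mul r fun θ => r * g θ ^ 2, intervalIntegral.integral_const,
      smul_eq_mul] at h1
    · have hc0 : 0 ≤ c := by positivity
      have h2 : 2 * c * l ≤ r * (∫ θ in α..β, r * g θ ^ 2) + 2 * Real.pi * c ^ 2 := by
        have h3 : (β - α) * c ^ 2 ≤ 2 * Real.pi * c ^ 2 :=
          mul_le_mul_of_nonneg_right (by linarith [hα1.1, hβ1.2]) (sq_nonneg c)
        have h4 := mul_le_mul_of_nonneg_left hle (mul_nonneg zero_le_two hc0)
        linarith
      rw [div_le_iff₀ (by positivity)]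
      have h5 : l = 2 * Real.pi * c := by rw [hc]; field_simp
      rw [h5] at h2 ⊢
      nlinarith
    · refine ContinuousOn.intervalIntegrable ?_
      rw [uIcc_of_le hα]
      fun_prop
    · exact intervalIntegrable_const
  calc ENNReal.ofReal (l ^ 2 / (2 * Real.pi * r))
      ≤ ENNReal.ofReal (∫ θ in α..β, r * g θ ^ 2) := ENNReal.ofReal_le_ofReal hlower
    _ = ∫⁻ θ in Ioc α β, ENNReal.ofReal (r * g θ ^ 2) := by
        rw [intervalIntegral.integral_of_le hα, ofReal_integral_eq_lintegral_ofReal]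
        · refine (ContinuousOn.integrableOn_Icc ?_).mono_set Ioc_subset_Icc_self
          fun_prop
        · exact Eventually.of_forall fun θ => by positivity
    _ ≤ ∫⁻ θ in Ioc α β, ENNReal.ofReal r * (ball (1 : ℂ) 1).indicator
          (fun u => ENNReal.ofReal (‖deriv k u‖ ^ 2)) (p θ) := by
        refine setLIntegral_mono' measurableSet_Ioc fun θ hθ => ?_
        rw [indicator_of_mem (hmem θ (Ioc_subset_Icc_self hθ)), ENNReal.ofReal_mul hr.le]
    _ ≤ _ := lintegral_mono_set (Ioc_subset_Ioo_right (by linarith [hβ1.2]) |>.trans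
        (Ioo_subset_Ioo_left (by linarith [hα1.1])))

lemma lintegral_norm_deriv_sq_eq {k : ℂ → ℂ} {D : Set ℂ} (hD : IsOpen D)
    (hk : DifferentiableOn ℂ k D) (hinj : InjOn k D) :
    ∫⁻ u in D, ENNReal.ofReal (‖deriv k u‖ ^ 2) = volume (k '' D) := by
  rw [← lintegral_abs_det_fderiv_eq_addHaar_image volume hD.measurableSet
    (f' := fun u => (ContinuousLinearMap.toSpanSingleton ℂ (deriv k u)).restrictScalars ℝ) ?_ hinj]
  · refine lintegral_congr fun u => ?_
    congr 1
    have : ((ContinuousLinearMap.toSpanSingleton ℂ (deriv k u)).restrictScalars ℝ).det =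
        ‖deriv k u‖ ^ 2 := by
      rw [ContinuousLinearMap.det]
      erw [LinearMap.det_restrictScalars]
      rw [show LinearMap.det (ContinuousLinearMap.toSpanSingleton ℂ (deriv k u) : ℂ →ₗ[ℂ] ℂ) =
        deriv k u from ContinuousLinearMap.det_toSpanSingleton _]
      rw [Algebra.norm_complex_apply, Complex.normSq_eq_norm_sq]
    rw [this, abs_of_nonneg (by positivity)]
  · intro u hu
    exact ((hk.differentiableAt (hD.mem_nhds hu)).hasDerivAt.hasFDerivAt.restrictScalars
      ℝ).hasFDerivWithinAt

lemma ofReal_mul_log_le_volume {k : ℂ → ℂ} (hk : DifferentiableOn ℂ k (ball 1 1))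
    (hinj : InjOn k (ball 1 1)) {a b l : ℝ} (ha : 0 < a) (hab : a ≤ b) (hl : 0 ≤ l)
    (h : ∀ r ∈ Ioo a b, ∃ u ∈ ball (1 : ℂ) 1, ∃ v ∈ ball (1 : ℂ) 1, ‖u‖ = r ∧ ‖v‖ = r ∧
      l ≤ dist (k u) (k v)) :
    ENNReal.ofReal (l ^ 2 / (2 * Real.pi) * Real.log (b / a)) ≤ volume (k '' ball 1 1) := by
  have hpi := Real.pi_pos
  rw [← lintegral_norm_deriv_sq_eq isOpen_ball hk hinj, ← lintegral_indicator measurableSet_ball,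
    ← Complex.lintegral_comp_polarCoord_symm, polarCoord_target, Measure.volume_eq_prod,
    ← Measure.prod_restrict, lintegral_prod]
  · calc ENNReal.ofReal (l ^ 2 / (2 * Real.pi) * Real.log (b / a))
        = ENNReal.ofReal (∫ r in a..b, l ^ 2 / (2 * Real.pi) * r⁻¹) := by
          rw [intervalIntegral.integral_const_mul, integral_inv_of_pos ha (ha.trans_le hab)]
      _ = ∫⁻ r in Ioo a b, ENNReal.ofReal (l ^ 2 / (2 * Real.pi) * r⁻¹) := by
          rw [intervalIntegral.integral_of_le hab, integral_Ioc_eq_integral_Ioo,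
            ofReal_integral_eq_lintegral_ofReal]
          · refine (ContinuousOn.integrableOn_Icc ?_).mono_set Ioo_subset_Icc_self
            exact continuousOn_const.mul (continuousOn_id.inv₀ fun x hx => (ha.trans_le hx.1).ne')
          · refine (ae_restrict_iff' measurableSet_Ioo).2 (Eventually.of_forall fun x hx => ?_)
            have := ha.trans hx.1
            positivity
      _ ≤ ∫⁻ r in Ioo a b, ∫⁻ θ in Ioo (-Real.pi) Real.pi, ENNReal.ofReal r *
            (ball (1 : ℂ) 1).indicator (fun u => ENNReal.ofReal (‖deriv k u‖ ^ 2))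
            (r * (Real.cos θ + Real.sin θ * Complex.I)) := by
          refine setLIntegral_mono' measurableSet_Ioo fun r hr => ?_
          obtain ⟨u, hu, v, hv, hur, hvr, huv⟩ := h r hr
          convert ofReal_le_lintegral_arc hk (ha.trans hr.1) hl hu hv hur hvr huv using 2
          field_simp
      _ ≤ ∫⁻ r in Ioi 0, ∫⁻ θ in Ioo (-Real.pi) Real.pi, ENNReal.ofReal r *
            (ball (1 : ℂ) 1).indicator (fun u => ENNReal.ofReal (‖deriv k u‖ ^ 2))
            (r * (Real.cos θ + Real.sin θ * Complex.I)) :=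
          lintegral_mono_set fun r hr => ha.trans hr.1
      _ = _ := by simp only [Complex.polarCoord_symm_apply, smul_eq_mul]
  · have h1 : Measurable ((ball (1 : ℂ) 1).indicator fun u => ENNReal.ofReal (‖deriv k u‖ ^ 2)) :=
      ((measurable_deriv k).norm.pow_const 2).ennreal_ofReal.indicator measurableSet_ball
    simp only [Complex.polarCoord_symm_apply, smul_eq_mul]
    exact ((measurable_fst.ennreal_ofReal).mul
      (h1.comp (by fun_prop : Measurable fun p : ℝ × ℝ =>
        (p.1 * (Real.cos p.2 + Real.sin p.2 * Complex.I) : ℂ)))).aemeasurable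

/-- Every boundary point of the disk is cut off by a crosscut with short image. -/
lemma exists_dist_image_le (c : ℂ) (R : ℝ) {l : ℝ} (hl : 0 < l) :
    ∃ a, 0 < a ∧ a < 1 ∧ ∀ f : ℂ → ℂ, DifferentiableOn ℂ f (ball 0 1) → InjOn f (ball 0 1) →
      MapsTo f (ball 0 1) (ball c R) → ∀ t ∈ sphere (0 : ℂ) 1, ∃ r, a < r ∧ r < 1 ∧
        ∀ w ∈ ball (0 : ℂ) 1, ∀ w' ∈ ball (0 : ℂ) 1, dist w t = r → dist w' t = r →
          dist (f w) (f w') ≤ l := by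
  have hpi := Real.pi_pos
  set M : ℝ := (volume (ball c R)).toReal with hM
  set s : ℝ := 2 * Real.pi / l ^ 2 * (M + 1) with hs
  have hM0 : 0 ≤ M := ENNReal.toReal_nonneg
  have hs0 : 0 < s := by positivity
  refine ⟨Real.exp (-s), Real.exp_pos _, Real.exp_lt_one_iff.2 (by linarith), ?_⟩
  intro f hf hinj hmaps t ht
  by_contra! hcon
  have ht1 : ‖t‖ = 1 := by simpa using ht
  have hdist : ∀ u : ℂ, dist (t - t * u) t = ‖u‖ := fun u => by
    rw [dist_eq_norm, sub_sub_cancel_left, norm_neg, norm_mul, ht1, one_mul]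
  have hnorm : ∀ u : ℂ, ‖t - t * u‖ = ‖u - 1‖ := fun u => by
    rw [show t - t * u = -(t * (u - 1)) by ring, norm_neg, norm_mul, ht1, one_mul]
  have ht0 : t ≠ 0 := by
    rw [← norm_pos_iff, ht1]
    exact one_pos
  have hmem : MapsTo (fun u => t - t * u) (ball 1 1) (ball 0 1) := fun u hu => by
    rw [mem_ball_zero_iff, hnorm, ← dist_eq_norm]
    exact hu
  have hk : DifferentiableOn ℂ (fun u => f (t - t * u)) (ball 1 1) :=
    hf.comp (by fun_prop) hmem
  have hki : InjOn (fun u => f (t - t * u)) (ball 1 1) := fun u hu v hv huv => by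
    have := hinj (hmem hu) (hmem hv) huv
    exact mul_left_cancel₀ ht0 (sub_right_inj.1 this)
  have key := ofReal_mul_log_le_volume hk hki (Real.exp_pos (-s)) (b := 1) (l := l)
    (Real.exp_le_one_iff.2 (by linarith)) hl.le (by
      intro r hr
      obtain ⟨w, hw, w', hw', hwr, hwr', hlt⟩ := hcon r hr.1 hr.2
      have hinv : ∀ w : ℂ, t - t * (1 - w / t) = w := fun w => by field_simp; ring
      refine ⟨1 - w / t, ?_, 1 - w' / t, ?_, ?_, ?_, ?_⟩
      · rw [mem_ball, dist_eq_norm, ← hnorm, hinv]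
        simpa using hw
      · rw [mem_ball, dist_eq_norm, ← hnorm, hinv]
        simpa using hw'
      · rw [← hdist, hinv, hwr]
      · rw [← hdist, hinv, hwr']
      · simp only [hinv]
        exact hlt.le)
  have hle : volume ((fun u => f (t - t * u)) '' ball 1 1) ≤ ENNReal.ofReal M := by
    rw [hM, ENNReal.ofReal_toReal measure_ball_lt_top.ne]
    exact measure_mono (image_subset_iff.2 (hmaps.comp hmem))
  have hfin := (ENNReal.ofReal_le_ofReal_iff hM0).1 (key.trans hle)
  rw [one_div, Real.log_inv, Real.log_exp, neg_neg] at hfin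
  have : l ^ 2 / (2 * Real.pi) * s = M + 1 := by
    rw [hs]
    field_simp
  linarith

end LengthArea

lemma closure_subset_union_of_frontier_subset {D K : Set ℂ} (h : frontier D ⊆ K) :
    closure D ⊆ D ∪ K := by
  intro x hx
  by_cases hxD : x ∈ D
  · exact Or.inl hxD
  · exact Or.inr (h ⟨hx, fun hi => hxD (interior_subset hi)⟩)

/-- The oscillation of a Riemann map near a boundary point, in terms of the local connectedness
of the complement. -/
lemma IsContinuumDomain.exists_dist_le (z₀ : ℂ) (R : ℝ) {l ε : ℝ} (hl : 0 < l) (hle : l ≤ ε) :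
    ∃ a, 0 < a ∧ ∀ (D K : Set ℂ) (f g : ℂ → ℂ), IsContinuumDomain D K →
      D ⊆ ball z₀ R → DifferentiableOn ℂ f (ball 0 1) → MapsTo f (ball 0 1) D →
      ContinuousOn g D → MapsTo g D (ball 0 1) → (∀ w ∈ ball (0 : ℂ) 1, g (f w) = w) →
      (∀ z ∈ D, f (g z) = z) → f 0 = z₀ → (∀ p ∈ K, ε + 2 * l < dist z₀ p) →
      (∀ p ∈ K, ∃ κ ⊆ K, IsCompact κ ∧ IsPreconnected κ ∧ K ∩ closedBall p (2 * l) ⊆ κ ∧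
        κ ⊆ closedBall p ε) →
      ∀ t ∈ sphere (0 : ℂ) 1, ∀ w ∈ ball (0 : ℂ) 1, ∀ w' ∈ ball (0 : ℂ) 1, dist w t < a →
        dist w' t < a → dist (f w) (f w') ≤ 4 * ε + 4 * l := by
  obtain ⟨a, ha0, ha1, ha⟩ := exists_dist_image_le z₀ R hl
  refine ⟨a, ha0, ?_⟩
  intro D K f g hD hDR hf hfD hg hgD hgf hfg hf0 hz₀ hK t ht
  have hinj : InjOn f (ball 0 1) := fun x hx y hy hxy => by rw [← hgf x hx, hxy, hgf y hy]
  obtain ⟨r, har, hr1, hr⟩ := ha f hf hinj (fun w hw => hDR (hfD hw)) t ht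
  have hr0 := ha0.trans har
  have ht1 : ‖t‖ = 1 := by simpa using ht
  set A : Set ℂ := ball (0 : ℂ) 1 ∩ sphere t r with hA
  have hAne : A.Nonempty := by
    refine ⟨(1 - r : ℝ) * t, ?_, ?_⟩
    · rw [mem_ball_zero_iff, norm_mul, ht1, Complex.norm_real, Real.norm_of_nonneg (by linarith)]
      linarith
    · rw [mem_sphere, dist_eq_norm, show ((1 - r : ℝ) : ℂ) * t - t = -((r : ℝ) * t) by
        push_cast; ring, norm_neg, norm_mul, ht1, Complex.norm_real, Real.norm_of_nonneg hr0.le,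
        mul_one]
  obtain ⟨w₀, hw₀⟩ := hAne
  set C : Set ℂ := closure (f '' A) with hC
  have hAD : f '' A ⊆ D := image_subset_iff.2 fun w hw => hfD hw.1
  have hCball : C ⊆ closedBall (f w₀) l := by
    refine closure_minimal ?_ isClosed_closedBall
    rintro _ ⟨w, hw, rfl⟩
    exact hr w hw.1 w₀ hw₀.1 hw.2 hw₀.2
  have hCc : IsCompact C := (isCompact_closedBall _ _).of_isClosed_subset isClosed_closure hCball
  have hDo := hD.isOpen
  have hCK : (C ∩ K).Nonempty := by
    by_contra hemp
    have hCD : C ⊆ D := by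
      intro x hx
      rcases closure_subset_union_of_frontier_subset hD.frontier_subset (closure_mono hAD hx)
        with h | h
      · exact h
      · exact absurd ⟨x, hx, h⟩ hemp
    have hgC : IsCompact (g '' C) := hCc.image_of_continuousOn (hg.mono hCD)
    have hAg : A = g '' C ∩ sphere t r := by
      ext w
      constructor
      · exact fun hw => ⟨⟨f w, subset_closure (mem_image_of_mem f hw), hgf w hw.1⟩, hw.2⟩
      · rintro ⟨⟨z, hz, rfl⟩, hw⟩
        exact ⟨hgD (hCD hz), hw⟩
    have hsph : IsPreconnected (sphere t r) :=
      isPreconnected_sphere (by rw [Complex.rank_real_complex]; norm_num) t r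
    have hfar : (1 + r : ℝ) * t ∈ sphere t r ∩ (g '' C)ᶜ := by
      constructor
      · rw [mem_sphere, dist_eq_norm, show ((1 + r : ℝ) : ℂ) * t - t = (r : ℝ) * t by
          push_cast; ring, norm_mul, ht1, Complex.norm_real, Real.norm_of_nonneg hr0.le, mul_one]
      · rintro ⟨z, hz, hzt⟩
        have := mem_ball_zero_iff.1 (hgD (hCD hz))
        rw [hzt, norm_mul, ht1, Complex.norm_real, Real.norm_of_nonneg (by linarith)] at this
        linarith
    obtain ⟨x, hx, hx1, hx2⟩ := hsph (ball 0 1) (g '' C)ᶜ isOpen_ball hgC.isClosed.isOpen_compl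
      (fun x hx => by
        by_cases h : x ∈ g '' C
        · exact Or.inl (hAg.ge ⟨h, hx⟩).1
        · exact Or.inr h) ⟨w₀, hw₀.2, hw₀.1⟩ ⟨_, hfar⟩
    exact hx2 (hAg.le ⟨hx1, hx⟩).1
  obtain ⟨p, hpC, hpK⟩ := hCK
  obtain ⟨κ, hκK, hκc, hκp, hκ, hκε⟩ := hK p hpK
  have hpw : dist p (f w₀) ≤ l := hCball hpC
  have hCp : C ⊆ closedBall p (2 * l) := fun x hx => by
    have h1 : dist x (f w₀) ≤ l := hCball hx
    rw [mem_closedBall]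
    linarith [dist_triangle_right x p (f w₀)]
  have hKL : K ∩ (κ ∪ C) = κ := by
    refine subset_antisymm ?_ fun x hx => ⟨hκK hx, Or.inl hx⟩
    rintro x ⟨hxK, hx | hx⟩
    · exact hx
    · exact hκ ⟨hxK, hCp hx⟩
  have hsub : κ ∪ C ⊆ closedBall p (ε + 2 * l) := union_subset
    (hκε.trans (closedBall_subset_closedBall (by linarith)))
    (hCp.trans (closedBall_subset_closedBall (by linarith)))
  have main : ∀ w ∈ ball (0 : ℂ) 1, dist w t < a → dist (f w) p ≤ ε + 2 * l := by
    intro w hw hwa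
    by_contra! hlt
    have hz₀D : z₀ ∈ D := hf0 ▸ hfD (mem_ball_self one_pos)
    have h1 : f w ∈ connectedComponentIn Kᶜ z₀ := by
      rw [← hD.eq_connectedComponentIn hz₀D]
      exact hfD hw
    have h2 : f w ∈ connectedComponentIn (κ ∪ C)ᶜ z₀ :=
      (isPreconnected_compl_closedBall p (by linarith : 0 < ε + 2 * l)).subset_connectedComponentIn
        (fun h => absurd (hz₀ p hpK) (not_lt.2 h)) (compl_subset_compl.2 hsub)
        (fun h => absurd hlt (not_lt.2 h))
    have h3 := mem_connectedComponentIn_compl_union hD.isCompact (hκc.union hCc)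
      (by rwa [hKL]) h1 h2
    set E := connectedComponentIn (K ∪ (κ ∪ C))ᶜ z₀ with hE
    have hEsub : E ⊆ (K ∪ (κ ∪ C))ᶜ := connectedComponentIn_subset _ _
    have hz₀E : z₀ ∈ E := by
      refine mem_connectedComponentIn ?_
      by_contra hn
      rw [hE, connectedComponentIn_eq_empty hn] at h3
      exact h3
    have hED : E ⊆ D := by
      rw [hD.eq_connectedComponentIn hz₀D]
      exact isPreconnected_connectedComponentIn.subset_connectedComponentIn hz₀E
        (hEsub.trans (compl_subset_compl.2 subset_union_left))
    have hgE : ContinuousOn (fun z => dist (g z) t) E :=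
      (continuous_id.dist continuous_const).comp_continuousOn (hg.mono hED)
    have hiv := isPreconnected_connectedComponentIn.intermediate_value h3 hz₀E hgE
    obtain ⟨z, hzE, hzr⟩ := hiv (show r ∈ Icc (dist (g (f w)) t) (dist (g z₀) t) by
      rw [hgf w hw, ← hf0, hgf 0 (mem_ball_self one_pos), dist_zero_left, ht1]
      exact ⟨by linarith, hr1.le⟩)
    refine hEsub hzE (Or.inr (Or.inr (subset_closure ⟨g z, ⟨hgD (hED hzE), hzr⟩, hfg z (hED hzE)⟩)))
  intro w hw w' hw' hwa hwa'
  have h1 := main w hw hwa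
  have h2 := main w' hw' hwa'
  have h3 := dist_triangle_right (f w) (f w') p
  linarith

/-- Uniform local connectedness of a set, by compact connected pieces. -/
def IsUniformlyLocallyConnected (K : Set ℂ) : Prop :=
  ∀ ε > 0, ∃ η > 0, ∀ p ∈ K, ∃ κ ⊆ K, IsCompact κ ∧ IsPreconnected κ ∧
    K ∩ closedBall p η ⊆ κ ∧ κ ⊆ closedBall p ε

/-- A conformal map of the unit disk onto `D` that is continuous up to the boundary. -/
structure IsDiskMap (f : ℂ → ℂ) (D : Set ℂ) : Prop where
  continuousOn : ContinuousOn f (closedBall 0 1)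
  differentiableOn : DifferentiableOn ℂ f (ball 0 1)
  injOn : InjOn f (ball 0 1)
  image_ball : f '' ball 0 1 = D
  notMem : ∀ w ∈ sphere (0 : ℂ) 1, f w ∉ D

namespace IsDiskMap

variable {f : ℂ → ℂ} {D : Set ℂ}

lemma isOpen (h : IsDiskMap f D) : IsOpen D :=
  h.image_ball ▸ isOpen_image_of_injOn isOpen_ball h.differentiableOn h.injOn

lemma mem (h : IsDiskMap f D) {w : ℂ} (hw : w ∈ ball (0 : ℂ) 1) : f w ∈ D :=
  h.image_ball ▸ mem_image_of_mem f hw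

lemma image_closedBall (h : IsDiskMap f D) : f '' closedBall 0 1 = closure D := by
  refine subset_antisymm ?_ ?_
  · rw [← h.image_ball, ← closure_ball (0 : ℂ) one_ne_zero]
    exact ContinuousOn.image_closure (by
      rw [closure_ball (0 : ℂ) one_ne_zero]; exact h.continuousOn)
  · refine closure_minimal ?_ ((isCompact_closedBall _ _).image_of_continuousOn
      h.continuousOn).isClosed
    rw [← h.image_ball]
    exact image_mono ball_subset_closedBall

lemma image_sphere (h : IsDiskMap f D) : f '' sphere 0 1 = frontier D := by
  rw [h.isOpen.frontier_eq, ← h.image_closedBall]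
  ext z
  constructor
  · rintro ⟨w, hw, rfl⟩
    exact ⟨mem_image_of_mem f (sphere_subset_closedBall hw), h.notMem w hw⟩
  · rintro ⟨⟨w, hw, rfl⟩, hn⟩
    refine ⟨w, ?_, rfl⟩
    rw [← ball_union_sphere] at hw
    exact hw.resolve_left fun hw => hn (h.mem hw)

lemma mem_frontier (h : IsDiskMap f D) {w : ℂ} (hw : w ∈ sphere (0 : ℂ) 1) : f w ∈ frontier D :=
  h.image_sphere ▸ mem_image_of_mem f hw

lemma exists_inverse (h : IsDiskMap f D) : ∃ g : ℂ → ℂ, DifferentiableOn ℂ g D ∧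
    MapsTo g D (ball 0 1) ∧ (∀ w ∈ ball (0 : ℂ) 1, g (f w) = w) ∧ (∀ z ∈ D, f (g z) = z) := by
  have hinv : ∀ w ∈ ball (0 : ℂ) 1, Function.invFunOn f (ball 0 1) (f w) = w := fun w hw =>
    h.injOn.leftInvOn_invFunOn hw
  refine ⟨Function.invFunOn f (ball 0 1), ?_, ?_, hinv, ?_⟩
  · rw [← h.image_ball]
    exact differentiableOn_of_leftInvOn isOpen_ball h.differentiableOn hinv
  · rw [← h.image_ball]
    exact fun z hz => Function.invFunOn_mem hz
  · rw [← h.image_ball]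
    exact fun z hz => Function.invFunOn_eq hz

end IsDiskMap

/-- The uniform modulus of continuity at the boundary of conformal maps of the disk. -/
lemma IsDiskMap.exists_dist_le (z₀ : ℂ) (R : ℝ) {l ε : ℝ} (hl : 0 < l) (hle : l ≤ ε) :
    ∃ a, 0 < a ∧ ∀ (D K : Set ℂ) (f : ℂ → ℂ), IsContinuumDomain D K →
      D ⊆ ball z₀ R → IsDiskMap f D → f 0 = z₀ → (∀ p ∈ K, ε + 2 * l < dist z₀ p) →
      (∀ p ∈ K, ∃ κ ⊆ K, IsCompact κ ∧ IsPreconnected κ ∧ K ∩ closedBall p (2 * l) ⊆ κ ∧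
        κ ⊆ closedBall p ε) →
      ∀ t ∈ sphere (0 : ℂ) 1, ∀ w ∈ closedBall (0 : ℂ) 1, dist w t < a →
        dist (f w) (f t) ≤ 4 * ε + 4 * l := by
  obtain ⟨a, ha0, ha⟩ := IsContinuumDomain.exists_dist_le z₀ R hl hle
  refine ⟨a, ha0, fun D K f hD hDR hf hf0 hz₀ hK t ht w hw hwt => ?_⟩
  obtain ⟨g, hg, hgD, hgf, hfg⟩ := hf.exists_inverse
  have key := ha D K f g hD hDR hf.differentiableOn (fun w hw => hf.mem hw) hg.continuousOn hgD hgf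
    hfg hf0 hz₀ hK t ht
  have hlim : ∀ u ∈ closedBall (0 : ℂ) 1,
      Tendsto (fun s : ℝ => (s : ℂ) * u) (𝓝[<] 1) (𝓝 u) ∧
      (∀ᶠ s : ℝ in 𝓝[<] 1, (s : ℂ) * u ∈ ball (0 : ℂ) 1) ∧
      Tendsto (fun s : ℝ => f ((s : ℂ) * u)) (𝓝[<] 1) (𝓝 (f u)) := by
    intro u hu
    have h1 : Tendsto (fun s : ℝ => (s : ℂ) * u) (𝓝[<] 1) (𝓝 u) := by
      have : Continuous fun s : ℝ => (s : ℂ) * u := by fun_prop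
      simpa using (this.tendsto 1).mono_left nhdsWithin_le_nhds
    have h2 : ∀ᶠ s : ℝ in 𝓝[<] 1, (s : ℂ) * u ∈ ball (0 : ℂ) 1 := by
      filter_upwards [self_mem_nhdsWithin,
        mem_nhdsWithin_of_mem_nhds (lt_mem_nhds (zero_lt_one' ℝ))] with s hs hs0
      rw [mem_ball_zero_iff, norm_mul, Complex.norm_real, Real.norm_of_nonneg hs0.le]
      exact (mul_le_of_le_one_right hs0.le (mem_closedBall_zero_iff.1 hu)).trans_lt hs
    refine ⟨h1, h2, (hf.continuousOn u hu).tendsto.comp ?_⟩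
    exact tendsto_nhdsWithin_iff.2 ⟨h1, h2.mono fun s hs => ball_subset_closedBall hs⟩
  obtain ⟨h1, h2, h3⟩ := hlim w hw
  obtain ⟨h1', h2', h3'⟩ := hlim t (sphere_subset_closedBall ht)
  refine le_of_tendsto (h3.dist h3') ?_
  have h4 := (h1.dist tendsto_const_nhds).eventually (gt_mem_nhds hwt)
  have h5 := (h1'.dist (tendsto_const_nhds (x := t))).eventually (gt_mem_nhds (by simpa using ha0))
  filter_upwards [h2, h2', h4, h5] with s hs hs' hd hd'
  exact key _ hs _ hs' hd hd'

/-- Carathéodory's theorem: continuous extension of the Riemann map. -/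
lemma IsContinuumDomain.exists_isDiskMap {D K : Set ℂ} (h : IsContinuumDomain D K)
    (hK : IsUniformlyLocallyConnected K) {z₀ : ℂ} (hz₀ : z₀ ∈ D) :
    ∃ f, IsDiskMap f D ∧ f 0 = z₀ := by
  obtain ⟨f, g, hf, hfD, hg, hgD, hgf, hfg, hf0⟩ := h.exists_riemann_map hz₀
  obtain ⟨R, hR0, hR⟩ := h.isBounded.subset_ball_lt 0 z₀
  have hz₀K : z₀ ∉ K := h.subset_compl hz₀
  obtain ⟨ρ, hρ, hρK⟩ := Metric.isOpen_iff.1 h.isCompact.isClosed.isOpen_compl z₀ hz₀K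
  have hosc : ∀ ε > 0, ∃ a > 0, ∀ t ∈ sphere (0 : ℂ) 1, ∀ w ∈ ball (0 : ℂ) 1,
      ∀ w' ∈ ball (0 : ℂ) 1, dist w t < a → dist w' t < a → dist (f w) (f w') < ε := by
    intro ε hε
    set ε' := min (ε / 9) (ρ / 4) with hε'
    have hε'0 : 0 < ε' := by positivity
    obtain ⟨η, hη, hκ⟩ := hK ε' hε'0
    set l := min (η / 2) ε' with hl
    have hl0 : 0 < l := by positivity
    obtain ⟨a, ha0, ha⟩ := IsContinuumDomain.exists_dist_le z₀ R hl0 (min_le_right _ _)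
    refine ⟨a, ha0, fun t ht w hw w' hw' hwt hwt' => ?_⟩
    have hle : l ≤ ε' := min_le_right _ _
    have hle1 : l ≤ η / 2 := min_le_left _ _
    have hle2 : ε' ≤ ε / 9 := min_le_left _ _
    have hle3 : ε' ≤ ρ / 4 := min_le_right _ _
    refine (ha D K f g h hR hf hfD hg.continuousOn hgD hgf hfg hf0 ?_ ?_ t ht w hw w' hw' hwt
      hwt').trans_lt (by linarith)
    · intro p hp
      by_contra! hlt
      refine hρK (?_ : p ∈ ball z₀ ρ) hp
      rw [mem_ball, dist_comm]
      linarith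
    · intro p hp
      obtain ⟨κ, h1, h2, h3, h4, h5⟩ := hκ p hp
      exact ⟨κ, h1, h2, h3, (inter_subset_inter_right _
        (closedBall_subset_closedBall (by linarith))).trans h4, h5⟩
  have hex : ContinuousOn (extendFrom (ball 0 1) f) (closedBall 0 1) := by
    refine continuousOn_extendFrom (closure_ball (0 : ℂ) one_ne_zero).ge fun t ht => ?_
    rw [← ball_union_sphere] at ht
    rcases ht with ht | ht
    · exact ⟨f t, (hf.continuousOn t ht).tendsto⟩
    · have hne : (𝓝[ball 0 1] t).NeBot := by
        rw [← mem_closure_iff_nhdsWithin_neBot, closure_ball (0 : ℂ) one_ne_zero]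
        exact sphere_subset_closedBall ht
      rw [← cauchy_map_iff_exists_tendsto, Metric.cauchy_iff]
      refine ⟨inferInstance, fun ε hε => ?_⟩
      obtain ⟨a, ha, hosc⟩ := hosc ε hε
      refine ⟨f '' (ball 0 1 ∩ ball t a), image_mem_map (inter_mem self_mem_nhdsWithin
        (mem_nhdsWithin_of_mem_nhds (ball_mem_nhds t ha))), ?_⟩
      rintro _ ⟨w, hw, rfl⟩ _ ⟨w', hw', rfl⟩
      exact hosc t ht w hw.1 w' hw'.1 hw.2 hw'.2
  have heq : ∀ w ∈ ball (0 : ℂ) 1, extendFrom (ball 0 1) f w = f w := fun w hw =>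
    extendFrom_eq (subset_closure hw) (hf.continuousOn w hw).tendsto
  refine ⟨extendFrom (ball 0 1) f, ⟨hex, hf.congr heq, ?_, ?_, ?_⟩, ?_⟩
  · intro x hx y hy hxy
    rw [heq x hx, heq y hy] at hxy
    rw [← hgf x hx, hxy, hgf y hy]
  · rw [image_congr heq]
    exact subset_antisymm (image_subset_iff.2 hfD) fun z hz => ⟨g z, hgD hz, hfg z hz⟩
  · intro w hw hwD
    have hne : (𝓝[ball 0 1] w).NeBot := by
      rw [← mem_closure_iff_nhdsWithin_neBot, closure_ball (0 : ℂ) one_ne_zero]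
      exact sphere_subset_closedBall hw
    have h1 : Tendsto f (𝓝[ball 0 1] w) (𝓝 (extendFrom (ball 0 1) f w)) := by
      refine (((hex w (sphere_subset_closedBall hw)).mono ball_subset_closedBall).tendsto).congr' ?_
      filter_upwards [self_mem_nhdsWithin] with x hx using heq x hx
    have h2 : Tendsto (fun x => g (f x)) (𝓝[ball 0 1] w)
        (𝓝 (g (extendFrom (ball 0 1) f w))) :=
      ((hg.continuousOn.continuousAt (h.isOpen.mem_nhds hwD)).tendsto).comp h1
    have h3 : Tendsto (fun x => g (f x)) (𝓝[ball 0 1] w) (𝓝 w) := by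
      refine (tendsto_id.mono_left nhdsWithin_le_nhds).congr' ?_
      filter_upwards [self_mem_nhdsWithin] with x hx using (hgf x hx).symm
    have h4 := hgD hwD
    rw [tendsto_nhds_unique h2 h3, mem_ball_zero_iff, mem_sphere_zero_iff_norm.1 hw] at h4
    exact lt_irrefl _ h4
  · rw [heq 0 (mem_ball_self one_pos), hf0]

lemma IsDiskMap.exists_notMem_of_isOpen {f : ℂ → ℂ} {D : Set ℂ} (h : IsDiskMap f D) {V : Set ℂ}
    (hV : V.Finite) {O : Set ℂ} (hO : IsOpen O) (hne : (O ∩ sphere (0 : ℂ) 1).Nonempty) :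
    ∃ w ∈ O ∩ sphere (0 : ℂ) 1, f w ∉ V := by
  by_contra! hcon
  obtain ⟨t, htO, ht⟩ := hne
  rw [mem_sphere_zero_iff_norm] at ht
  obtain ⟨C, hC⟩ := (isCompact_sphere (0 : ℂ) 1).elim_finite_subcover
    (fun c : sphere (0 : ℂ) 1 => (fun u : ℂ => (c : ℂ) * u) ⁻¹' O)
    (fun c => hO.preimage (by fun_prop)) (by
      intro u hu
      rw [mem_sphere_zero_iff_norm] at hu
      have hu0 : u ≠ 0 := by rintro rfl; simp at hu
      refine mem_iUnion.2 ⟨⟨t / u, by simp [ht, hu]⟩, ?_⟩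
      simpa [hu0] using htO)
  set P : ℂ → ℂ := fun w => ∏ c ∈ C, ∏ p ∈ hV.toFinset, (f (c * w) - p) with hP
  have hcn : ∀ (c : sphere (0 : ℂ) 1) (w : ℂ), ‖(c : ℂ) * w‖ = ‖w‖ := fun c w => by
    rw [norm_mul, mem_sphere_zero_iff_norm.1 c.2, one_mul]
  have hd : DiffContOnCl ℂ P (ball 0 1) := by
    refine ⟨?_, ?_⟩
    · refine DifferentiableOn.fun_finsetProd fun c _ => DifferentiableOn.fun_finsetProd fun p _ => ?_
      refine DifferentiableOn.sub_const ?_ p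
      refine h.differentiableOn.comp (by fun_prop) fun w hw => ?_
      rw [mem_ball_zero_iff] at hw ⊢
      rwa [hcn]
    · rw [closure_ball _ one_ne_zero]
      refine continuousOn_finsetProd _ fun c _ => continuousOn_finsetProd _ fun p _ => ?_
      refine ContinuousOn.sub ?_ continuousOn_const
      refine h.continuousOn.comp (by fun_prop) fun w hw => ?_
      rw [mem_closedBall_zero_iff] at hw ⊢
      rwa [hcn]
  have h0 : ∀ w ∈ ball (0 : ℂ) 1, P w = 0 := by
    intro w hw
    refine norm_le_zero_iff.1 (Complex.norm_le_of_forall_mem_frontier_norm_le isBounded_ball hd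
      (fun z hz => ?_) (subset_closure hw))
    rw [frontier_ball _ one_ne_zero] at hz
    obtain ⟨c, hc, hcz⟩ := mem_iUnion₂.1 (hC hz)
    refine norm_le_zero_iff.2 (Finset.prod_eq_zero hc ?_)
    have h1 := hcon (c * z) ⟨hcz, by
      rw [mem_sphere_zero_iff_norm] at hz ⊢
      rwa [hcn]⟩
    exact Finset.prod_eq_zero (hV.mem_toFinset.2 h1) (sub_self _)
  have hfin : (⋃ c ∈ C, ⋃ p ∈ hV.toFinset, {w ∈ ball (0 : ℂ) 1 | f (c * w) = p}).Finite := by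
    refine C.finite_toSet.biUnion fun c _ => hV.toFinset.finite_toSet.biUnion fun p _ => ?_
    refine Set.Subsingleton.finite fun w hw w' hw' => ?_
    have h1 := h.injOn (by simpa [hcn] using hw.1 : (c : ℂ) * w ∈ ball 0 1)
      (by simpa [hcn] using hw'.1 : (c : ℂ) * w' ∈ ball 0 1) (hw.2.trans hw'.2.symm)
    refine mul_left_cancel₀ ?_ h1
    intro hc
    simpa [hc] using c.2
  refine infinite_of_mem_nhds (0 : ℂ) (ball_mem_nhds _ one_pos) (hfin.subset fun w hw => ?_)
  have h1 := h0 w hw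
  simp only [hP, Finset.prod_eq_zero_iff] at h1
  obtain ⟨c, hc, p, hp, hcp⟩ := h1
  exact mem_iUnion₂.2 ⟨c, hc, mem_iUnion₂.2 ⟨p, hp, hw, sub_eq_zero.1 hcp⟩⟩

lemma IsDiskMap.deriv_ne_zero {f : ℂ → ℂ} {D : Set ℂ} (h : IsDiskMap f D) {m : ℂ}
    (hm : m ∈ ball (0 : ℂ) 1) : deriv f m ≠ 0 := by
  obtain ⟨g, hg, hgD, hgf, hfg⟩ := h.exists_inverse
  have h1 : HasDerivAt f (deriv f m) m :=
    (h.differentiableOn.differentiableAt (isOpen_ball.mem_nhds hm)).hasDerivAt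
  have h2 : HasDerivAt g (deriv g (f m)) (f m) :=
    (hg.differentiableAt (h.isOpen.mem_nhds (h.mem hm))).hasDerivAt
  have h3 : HasDerivAt id (deriv g (f m) * deriv f m) m := by
    refine (h2.comp m h1).congr_of_eventuallyEq ?_
    filter_upwards [isOpen_ball.mem_nhds hm] with w hw using (hgf w hw).symm
  have h4 := h3.unique (hasDerivAt_id m)
  intro h0
  rw [h0, mul_zero] at h4
  exact zero_ne_one h4

lemma IsDiskMap.eventually_norm_sub_lt {f : ℂ → ℂ} {D : Set ℂ} (h : IsDiskMap f D) {m : ℂ}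
    (hm : m ∈ ball (0 : ℂ) 1) (d : ℂ) : ∀ᶠ ε : ℝ in 𝓝 0, ∀ w ∈ closedBall (0 : ℂ) 1,
      w ≠ m + Complex.I * ε * d → w ≠ m - Complex.I * ε * d →
      ‖(f w - f (m + Complex.I * ε * d)) * (w - (m - Complex.I * ε * d)) -
        (f w - f (m - Complex.I * ε * d)) * (w - (m + Complex.I * ε * d))‖ <
      ‖(f w - f (m - Complex.I * ε * d)) * (w - (m + Complex.I * ε * d))‖ := by
  have hdm : DifferentiableAt ℂ f m := h.differentiableOn.differentiableAt (isOpen_ball.mem_nhds hm)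
  have hc1 : Tendsto (fun x : ℝ × ℂ => m + Complex.I * x.1 * d) (𝓝 (0, m)) (𝓝 m) :=
    Continuous.tendsto' (by fun_prop) _ _ (by simp)
  have hc2 : Tendsto (fun x : ℝ × ℂ => m - Complex.I * x.1 * d) (𝓝 (0, m)) (𝓝 m) :=
    Continuous.tendsto' (by fun_prop) _ _ (by simp)
  have h' : ∀ᶠ ε : ℝ in 𝓝 0, ∀ w ∈ closedBall (0 : ℂ) 1, w ∈ closedBall (0 : ℂ) 1 →
      w ≠ m + Complex.I * ε * d → w ≠ m - Complex.I * ε * d →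
      ‖(f w - f (m + Complex.I * ε * d)) * (w - (m - Complex.I * ε * d)) -
        (f w - f (m - Complex.I * ε * d)) * (w - (m + Complex.I * ε * d))‖ <
      ‖(f w - f (m - Complex.I * ε * d)) * (w - (m + Complex.I * ε * d))‖ := by
    refine (isCompact_closedBall (0 : ℂ) 1).eventually_forall_of_forall_eventually fun w₀ hw₀ => ?_
    by_cases hwm : w₀ = m
    · subst hwm
      have hd0 := h.deriv_ne_zero hm
      have hst : HasStrictDerivAt f (deriv f w₀) w₀ :=
        (h.differentiableOn.analyticAt (isOpen_ball.mem_nhds hm)).hasStrictDerivAt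
      have hst' := hst.hasStrictFDerivAt.isLittleO.def
        (show 0 < ‖deriv f w₀‖ / 4 by positivity)
      have ht1 : Tendsto (fun x : ℝ × ℂ => (x.2, w₀ + Complex.I * x.1 * d)) (𝓝 (0, w₀))
          (𝓝 (w₀, w₀)) := by
        rw [nhds_prod_eq (x := w₀)]
        exact (Continuous.tendsto' (by fun_prop) _ _ rfl).prodMk hc1
      have ht2 : Tendsto (fun x : ℝ × ℂ => (x.2, w₀ - Complex.I * x.1 * d)) (𝓝 (0, w₀))
          (𝓝 (w₀, w₀)) := by
        rw [nhds_prod_eq (x := w₀)]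
        exact (Continuous.tendsto' (by fun_prop) _ _ rfl).prodMk hc2
      filter_upwards [ht1.eventually hst', ht2.eventually hst'] with x hx1 hx2 _ hne1 hne2
      set w := x.2
      set w1 := w₀ + Complex.I * x.1 * d
      set w2 := w₀ - Complex.I * x.1 * d
      set c := deriv f w₀
      simp only [ContinuousLinearMap.toSpanSingleton_apply, smul_eq_mul] at hx1 hx2
      have hp1 : 0 < ‖w - w1‖ := norm_pos_iff.2 (sub_ne_zero.2 hne1)
      have hp2 : 0 < ‖w - w2‖ := norm_pos_iff.2 (sub_ne_zero.2 hne2)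
      have hcp : 0 < ‖c‖ := norm_pos_iff.2 hd0
      have e1 : (f w - f w1) * (w - w2) - (f w - f w2) * (w - w1) =
          (f w - f w1 - (w - w1) * c) * (w - w2) - (f w - f w2 - (w - w2) * c) * (w - w1) := by
        ring
      have e2 : ‖(w - w2) * c‖ - ‖f w - f w2 - (w - w2) * c‖ ≤ ‖f w - f w2‖ := by
        have := norm_sub_norm_le ((w - w2) * c) (-(f w - f w2 - (w - w2) * c))
        rw [norm_neg] at this
        refine this.trans (le_of_eq ?_)
        congr 1; ring
      rw [e1]
      refine (norm_sub_le _ _).trans_lt ?_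
      rw [norm_mul, norm_mul, norm_mul]
      rw [norm_mul] at e2
      have e3 := mul_le_mul_of_nonneg_right hx1 hp2.le
      have e4 := mul_le_mul_of_nonneg_right hx2 hp1.le
      have e5 := mul_le_mul_of_nonneg_right e2 hp1.le
      have e6 : 0 < ‖c‖ * ‖w - w1‖ * ‖w - w2‖ := by positivity
      nlinarith
    · have hfw : f w₀ ≠ f m := by
        intro he
        rw [← ball_union_sphere] at hw₀
        rcases hw₀ with hw | hw
        · exact hwm (h.injOn hw hm he)
        · exact h.notMem _ hw (he ▸ h.mem hm)
      have hc1' : Tendsto (fun x : ℝ × ℂ => m + Complex.I * x.1 * d)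
          (𝓝[univ ×ˢ closedBall 0 1] (0, w₀)) (𝓝 m) :=
        (Continuous.tendsto' (by fun_prop) _ _ (by simp)).mono_left nhdsWithin_le_nhds
      have hc2' : Tendsto (fun x : ℝ × ℂ => m - Complex.I * x.1 * d)
          (𝓝[univ ×ˢ closedBall 0 1] (0, w₀)) (𝓝 m) :=
        (Continuous.tendsto' (by fun_prop) _ _ (by simp)).mono_left nhdsWithin_le_nhds
      have hw' : Tendsto (fun x : ℝ × ℂ => x.2) (𝓝[univ ×ˢ closedBall 0 1] (0, w₀)) (𝓝 w₀) :=
        (Continuous.tendsto' (by fun_prop) _ _ rfl).mono_left nhdsWithin_le_nhds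
      have hfc : Tendsto (fun x : ℝ × ℂ => f x.2) (𝓝[univ ×ˢ closedBall 0 1] (0, w₀))
          (𝓝 (f w₀)) := by
        refine (h.continuousOn w₀ hw₀).tendsto.comp (tendsto_nhdsWithin_iff.2 ⟨hw', ?_⟩)
        filter_upwards [self_mem_nhdsWithin] with x hx using hx.2
      have hf1 := hdm.continuousAt.tendsto.comp hc1'
      have hf2 := hdm.continuousAt.tendsto.comp hc2'
      have hlt := (((hfc.sub hf1).mul (hw'.sub hc2')).sub
        ((hfc.sub hf2).mul (hw'.sub hc1'))).norm.eventually_lt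
        ((hfc.sub hf2).mul (hw'.sub hc1')).norm (by
          rw [sub_self, norm_zero]
          exact norm_pos_iff.2 (mul_ne_zero (sub_ne_zero.2 hfw) (sub_ne_zero.2 hwm)))
      rw [eventually_nhdsWithin_iff] at hlt
      filter_upwards [hlt] with x hx hxc _ _ using hx ⟨mem_univ _, hxc⟩
  filter_upwards [h'] with ε hε w hw using hε w hw hw

lemma arg_add_mul_I_bounds {ε : ℝ} (hε : 0 < ε) (hε1 : ε ≤ 1 / 2) :
    Complex.arg ((1 : ℝ) + ε * Complex.I) ≤ Real.pi / 4 ∧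
      3 * Real.pi / 4 ≤ Complex.arg ((-1 : ℝ) + ε * Complex.I) := by
  have hs : ∀ z : ℂ, |z.re| = 1 → Real.arcsin (ε / ‖z‖) ≤ Real.pi / 4 := by
    intro z hz
    have hn : 1 ≤ ‖z‖ := hz ▸ Complex.abs_re_le_norm z
    have h1 : ε / ‖z‖ ≤ 1 / 2 := (div_le_self hε.le hn).trans hε1
    have h2 : (1 : ℝ) / 2 ≤ Real.sin (Real.pi / 4) := by
      rw [Real.sin_pi_div_four]
      have : (1 : ℝ) ≤ √2 := Real.one_le_sqrt.2 (by norm_num)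
      linarith
    rw [Real.arcsin_le_iff_le_sin' ⟨by linarith [Real.pi_pos], by linarith [Real.pi_pos]⟩]
    exact h1.trans h2
  constructor
  · rw [Complex.arg_of_re_nonneg (by simp)]
    simpa using hs ((1 : ℝ) + ε * Complex.I) (by simp)
  · rw [Complex.arg_of_re_neg_of_im_nonneg (by simp) (by simpa using hε.le)]
    have h1 := hs ((-1 : ℝ) + ε * Complex.I) (by simp)
    have h2 : (-(((-1 : ℝ) : ℂ) + ε * Complex.I)).im / ‖((-1 : ℝ) : ℂ) + ε * Complex.I‖ =
        -(ε / ‖((-1 : ℝ) : ℂ) + ε * Complex.I‖) := by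
      simp [neg_div]
    rw [h2, Real.arcsin_neg]
    linarith

lemma log_jump_false {ε : ℝ} (hε : 0 < ε) (hε1 : ε ≤ 1 / 2) {ℓ : ℝ → ℂ}
    (hℓ : ContinuousOn ℓ (Icc (-1) 1)) (hends : ℓ (-1) = ℓ 1)
    (h : ∀ x ∈ Icc (-1 : ℝ) 1, ‖Complex.exp (ℓ x) * (x + ε * Complex.I) - (x - ε * Complex.I)‖ <
      ‖(x : ℂ) - ε * Complex.I‖) : False := by
  have hz0 : ∀ x : ℝ, (x : ℂ) + ε * Complex.I ≠ 0 := fun x h0 => by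
    have := congrArg Complex.im h0
    simp at this; exact hε.ne' this
  have hz1 : ∀ x : ℝ, (x : ℂ) - ε * Complex.I ≠ 0 := fun x h0 => by
    have := congrArg Complex.im h0
    simp at this; exact hε.ne' this
  set G : ℝ → ℂ := fun x => Complex.exp (ℓ x) * (x + ε * Complex.I) / (x - ε * Complex.I) with hG
  have hGn : ∀ x ∈ Icc (-1 : ℝ) 1, ‖G x - 1‖ < 1 := by
    intro x hx
    have : G x - 1 = (Complex.exp (ℓ x) * (x + ε * Complex.I) - (x - ε * Complex.I)) /
        (x - ε * Complex.I) := by rw [hG, sub_div, div_self (hz1 x)]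
    rw [this, norm_div, div_lt_one (norm_pos_iff.2 (hz1 x))]
    exact h x hx
  have hGre : ∀ x ∈ Icc (-1 : ℝ) 1, 0 < (G x).re := by
    intro x hx
    have h1 := (Complex.abs_re_le_norm (G x - 1)).trans_lt (hGn x hx)
    rw [abs_lt] at h1
    simp at h1
    linarith [h1.1]
  have hGc : ContinuousOn G (Icc (-1) 1) := by
    refine ContinuousOn.div ((Complex.continuous_exp.comp_continuousOn hℓ).mul (by fun_prop))
      (by fun_prop) fun x _ => hz1 x
  set g : ℝ → ℂ := fun x => Complex.log (G x) +
    ((starRingEnd ℂ) (Complex.log (x + ε * Complex.I)) - Complex.log (x + ε * Complex.I)) with hg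
  have hlc : Continuous fun x : ℝ => Complex.log (x + ε * Complex.I) :=
    Continuous.clog (by fun_prop) fun x => Or.inr (by simpa using hε.ne')
  have hgc : ContinuousOn g (Icc (-1) 1) := by
    refine (hGc.clog fun x hx => Or.inl (hGre x hx)).add ?_
    exact ((Complex.continuous_conj.comp hlc).sub hlc).continuousOn
  have hexp : ∀ x ∈ Icc (-1 : ℝ) 1, Complex.exp (ℓ x) = Complex.exp (g x) := by
    intro x hx
    have hG0 : G x ≠ 0 := fun h0 => by simpa [h0] using hGre x hx
    rw [hg]
    simp only
    rw [Complex.exp_add, Complex.exp_log hG0, Complex.exp_sub, Complex.exp_conj,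
      Complex.exp_log (hz0 x), hG]
    have e : (starRingEnd ℂ) ((x : ℂ) + ε * Complex.I) = x - ε * Complex.I := by
      simp [sub_eq_add_neg]
    rw [e]
    field_simp [hz0 x, hz1 x]
  have key := sub_eq_sub_of_exp_eq_exp isPreconnected_Icc hℓ hgc hexp
    (x := -1) (y := 1) (by simp) (by simp)
  rw [hends, sub_right_inj] at key
  have him := congrArg Complex.im key
  simp only [hg, Complex.add_im, Complex.sub_im, Complex.conj_im, Complex.log_im] at him
  have a1 := Complex.abs_arg_lt_pi_div_two_iff.2 (Or.inl (hGre 1 (by simp)))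
  have a2 := Complex.abs_arg_lt_pi_div_two_iff.2 (Or.inl (hGre (-1) (by simp)))
  rw [abs_lt] at a1 a2
  obtain ⟨b1, b2⟩ := arg_add_mul_I_bounds hε hε1
  linarith [a1.1, a1.2, a2.1, a2.2]

lemma IsDiskMap.side_subset {f : ℂ → ℂ} {D : Set ℂ} (h : IsDiskMap f D) {a b : ℂ}
    (ha : a ∈ sphere (0 : ℂ) 1) (hb : b ∈ sphere (0 : ℂ) 1) (hf : f a = f b)
    {O : Set ℂ} (hO : IsOpen O) (hOc : Convex ℝ O) (hOs : Disjoint O (segment ℝ a b))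
    (hne : (O ∩ sphere (0 : ℂ) 1).Nonempty) :
    ∃ t ∈ frontier D \ {f a}, ∀ w ∈ O ∩ ball (0 : ℂ) 1,
      f w ∈ connectedComponentIn (f '' segment ℝ a b)ᶜ t := by
  obtain ⟨t, ⟨htO, ht⟩, hft⟩ := h.exists_notMem_of_isOpen (finite_singleton (f a)) hO hne
  refine ⟨f t, ⟨h.mem_frontier ht, hft⟩, fun w hw => ?_⟩
  have hfa : ∀ w ∈ ball (0 : ℂ) 1, f w ≠ f a := fun w hw he =>
    h.notMem a ha (he ▸ h.mem hw)
  set S : Set ℂ := {w ∈ O ∩ closedBall (0 : ℂ) 1 | f w ≠ f a} with hS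
  have hSp : IsPreconnected S := by
    refine IsPreconnected.subset_closure (s := O ∩ ball (0 : ℂ) 1)
      (hOc.inter (convex_ball _ _)).isPreconnected (fun w hw =>
        ⟨⟨hw.1, ball_subset_closedBall hw.2⟩, hfa w hw.2⟩) ?_
    refine Subset.trans (fun w hw => hw.1) ?_
    rw [← closure_ball (0 : ℂ) one_ne_zero]
    exact hO.inter_closure
  have hfS : IsPreconnected (f '' S) :=
    hSp.image f (h.continuousOn.mono fun w hw => hw.1.2)
  have hsub : f '' S ⊆ (f '' segment ℝ a b)ᶜ := by
    rintro _ ⟨w, ⟨⟨hwO, hwc⟩, hwa⟩, rfl⟩ ⟨v, hv, hvw⟩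
    have hvc : v ∈ closedBall (0 : ℂ) 1 := (convex_closedBall (0 : ℂ) 1).segment_subset
      (sphere_subset_closedBall ha) (sphere_subset_closedBall hb) hv
    have hva : v ≠ a := by rintro rfl; exact hwa hvw.symm
    have hvb : v ≠ b := by rintro rfl; exact hwa (hvw.symm.trans hf.symm)
    have hvo : v ∈ ball (0 : ℂ) 1 := by
      have hab : a ≠ b := by
        rintro rfl
        rw [segment_same] at hv
        exact hva hv
      have h1 := (strictConvex_closedBall ℝ (0 : ℂ) 1).openSegment_subset
        (sphere_subset_closedBall ha) (sphere_subset_closedBall hb) hab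
      rw [interior_closedBall _ one_ne_zero] at h1
      rw [← insert_endpoints_openSegment] at hv
      rcases hv with hv | hv | hv
      exacts [absurd hv hva, absurd hv hvb, h1 hv]
    rw [← ball_union_sphere] at hwc
    rcases hwc with hwc | hwc
    · have := h.injOn hvo hwc hvw
      exact hOs.ne_of_mem hwO hv this.symm
    · exact h.notMem w hwc (hvw ▸ h.mem hvo)
  exact hfS.subset_connectedComponentIn ⟨t, ⟨⟨htO, sphere_subset_closedBall ht⟩, hft⟩, rfl⟩ hsub
    ⟨w, ⟨⟨hw.1, ball_subset_closedBall hw.2⟩, hfa w hw.2⟩, rfl⟩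

lemma IsDiskMap.not_isPreconnected {f : ℂ → ℂ} {D : Set ℂ} (h : IsDiskMap f D) {a b : ℂ}
    (ha : a ∈ sphere (0 : ℂ) 1) (hb : b ∈ sphere (0 : ℂ) 1) (hab : a ≠ b) (hf : f a = f b) :
    ¬ IsPreconnected (frontier D \ {f a}) := by
  intro hpre
  set m : ℂ := (a + b) / 2 with hm
  set d : ℂ := (b - a) / 2 with hd
  have hd0 : d ≠ 0 := div_ne_zero (sub_ne_zero.2 hab.symm) two_ne_zero
  have hdn : 0 < ‖d‖ := norm_pos_iff.2 hd0
  have hopen : openSegment ℝ a b ⊆ ball (0 : ℂ) 1 := by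
    have h1 := (strictConvex_closedBall ℝ (0 : ℂ) 1).openSegment_subset
      (sphere_subset_closedBall ha) (sphere_subset_closedBall hb) hab
    rwa [interior_closedBall _ one_ne_zero] at h1
  have hmb : m ∈ ball (0 : ℂ) 1 := by
    refine hopen ⟨1 / 2, 1 / 2, by norm_num, by norm_num, by norm_num, ?_⟩
    simp only [Complex.real_smul, hm]
    push_cast
    ring
  have hseg : ∀ x ∈ Icc (-1 : ℝ) 1, m + d * x ∈ segment ℝ a b := by
    intro x hx
    refine ⟨(1 - x) / 2, (1 + x) / 2, by linarith [hx.2], by linarith [hx.1], by ring, ?_⟩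
    simp only [Complex.real_smul, hm, hd]
    push_cast
    ring
  have hseg0 : ∀ w ∈ segment ℝ a b, ((w - m) / d).im = 0 := by
    rintro w ⟨s, t, hs, ht, hst, rfl⟩
    have hs' : s = 1 - t := by linarith
    have : (s • a + t • b - m) / d = ((t - s : ℝ) : ℂ) := by
      rw [div_eq_iff hd0]
      simp only [Complex.real_smul, hm, hd, hs']
      push_cast
      ring
    rw [this, Complex.ofReal_im]
  have hmd : |(m / d).im| < 1 / ‖d‖ := by
    refine (Complex.abs_im_le_norm _).trans_lt ?_
    rw [norm_div]
    gcongr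
    simpa using hmb
  rw [abs_lt] at hmd
  have hside : ∀ s : ℝ, |s| = 1 → ∃ t ∈ frontier D \ {f a},
      ∀ w ∈ {w : ℂ | 0 < s * ((w - m) / d).im} ∩ ball (0 : ℂ) 1,
      f w ∈ connectedComponentIn (f '' segment ℝ a b)ᶜ t := by
    intro s hs
    refine h.side_subset ha hb hf ?_ ?_ ?_ ?_
    · exact isOpen_lt continuous_const (by fun_prop)
    · intro x hx y hy p q hp hq hpq
      have e : ((p • x + q • y - m) / d).im = p * ((x - m) / d).im + q * ((y - m) / d).im := by
        have : (p • x + q • y - m) / d = p • ((x - m) / d) + q • ((y - m) / d) := by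
          have hpq' : (p : ℂ) + q = 1 := by exact_mod_cast hpq
          simp only [Complex.real_smul]
          field_simp
          linear_combination m * hpq'
        rw [this]
        simp
      simp only [mem_ofPred_eq] at hx hy ⊢
      rw [e]
      rcases hp.eq_or_lt with rfl | hp
      · have : q = 1 := by linarith
        subst this
        simpa using hy
      · nlinarith [mul_pos hp hx, mul_nonneg hq hy.le]
    · rw [Set.disjoint_left]
      intro w hw hws
      simp only [mem_ofPred_eq] at hw
      rw [hseg0 w hws] at hw
      simp at hw
    · refine ⟨s * (Complex.I * (d / ‖d‖)), ?_, ?_⟩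
      · have hdc : (‖d‖ : ℂ) ≠ 0 := by exact_mod_cast hdn.ne'
        have e : (s * (Complex.I * (d / ‖d‖)) - m) / d = ((s / ‖d‖ : ℝ) : ℂ) * Complex.I - m / d := by
          push_cast
          field_simp
        have e2 : s * s = 1 := by rw [← abs_mul_abs_self, hs, one_mul]
        simp only [mem_ofPred_eq, e, Complex.sub_im, Complex.im_ofReal_mul,
          Complex.I_im, mul_one]
        have e3 : s * (s / ‖d‖ - (m / d).im) = 1 / ‖d‖ - s * (m / d).im := by
          rw [mul_sub, ← mul_div_assoc, e2]
        rw [e3]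
        rcases eq_or_eq_neg_of_abs_eq hs with rfl | rfl <;> linarith [hmd.1, hmd.2]
      · have : (‖d‖ : ℝ) ≠ 0 := hdn.ne'
        simp [this, hs]
  obtain ⟨t1, ht1, hc1⟩ := hside 1 (by simp)
  obtain ⟨t2, ht2, hc2⟩ := hside (-1) (by simp)
  have hfr : frontier D \ {f a} ⊆ (f '' segment ℝ a b)ᶜ := by
    rintro z ⟨hz, hza⟩ ⟨w, hw, rfl⟩
    rw [← insert_endpoints_openSegment] at hw
    rcases hw with rfl | rfl | hw
    · exact hza rfl
    · exact hza hf.symm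
    · rw [h.isOpen.frontier_eq] at hz
      exact hz.2 (h.mem (hopen hw))
  have ht12 : t2 ∈ connectedComponentIn (f '' segment ℝ a b)ᶜ t1 :=
    hpre.subset_connectedComponentIn ht1 hfr ht2
  have hevb : ∀ᶠ ε : ℝ in 𝓝 0, m + Complex.I * ε * d ∈ ball (0 : ℂ) 1 ∧
      m - Complex.I * ε * d ∈ ball (0 : ℂ) 1 := by
    have c1 : Tendsto (fun ε : ℝ => m + Complex.I * ε * d) (𝓝 0) (𝓝 m) :=
      Continuous.tendsto' (by fun_prop) _ _ (by simp)
    have c2 : Tendsto (fun ε : ℝ => m - Complex.I * ε * d) (𝓝 0) (𝓝 m) :=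
      Continuous.tendsto' (by fun_prop) _ _ (by simp)
    exact (c1.eventually (isOpen_ball.mem_nhds hmb)).and (c2.eventually (isOpen_ball.mem_nhds hmb))
  have hsm : ∀ᶠ ε : ℝ in 𝓝 0, ε ≤ 1 / 2 := eventually_le_nhds (by norm_num)
  obtain ⟨ε, ⟨hA, ⟨hb1, hb2⟩, hε2⟩, hε : 0 < ε⟩ :=
    ((((h.eventually_norm_sub_lt hmb d).and (hevb.and hsm)).filter_mono
      nhdsWithin_le_nhds).and (self_mem_nhdsWithin (s := Ioi (0 : ℝ)))).exists
  set w1 : ℂ := m + Complex.I * ε * d with hw1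
  set w2 : ℂ := m - Complex.I * ε * d with hw2
  have i1 : ((w1 - m) / d).im = ε := by
    have : (w1 - m) / d = Complex.I * ε := by rw [hw1]; field_simp; ring
    rw [this]; simp
  have i2 : ((w2 - m) / d).im = -ε := by
    have : (w2 - m) / d = -(Complex.I * ε) := by rw [hw2]; field_simp; ring
    rw [this]; simp
  have k1 := hc1 w1 ⟨by simpa [i1] using hε, hb1⟩
  have k2 := hc2 w2 ⟨by simpa [i2] using hε, hb2⟩
  rw [← connectedComponentIn_eq ht12, connectedComponentIn_eq k1] at k2
  have hcl : IsClosed (f '' segment ℝ a b) := by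
    refine IsCompact.isClosed (IsCompact.image_of_continuousOn ?_ (h.continuousOn.mono
      ((convex_closedBall (0 : ℂ) 1).segment_subset (sphere_subset_closedBall ha)
        (sphere_subset_closedBall hb))))
    rw [segment_eq_image]
    exact isCompact_Icc.image (by fun_prop)
  obtain ⟨L, hL, hLe⟩ := hasLogOn_div_of_mem_connectedComponentIn hcl k2
  have hn2 : f w2 ∉ f '' segment ℝ a b := by
    rw [← connectedComponentIn_eq k1] at k2
    exact connectedComponentIn_subset _ _ k2
  refine log_jump_false hε hε2 (ℓ := fun x => L (f (m + d * x))) ?_ ?_ ?_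
  · refine hL.comp (h.continuousOn.comp (by fun_prop) fun x hx => ?_) fun x hx =>
      mem_image_of_mem f (hseg x hx)
    exact (convex_closedBall (0 : ℂ) 1).segment_subset (sphere_subset_closedBall ha)
        (sphere_subset_closedBall hb) (hseg x hx)
  · have e1 : m + d * ((-1 : ℝ) : ℂ) = a := by simp [hm, hd]; ring
    have e2 : m + d * ((1 : ℝ) : ℂ) = b := by simp [hm, hd]; ring
    simp only [e1, e2, hf]
  · intro x hx
    set w := m + d * x with hw
    have hws := hseg x hx
    have e1 : w - w1 = d * (x - ε * Complex.I) := by rw [hw, hw1]; ring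
    have e2 : w - w2 = d * (x + ε * Complex.I) := by rw [hw, hw2]; ring
    have hwi := hseg0 w hws
    have hne1 : w ≠ w1 := fun he => by rw [he, i1] at hwi; exact hε.ne' hwi
    have hne2 : w ≠ w2 := fun he => by rw [he, i2] at hwi; linarith
    have key := hA w ((convex_closedBall (0 : ℂ) 1).segment_subset (sphere_subset_closedBall ha)
        (sphere_subset_closedBall hb) hws) hne1 hne2
    have hfw : f w - f w2 ≠ 0 := sub_ne_zero.2 fun he => hn2 (he ▸ mem_image_of_mem f hws)
    rw [e1, e2] at key
    have hq := hLe (f w) (mem_image_of_mem f hws)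
    rw [hq]
    have hpos : 0 < ‖(f w - f w2) * d‖ := norm_pos_iff.2 (mul_ne_zero hfw hd0)
    refine lt_of_mul_lt_mul_left ?_ hpos.le
    rw [← norm_mul, ← norm_mul]
    have e3 : (f w - f w2) * d * ((f w - f w1) / (f w - f w2) * (x + ε * Complex.I) -
        (x - ε * Complex.I)) = (f w - f w1) * (d * (x + ε * Complex.I)) -
        (f w - f w2) * (d * (x - ε * Complex.I)) := by
      field_simp
    rw [e3, mul_assoc]
    exact key

lemma not_isClosed_separation {Ω K₁ K₂ : Set ℂ} (ho : IsOpen Ω) (hsc : IsSimplyConnected Ω)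
    (hb : Bornology.IsBounded Ω) (h₁ : IsClosed K₁) (h₂ : IsClosed K₂) (hd : Disjoint K₁ K₂)
    (hU : K₁ ∪ K₂ = Ωᶜ) (hK₁ : Bornology.IsBounded K₁) (hne : K₁.Nonempty) : False := by
  classical
  obtain ⟨a, ha⟩ := hne
  have haΩ : a ∉ Ω := (hU ▸ Or.inl ha : a ∈ Ωᶜ)
  obtain ⟨l, hl, hle⟩ := Complex.exists_continuousOn_eqOn_exp_comp hsc ho (g := fun z => z - a)
    (by fun_prop) (by rintro ⟨z, hz, h0⟩; exact haΩ (sub_eq_zero.1 h0 ▸ hz))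
  obtain ⟨ψ, hψ₁, hψ₂, -⟩ := exists_continuous_zero_one_of_isClosed h₁ h₂ hd
  set χ : ℂ → ℝ := fun z => max 0 (min 1 (3 * ψ z - 1)) with hχ
  have hχc : Continuous χ := by fun_prop
  set F : ℂ → ℂ := fun z => if ψ z < 1 / 3 then 1 else if 2 / 3 < ψ z then z - a else
    Complex.exp (χ z * l z) with hF
  have hFΩ : ∀ z ∈ Ω, F z = Complex.exp (χ z * l z) := by
    intro z hz
    simp only [hF]
    split_ifs with c1 c2
    · have : χ z = 0 := by
        simp only [hχ]
        rw [max_eq_left]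
        exact (min_le_right _ _).trans (by linarith)
      simp [this]
    · have : χ z = 1 := by
        simp only [hχ]
        rw [min_eq_left (by linarith), max_eq_right zero_le_one]
      simpa [this] using (hle hz).symm
    · rfl
  have hF0 : ∀ z, F z ≠ 0 := by
    intro z
    simp only [hF]
    split_ifs with c1 c2
    · exact one_ne_zero
    · refine sub_ne_zero.2 ?_
      rintro rfl
      rw [hψ₁ ha] at c2
      norm_num at c2
    · exact Complex.exp_ne_zero _
  have hFc : Continuous F := by
    rw [continuous_iff_continuousAt]
    intro z
    by_cases hz : z ∈ Ω
    · have hlz : ContinuousAt l z := hl.continuousAt (ho.mem_nhds hz)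
      refine ContinuousAt.congr (f := fun z => Complex.exp (χ z * l z)) ?_ ?_
      · have : ContinuousAt (fun z => (χ z : ℂ)) z := by fun_prop
        exact (this.mul hlz).cexp
      · filter_upwards [ho.mem_nhds hz] with w hw using (hFΩ w hw).symm
    · have hz' : z ∈ K₁ ∪ K₂ := hU ▸ hz
      rcases hz' with hz' | hz'
      · refine ContinuousAt.congr (f := fun _ => (1 : ℂ)) continuousAt_const ?_
        have : ψ z < 1 / 3 := by rw [hψ₁ hz']; norm_num
        filter_upwards [ψ.continuous.continuousAt.eventually (Iio_mem_nhds this)] with w hw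
        simp only [hF]
        rw [if_pos hw]
      · refine ContinuousAt.congr (f := fun w => w - a) (by fun_prop) ?_
        have : 2 / 3 < ψ z := by rw [hψ₂ hz']; norm_num
        filter_upwards [ψ.continuous.continuousAt.eventually (Ioi_mem_nhds this)] with w hw
        have hw' : 2 / 3 < ψ w := hw
        simp only [hF]
        rw [if_neg (by linarith), if_pos hw']
  obtain ⟨R, hR⟩ := (hb.union hK₁).subset_ball 0
  refine not_eq_sub_outside hFc hF0 a R fun z hz => ?_
  have hzn : z ∉ Ω ∪ K₁ := fun h => by
    have := hR h
    rw [mem_ball_zero_iff] at this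
    linarith
  have hz2 : z ∈ K₂ := by
    have : z ∈ K₁ ∪ K₂ := hU ▸ fun h => hzn (Or.inl h)
    exact this.resolve_left fun h => hzn (Or.inr h)
  have : 2 / 3 < ψ z := by rw [hψ₂ hz2]; norm_num
  simp only [hF]
  rw [if_neg (by linarith), if_pos this]

lemma isPreconnected_frontier_of_isSimplyConnected {Ω : Set ℂ} (ho : IsOpen Ω)
    (hsc : IsSimplyConnected Ω) (hb : Bornology.IsBounded Ω) : IsPreconnected (frontier Ω) := by
  classical
  rw [isPreconnected_closed_iff]
  intro t t' ht ht' hsub hne hne'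
  by_contra hcon
  have hΩc : IsPreconnected (closure Ω) := by
    refine IsPreconnected.closure ?_
    have := hsc.simplyConnectedSpace
    exact isPreconnected_iff_preconnectedSpace.2 inferInstance
  obtain ⟨φ, hφ₁, hφ₂, -⟩ := exists_continuous_zero_one_of_isClosed
    (isClosed_frontier (s := Ω).inter ht) (isClosed_frontier (s := Ω).inter ht') (by
      rw [Set.disjoint_left]
      exact fun z h1 h2 => hcon ⟨z, h1.1, h1.2, h2.2⟩)
  set p : ℂ := 2 * Real.pi * Complex.I with hp
  have hp0 : p ≠ 0 := Complex.two_pi_I_ne_zero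
  set u : ℂ → ℂ := fun z => if z ∈ Ω then Complex.exp (p * φ z) else 1 with hu
  have huc : Continuous u := by
    refine Continuous.if ?_ (by fun_prop) continuous_const
    intro z hz
    have hz' : z ∈ frontier Ω := hz
    rcases hsub hz' with h | h
    · rw [hφ₁ ⟨hz', h⟩]; simp
    · rw [hφ₂ ⟨hz', h⟩]; simp [hp, Complex.exp_two_pi_mul_I]
  obtain ⟨L, hL, hLe⟩ := hasLogOn_univ huc fun z => by
    simp only [hu]; split_ifs
    exacts [Complex.exp_ne_zero _, one_ne_zero]
  rw [continuousOn_univ] at hL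
  have hue : ∀ z ∈ closure Ω, u z = Complex.exp (p * φ z) := by
    intro z hz
    by_cases hzΩ : z ∈ Ω
    · simp [hu, hzΩ]
    · have hz' : z ∈ frontier Ω := by rw [ho.frontier_eq]; exact ⟨hz, hzΩ⟩
      simp only [hu, hzΩ, if_false]
      rcases hsub hz' with h | h
      · rw [hφ₁ ⟨hz', h⟩]; simp
      · rw [hφ₂ ⟨hz', h⟩]; simp [hp, Complex.exp_two_pi_mul_I]
  obtain ⟨x, hx, hxt⟩ := hne
  obtain ⟨y, hy, hyt⟩ := hne'
  have hxy : L y = L x + p := by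
    have := sub_eq_sub_of_exp_eq_exp hΩc hL.continuousOn (g₂ := fun z => p * φ z) (by fun_prop)
      (fun z hz => (hLe z (mem_univ _)).trans (hue z hz)) (frontier_subset_closure hx)
      (frontier_subset_closure hy)
    rw [hφ₁ ⟨hx, hxt⟩, hφ₂ ⟨hy, hyt⟩] at this
    simp at this
    rw [this]; ring
  have hsp : ∀ z ∉ Ω, ∀ w ∉ Ω, ∃ n : ℤ, L z = L w + n * p := by
    intro z hz w hw
    rw [hp]
    refine Complex.exp_eq_exp_iff_exists_int.1 ?_
    rw [hLe z (mem_univ _), hLe w (mem_univ _)]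
    simp [hu, hz, hw]
  have hpn : 0 < ‖p‖ := norm_pos_iff.2 hp0
  have hfx : x ∉ Ω := by rw [ho.frontier_eq] at hx; exact hx.2
  have hfy : y ∉ Ω := by rw [ho.frontier_eq] at hy; exact hy.2
  have hchar : ∀ z ∉ Ω, L z ≠ L x → ‖p‖ ≤ ‖L z - L x‖ := by
    intro z hz hne
    obtain ⟨n, hn⟩ := hsp z hz x hfx
    have hn0 : n ≠ 0 := by rintro rfl; simp at hn; exact hne hn
    rw [hn, add_sub_cancel_left, norm_mul (n : ℂ) p]
    refine le_mul_of_one_le_left hpn.le ?_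
    rw [Complex.norm_intCast]
    exact_mod_cast Int.one_le_abs hn0
  set K₁ : Set ℂ := Ωᶜ ∩ {z | L z = L x}
  set K₂ : Set ℂ := Ωᶜ ∩ {z | ‖p‖ ≤ ‖L z - L x‖}
  have hc1 : IsClosed K₁ := ho.isClosed_compl.inter (isClosed_eq hL continuous_const)
  have hc2 : IsClosed K₂ := ho.isClosed_compl.inter (isClosed_le (by fun_prop) (by fun_prop))
  have hdis : Disjoint K₁ K₂ := by
    rw [Set.disjoint_left]
    rintro z ⟨_, h1⟩ ⟨_, h2⟩
    simp only [mem_ofPred_eq] at h1 h2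
    rw [h1, sub_self, norm_zero] at h2
    linarith
  have hun : K₁ ∪ K₂ = Ωᶜ := by
    ext z
    constructor
    · rintro (h | h)
      exacts [h.1, h.1]
    · intro hz
      by_cases h : L z = L x
      exacts [Or.inl ⟨hz, h⟩, Or.inr ⟨hz, hchar z hz h⟩]
  obtain ⟨R, hR0, hR⟩ := hb.subset_closedBall_lt 0 0
  have hout : (closedBall (0 : ℂ) R)ᶜ ⊆ K₁ ∨ (closedBall (0 : ℂ) R)ᶜ ⊆ K₂ := by
    have hpre := isPreconnected_compl_closedBall 0 hR0
    by_contra! hboth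
    obtain ⟨⟨z, hz, hz1⟩, ⟨w, hw, hw2⟩⟩ := And.imp not_subset.1 not_subset.1 hboth
    have hcov : (closedBall (0 : ℂ) R)ᶜ ⊆ K₁ ∪ K₂ := hun ▸ compl_subset_compl.2 hR
    obtain ⟨v, -, hv1, hv2⟩ := isPreconnected_closed_iff.1 hpre K₁ K₂ hc1 hc2 hcov
      ⟨w, hw, (hcov hw).resolve_right hw2⟩ ⟨z, hz, (hcov hz).resolve_left hz1⟩
    exact hdis.ne_of_mem hv1 hv2 rfl
  have hbd : ∀ {A B : Set ℂ}, Disjoint A B → (closedBall (0 : ℂ) R)ᶜ ⊆ B →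
      Bornology.IsBounded A := fun {A B} hAB hB => isBounded_closedBall.subset fun z hz => by
    by_contra hzn
    exact hAB.ne_of_mem hz (hB hzn) rfl
  rcases hout with h | h
  · refine not_isClosed_separation ho hsc hb hc2 hc1 hdis.symm (by rw [union_comm, hun])
      (hbd hdis.symm h) ⟨y, hfy, ?_⟩
    simp [hxy]
  · exact not_isClosed_separation ho hsc hb hc1 hc2 hdis hun (hbd hdis h) ⟨x, hfx, rfl⟩

/-- A finite graph in the plane with vertex set `V`, edge set `E` and edges parametrised by `c`. -/
structure IsArcGraph (γ V : Set ℂ) (E : Set (Set ℂ)) (c : Set ℂ → ℝ → ℂ) : Prop where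
  vertex_finite : V.Finite
  edges_finite : E.Finite
  vertex_subset : V ⊆ γ
  diff_eq : γ \ V = ⋃₀ E
  pairwiseDisjoint : E.PairwiseDisjoint id
  continuousOn : ∀ e ∈ E, ContinuousOn (c e) (Icc 0 1)
  injOn : ∀ e ∈ E, InjOn (c e) (Ioo 0 1)
  image_eq : ∀ e ∈ E, c e '' Ioo 0 1 = e
  left_mem : ∀ e ∈ E, c e 0 ∈ V
  right_mem : ∀ e ∈ E, c e 1 ∈ V

lemma image_Icc_eq_insert (c : ℝ → ℂ) : c '' Icc 0 1 = c '' Ioo 0 1 ∪ {c 0, c 1} := by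
  rw [← Ioo_union_both zero_le_one, image_union, image_pair]

namespace IsArcGraph

variable {γ V : Set ℂ} {E : Set (Set ℂ)} {c : Set ℂ → ℝ → ℂ}

lemma image_Icc (h : IsArcGraph γ V E c) {e : Set ℂ} (he : e ∈ E) :
    c e '' Icc 0 1 = e ∪ {c e 0, c e 1} := by
  rw [image_Icc_eq_insert, h.image_eq e he]

lemma edge_subset (h : IsArcGraph γ V E c) {e : Set ℂ} (he : e ∈ E) : e ⊆ γ \ V :=
  h.diff_eq ▸ subset_sUnion_of_mem he

lemma image_Icc_subset (h : IsArcGraph γ V E c) {e : Set ℂ} (he : e ∈ E) :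
    c e '' Icc 0 1 ⊆ e ∪ V := by
  rw [h.image_Icc he]
  refine union_subset_union_right _ ?_
  rintro _ (rfl | rfl)
  exacts [h.left_mem e he, h.right_mem e he]

lemma diff_edge_eq (h : IsArcGraph γ V E c) {e : Set ℂ} (he : e ∈ E) :
    γ \ e = V ∪ ⋃ d ∈ E \ {e}, c d '' Icc 0 1 := by
  ext z
  constructor
  · rintro ⟨hz, hze⟩
    by_cases hzV : z ∈ V
    · exact Or.inl hzV
    · have : z ∈ ⋃₀ E := h.diff_eq ▸ ⟨hz, hzV⟩
      obtain ⟨e', he', hz'⟩ := this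
      refine Or.inr (mem_iUnion₂.2 ⟨e', ⟨he', ?_⟩, ?_⟩)
      · rintro rfl; exact hze hz'
      · rw [h.image_Icc he']; exact Or.inl hz'
  · rintro (hz | hz)
    · exact ⟨h.vertex_subset hz, fun hze => (h.edge_subset he hze).2 hz⟩
    · obtain ⟨e', ⟨he', hne⟩, hz'⟩ := mem_iUnion₂.1 hz
      rcases h.image_Icc_subset he' hz' with hz' | hz'
      · exact ⟨(h.edge_subset he' hz').1, fun hze =>
          (h.pairwiseDisjoint he' he hne).ne_of_mem hz' hze rfl⟩
      · exact ⟨h.vertex_subset hz', fun hze => (h.edge_subset he hze).2 hz'⟩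

lemma eq_union (h : IsArcGraph γ V E c) : γ = V ∪ ⋃ e ∈ E, c e '' Icc 0 1 := by
  ext z
  constructor
  · intro hz
    by_cases hzV : z ∈ V
    · exact Or.inl hzV
    · have : z ∈ ⋃₀ E := h.diff_eq ▸ ⟨hz, hzV⟩
      obtain ⟨e', he', hz'⟩ := this
      refine Or.inr (mem_iUnion₂.2 ⟨e', he', ?_⟩)
      rw [h.image_Icc he']; exact Or.inl hz'
  · rintro (hz | hz)
    · exact h.vertex_subset hz
    · obtain ⟨e', he', hz'⟩ := mem_iUnion₂.1 hz
      rcases h.image_Icc_subset he' hz' with hz' | hz'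
      exacts [(h.edge_subset he' hz').1, h.vertex_subset hz']

lemma isClosed_diff_edge (h : IsArcGraph γ V E c) {e : Set ℂ} (he : e ∈ E) :
    IsClosed (γ \ e) := by
  rw [h.diff_edge_eq he]
  refine h.vertex_finite.isClosed.union ((h.edges_finite.subset sdiff_subset).isClosed_biUnion
    fun e' he' => (isCompact_Icc.image_of_continuousOn (h.continuousOn e' he'.1)).isClosed)

lemma isCompact (h : IsArcGraph γ V E c) : IsCompact γ := by
  rw [h.eq_union]
  exact h.vertex_finite.isCompact.union (h.edges_finite.isCompact_biUnion
    fun e' he' => isCompact_Icc.image_of_continuousOn (h.continuousOn e' he'))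

end IsArcGraph

/-- A finite union of continua of small diameter is uniformly locally connected. -/
lemma isUniformlyLocallyConnected_of_forall_exists_cover {K : Set ℂ}
    (h : ∀ ε > 0, ∃ S : Set (Set ℂ), S.Finite ∧ K = ⋃₀ S ∧
      ∀ κ ∈ S, IsCompact κ ∧ IsPreconnected κ ∧ ∀ x ∈ κ, ∀ y ∈ κ, dist x y ≤ ε) :
    IsUniformlyLocallyConnected K := by
  intro ε hε
  obtain ⟨S, hSf, rfl, hS⟩ := h (ε / 2) (half_pos hε)
  have hpair : ∀ κ ∈ S, ∀ κ' ∈ S, ∃ η > 0, (∀ x ∈ κ, ∀ y ∈ κ', dist x y ≤ η →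
      (κ ∩ κ').Nonempty) := by
    intro κ hκ κ' hκ'
    by_cases hne : (κ ∩ κ').Nonempty
    · exact ⟨1, one_pos, fun _ _ _ _ _ => hne⟩
    · have hd : Disjoint κ κ' := by rwa [Set.not_nonempty_iff_eq_empty, ← disjoint_iff_inter_eq_empty] at hne
      obtain ⟨r, hr, hrd⟩ := (hd.exists_thickenings (hS κ hκ).1 (hS κ' hκ').1.isClosed)
      refine ⟨r / 2, half_pos hr, fun x hx y hy hxy => ?_⟩
      exact absurd rfl (hrd.ne_of_mem (mem_thickening_iff.2 ⟨x, hx, by rw [dist_comm]; linarith⟩ : y ∈ _)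
        (self_subset_thickening hr _ hy))
  choose! η hη0 hη using hpair
  obtain ⟨η₀, hη₀, hle⟩ : ∃ η₀ > 0, ∀ κ ∈ S, ∀ κ' ∈ S, η₀ ≤ η κ κ' := by
    have hfin : ((fun p : Set ℂ × Set ℂ => η p.1 p.2) '' (S ×ˢ S)).Finite := (hSf.prod hSf).image _
    obtain ⟨m, hm⟩ : ∃ m > 0, ∀ x ∈ (fun p : Set ℂ × Set ℂ => η p.1 p.2) '' (S ×ˢ S), m ≤ x := by
      rcases ((fun p : Set ℂ × Set ℂ => η p.1 p.2) '' (S ×ˢ S)).eq_empty_or_nonempty with h0 | h0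
      · exact ⟨1, one_pos, by simp [h0]⟩
      · obtain ⟨x, hx, hmin⟩ := hfin.exists_minimalFor id _ h0
        obtain ⟨p, hp, rfl⟩ := hx
        refine ⟨η p.1 p.2, hη0 _ hp.1 _ hp.2, fun y hy => ?_⟩
        rcases le_total (η p.1 p.2) y with h | h
        exacts [h, hmin hy h]
    exact ⟨m, hm.1, fun κ hκ κ' hκ' => hm.2 _ ⟨(κ, κ'), ⟨hκ, hκ'⟩, rfl⟩⟩
  refine ⟨η₀, hη₀, fun p hp => ?_⟩
  obtain ⟨κ₀, hκ₀, hp₀⟩ := hp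
  set W : Set (Set ℂ) := {κ ∈ S | (κ₀ ∩ κ).Nonempty}
  have hWS : W ⊆ S := fun κ hκ => hκ.1
  refine ⟨⋃₀ W, sUnion_mono hWS, ?_, ?_, ?_, ?_⟩
  · exact (hSf.subset hWS).isCompact_sUnion fun κ hκ => (hS κ hκ.1).1
  · have : ⋃₀ W = ⋃₀ ((fun κ => κ₀ ∪ κ) '' W) := by
      ext z
      constructor
      · rintro ⟨κ, hκ, hz⟩
        exact ⟨κ₀ ∪ κ, ⟨κ, hκ, rfl⟩, Or.inr hz⟩
      · rintro ⟨_, ⟨κ, hκ, rfl⟩, hz | hz⟩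
        exacts [⟨κ₀, ⟨hκ₀, by simpa using ⟨p, hp₀⟩⟩, hz⟩, ⟨κ, hκ, hz⟩]
    rw [this]
    refine isPreconnected_sUnion p _ ?_ ?_
    · rintro _ ⟨κ, hκ, rfl⟩
      exact Or.inl hp₀
    · rintro _ ⟨κ, hκ, rfl⟩
      exact (hS κ₀ hκ₀).2.1.union' hκ.2 (hS κ hκ.1).2.1
  · rintro z ⟨⟨κ, hκ, hz⟩, hzp⟩
    rw [mem_closedBall, dist_comm] at hzp
    exact ⟨κ, ⟨hκ, hη κ₀ hκ₀ κ hκ p hp₀ z hz (hzp.trans (hle _ hκ₀ _ hκ))⟩, hz⟩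
  · rintro z ⟨κ, ⟨hκ, y, hy₀, hy⟩, hz⟩
    rw [mem_closedBall]
    have h1 := (hS κ hκ).2.2 z hz y hy
    have h2 := (hS κ₀ hκ₀).2.2 y hy₀ p hp₀
    linarith [dist_triangle z y p]

lemma IsArcGraph.isUniformlyLocallyConnected {γ V : Set ℂ} {E : Set (Set ℂ)}
    {c : Set ℂ → ℝ → ℂ} (h : IsArcGraph γ V E c) : IsUniformlyLocallyConnected γ := by
  refine isUniformlyLocallyConnected_of_forall_exists_cover fun ε hε => ?_
  have hcov : ∀ e ∈ E, ∃ S : Set (Set ℂ), S.Finite ∧ c e '' Icc 0 1 = ⋃₀ S ∧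
      ∀ κ ∈ S, IsCompact κ ∧ IsPreconnected κ ∧ ∀ x ∈ κ, ∀ y ∈ κ, dist x y ≤ ε := by
    intro e he
    have huc := isCompact_Icc.uniformContinuousOn_of_continuous (h.continuousOn e he)
    rw [Metric.uniformContinuousOn_iff] at huc
    obtain ⟨δ, hδ, hdel⟩ := huc ε hε
    obtain ⟨T, -, hTf, hT⟩ := (isCompact_Icc (a := (0 : ℝ)) (b := 1)).finite_cover_balls
      (show 0 < δ / 4 by positivity)
    refine ⟨(fun t => c e '' (Icc 0 1 ∩ closedBall t (δ / 4))) '' T, hTf.image _, ?_, ?_⟩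
    · ext z
      constructor
      · rintro ⟨t, ht, rfl⟩
        obtain ⟨s, hs, hts⟩ := mem_iUnion₂.1 (hT ht)
        exact ⟨_, ⟨s, hs, rfl⟩, t, ⟨ht, ball_subset_closedBall hts⟩, rfl⟩
      · rintro ⟨_, ⟨s, hs, rfl⟩, t, ht, rfl⟩
        exact ⟨t, ht.1, rfl⟩
    · rintro _ ⟨s, hs, rfl⟩
      refine ⟨(isCompact_Icc.inter_right isClosed_closedBall).image_of_continuousOn
        ((h.continuousOn e he).mono inter_subset_left), ?_, ?_⟩
      · refine IsPreconnected.image ?_ _ ((h.continuousOn e he).mono inter_subset_left)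
        exact ((convex_Icc _ _).inter (convex_closedBall _ _)).isPreconnected
      · rintro _ ⟨x, hx, rfl⟩ _ ⟨y, hy, rfl⟩
        refine (hdel x hx.1 y hy.1 ?_).le
        have h1 := hx.2
        have h2 := hy.2
        rw [mem_closedBall] at h1 h2
        linarith [dist_triangle_right x y s]
  choose! S hSf hSe hS using hcov
  refine ⟨(fun v => {v}) '' V ∪ ⋃ e ∈ E, S e, (h.vertex_finite.image _).union
    (h.edges_finite.biUnion hSf), ?_, ?_⟩
  · rw [sUnion_union, sUnion_image, biUnion_of_singleton]
    conv_lhs => rw [h.eq_union]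
    congr 1
    ext z
    simp only [mem_iUnion, mem_sUnion, exists_prop]
    constructor
    · rintro ⟨e, he, hz⟩
      rw [hSe e he] at hz
      obtain ⟨κ, hκ, hz⟩ := hz
      exact ⟨κ, ⟨e, he, hκ⟩, hz⟩
    · rintro ⟨κ, ⟨e, he, hκ⟩, hz⟩
      refine ⟨e, he, ?_⟩
      rw [hSe e he]
      exact ⟨κ, hκ, hz⟩
  · rintro κ (⟨v, hv, rfl⟩ | hκ)
    · refine ⟨isCompact_singleton, isPreconnected_singleton, ?_⟩
      rintro x rfl y rfl
      simpa using hε.le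
    · obtain ⟨e, he, hκ⟩ := mem_iUnion₂.1 hκ
      exact hS e he κ hκ
lemma continuousOn_image_of_comp {X Y Z : Type*} [TopologicalSpace X] [TopologicalSpace Y]
    [T2Space Y] [TopologicalSpace Z] {K : Set X} (hK : IsCompact K) {c : X → Y}
    (hc : ContinuousOn c K) {g : Y → Z} (hg : ContinuousOn (fun x => g (c x)) K) :
    ContinuousOn g (c '' K) := by
  rw [continuousOn_iff_isClosed]
  intro t ht
  obtain ⟨u, hu, hut⟩ := continuousOn_iff_isClosed.1 hg t ht
  refine ⟨c '' (u ∩ K), ?_, ?_⟩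
  · exact ((hK.inter_left hu).image_of_continuousOn (hc.mono inter_subset_right)).isClosed
  · ext y
    constructor
    · rintro ⟨hy, x, hx, rfl⟩
      have : x ∈ u ∩ K := hut ▸ ⟨hy, hx⟩
      exact ⟨⟨x, this, rfl⟩, x, hx, rfl⟩
    · rintro ⟨⟨x, hx, rfl⟩, hy⟩
      rw [← hut] at hx
      exact ⟨hx.1, hy⟩

lemma injOn_exp_two_pi_mul_I :
    InjOn (fun t : ℝ => Complex.exp ((2 * Real.pi * t : ℝ) * Complex.I)) (Ico 0 1) := by
  intro x hx y hy hxy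
  simp only at hxy
  obtain ⟨n, hn⟩ := Complex.exp_eq_exp_iff_exists_int.1 hxy
  have h1 : 2 * Real.pi * x = 2 * Real.pi * y + n * (2 * Real.pi) := by
    have := congrArg Complex.im hn
    simpa using this
  have h2 : x = y + n := by
    have : 2 * Real.pi ≠ 0 := by positivity
    apply mul_left_cancel₀ this
    rw [h1]; ring
  have h3 : (n : ℝ) < 1 := by linarith [hx.2, hy.1]
  have h4 : (-1 : ℝ) < n := by linarith [hx.1, hy.2]
  have h5 : n < 1 := by exact_mod_cast h3
  have h6 : -1 < n := by exact_mod_cast h4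
  have : n = 0 := by omega
  simpa [this] using h2

lemma exists_exp_two_pi_mul_I_eq {u : ℂ} (hu : ‖u‖ = 1) :
    ∃ t ∈ Ico (0 : ℝ) 1, Complex.exp ((2 * Real.pi * t : ℝ) * Complex.I) = u := by
  have h2π : (0 : ℝ) < 2 * Real.pi := by positivity
  set θ := toIcoMod h2π 0 (Complex.arg u) with hθ
  have hθm : θ ∈ Ico 0 (0 + 2 * Real.pi) := toIcoMod_mem_Ico h2π 0 _
  rw [zero_add] at hθm
  refine ⟨θ / (2 * Real.pi), ⟨by have := hθm.1; positivity, (div_lt_one h2π).2 hθm.2⟩, ?_⟩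
  have e1 : (2 * Real.pi * (θ / (2 * Real.pi)) : ℝ) = θ := by field_simp
  rw [e1, hθ, toIcoMod, zsmul_eq_mul]
  push_cast
  rw [sub_mul, Complex.exp_sub]
  have e2 : Complex.exp (((toIcoDiv h2π 0 u.arg : ℤ) : ℂ) * (2 * Real.pi) * Complex.I) = 1 := by
    rw [mul_assoc]
    exact Complex.exp_int_mul_two_pi_mul_I _
  rw [e2, div_one]
  have := Complex.norm_mul_exp_arg_mul_I u
  rwa [hu, Complex.ofReal_one, one_mul] at this

lemma IsArcGraph.exists_circle_map {γ V : Set ℂ} {E : Set (Set ℂ)} {c : Set ℂ → ℝ → ℂ}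
    (h : IsArcGraph γ V E c) {e : Set ℂ} (he : e ∈ E) :
    ∃ π : ℂ → ℂ, ContinuousOn π γ ∧ (∀ z ∈ γ, ‖π z‖ = 1) ∧ (∀ z ∈ γ \ e, π z = 1) ∧
      (∀ z ∈ e, π z ≠ 1) ∧ InjOn π e ∧ ∀ u : ℂ, ‖u‖ = 1 → u ≠ 1 → ∃ z ∈ e, π z = u := by
  classical
  set q : ℝ → ℂ := fun t => Complex.exp ((2 * Real.pi * t : ℝ) * Complex.I) with hq
  set s : ℂ → ℝ := Function.invFunOn (c e) (Ioo 0 1) with hs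
  have hsc : ∀ t ∈ Ioo (0 : ℝ) 1, s (c e t) = t := (h.injOn e he).leftInvOn_invFunOn
  have hcs : ∀ z ∈ e, s z ∈ Ioo (0 : ℝ) 1 ∧ c e (s z) = z := by
    intro z hz
    rw [← h.image_eq e he] at hz
    exact ⟨Function.invFunOn_mem hz, Function.invFunOn_eq hz⟩
  have hqn : ∀ t, ‖q t‖ = 1 := fun t => Complex.norm_exp_ofReal_mul_I _
  have hqinj : InjOn q (Ico 0 1) := injOn_exp_two_pi_mul_I
  have hq0 : q 0 = 1 := by simp [hq]
  have hq1 : q 1 = 1 := by simp [hq]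
  set π : ℂ → ℂ := fun z => if z ∈ e then q (s z) else 1 with hπ
  have hπe : ∀ z ∈ e, π z = q (s z) := fun z hz => if_pos hz
  have hπn : ∀ z ∉ e, π z = 1 := fun z hz => if_neg hz
  have hVe : ∀ v ∈ V, v ∉ e := fun v hv hve => (h.edge_subset he hve).2 hv
  have hπc : ∀ t ∈ Icc (0 : ℝ) 1, π (c e t) = q t := by
    intro t ht
    by_cases h0 : t = 0
    · rw [h0, hq0, hπn _ (hVe _ (h.left_mem e he))]
    by_cases h1 : t = 1
    · rw [h1, hq1, hπn _ (hVe _ (h.right_mem e he))]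
    have ht' : t ∈ Ioo (0 : ℝ) 1 := ⟨lt_of_le_of_ne ht.1 (Ne.symm h0), lt_of_le_of_ne ht.2 h1⟩
    have : c e t ∈ e := (h.image_eq e he).subset (mem_image_of_mem _ ht')
    rw [hπe _ this, hsc t ht']
  have hγ : γ = (c e '' Icc 0 1) ∪ (γ \ e) := by
    ext z
    constructor
    · intro hz
      by_cases hze : z ∈ e
      · rw [h.image_Icc he]; exact Or.inl (Or.inl hze)
      · exact Or.inr ⟨hz, hze⟩
    · rintro (hz | hz)
      · rcases h.image_Icc_subset he hz with hz | hz
        exacts [(h.edge_subset he hz).1, h.vertex_subset hz]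
      · exact hz.1
  refine ⟨π, ?_, ?_, fun z hz => hπn z hz.2, ?_, ?_, ?_⟩
  · rw [hγ]
    refine ContinuousOn.union_of_isClosed ?_ ?_ ?_ (h.isClosed_diff_edge he)
    · refine continuousOn_image_of_comp isCompact_Icc (h.continuousOn e he) ?_
      refine ContinuousOn.congr (f := q) ?_ hπc
      exact Continuous.continuousOn (by fun_prop)
    · exact continuousOn_const.congr fun z hz => hπn z hz.2
    · exact (isCompact_Icc.image_of_continuousOn (h.continuousOn e he)).isClosed
  · intro z _
    by_cases hz : z ∈ e
    · rw [hπe z hz, hqn]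
    · rw [hπn z hz, norm_one]
  · intro z hz h1
    rw [hπe z hz, ← hq0] at h1
    obtain ⟨hz1, -⟩ := hcs z hz
    exact hz1.1.ne' (hqinj (Ioo_subset_Ico_self hz1) (by simp) h1)
  · intro x hx y hy hxy
    rw [hπe x hx, hπe y hy] at hxy
    have := hqinj (Ioo_subset_Ico_self (hcs x hx).1) (Ioo_subset_Ico_self (hcs y hy).1) hxy
    rw [← (hcs x hx).2, this, (hcs y hy).2]
  · intro u hu hu1
    obtain ⟨t, ht, htu⟩ := exists_exp_two_pi_mul_I_eq hu
    have ht0 : t ≠ 0 := by rintro rfl; exact hu1 (htu ▸ hq0)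
    have ht' : t ∈ Ioo (0 : ℝ) 1 := ⟨lt_of_le_of_ne ht.1 (Ne.symm ht0), ht.2⟩
    refine ⟨c e t, (h.image_eq e he).subset (mem_image_of_mem _ ht'), ?_⟩
    rw [hπc t (Ioo_subset_Icc_self ht')]
    exact htu

lemma exists_tendsto_nhdsGT_of_mapClusterPt {f : ℝ → ℂ} (hf : ContinuousOn f (Ioo 0 1))
    (hb : Bornology.IsBounded (f '' Ioo 0 1)) {V : Set ℂ} (hV : V.Finite)
    (hcl : ∀ x, MapClusterPt x (𝓝[>] 0) f → x ∈ V) : ∃ v ∈ V, Tendsto f (𝓝[>] 0) (𝓝 v) := by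
  have hev : ∀ᶠ t in 𝓝[>] (0 : ℝ), t ∈ Ioo (0 : ℝ) 1 := Ioo_mem_nhdsGT one_pos
  have hcomp : IsCompact (closure (f '' Ioo 0 1)) := hb.isCompact_closure
  obtain ⟨v, -, hv⟩ := hcomp (f := map f (𝓝[>] 0)) (by
    rw [le_principal_iff, mem_map]
    filter_upwards [hev] with t ht using subset_closure (mem_image_of_mem f ht))
  have hvV : v ∈ V := hcl v hv
  refine ⟨v, hvV, ?_⟩
  obtain ⟨r, hr, hrV⟩ : ∃ r > 0, closedBall v r ∩ V ⊆ {v} := by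
    have h1 : (V \ {v})ᶜ ∈ 𝓝 v :=
      (hV.subset sdiff_subset).isClosed.isOpen_compl.mem_nhds (by simp)
    obtain ⟨r, hr, hsub⟩ := Metric.nhds_basis_closedBall.mem_iff.1 h1
    exact ⟨r, hr, fun x hx => by_contra fun hne => hsub hx.1 ⟨hx.2, hne⟩⟩
  by_contra hnt
  rw [Metric.tendsto_nhds] at hnt
  push Not at hnt
  obtain ⟨ρ, hρ, hfreq⟩ := hnt
  set σ := min ρ r / 2 with hσ
  have hσ0 : 0 < σ := by positivity
  have hσρ : σ < ρ := by
    have := min_le_left ρ r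
    have : 0 < min ρ r := lt_min hρ hr
    linarith
  have hσr : σ ≤ r := by
    have := min_le_right ρ r
    have : 0 < min ρ r := lt_min hρ hr
    linarith
  have hfreq2 : ∃ᶠ t in 𝓝[>] (0 : ℝ), dist (f t) v < σ :=
    hv.frequently (ball_mem_nhds v hσ0)
  have hsph : ∃ᶠ t in 𝓝[>] (0 : ℝ), f t ∈ sphere v σ := by
    rw [Filter.frequently_iff]
    intro U hU
    obtain ⟨δ, hδ : 0 < δ, hδU⟩ := mem_nhdsGT_iff_exists_Ioo_subset.1 hU
    set δ' := min δ 1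
    have hδ' : 0 < δ' := lt_min hδ one_pos
    have hI : Ioo 0 δ' ∈ 𝓝[>] (0 : ℝ) := Ioo_mem_nhdsGT hδ'
    obtain ⟨a, ha, haI⟩ := (hfreq.and_eventually hI).exists
    obtain ⟨b, hb, hbI⟩ := (hfreq2.and_eventually hI).exists
    have hIs : Ioo 0 δ' ⊆ Ioo (0 : ℝ) 1 := Ioo_subset_Ioo_right (min_le_right _ _)
    have hc : ContinuousOn (fun t => dist (f t) v) (Ioo 0 δ') :=
      (continuous_id.dist continuous_const).comp_continuousOn (hf.mono hIs)
    obtain ⟨t, ht, hte⟩ := isPreconnected_Ioo.intermediate_value hbI haI hc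
      (⟨hb.le, hσρ.le.trans ha⟩ : σ ∈ Icc _ _)
    exact ⟨t, hδU (Ioo_subset_Ioo_right (min_le_left _ _) ht), hte⟩
  obtain ⟨x, hx, hxc⟩ := (isCompact_sphere v σ).exists_mapClusterPt_of_frequently hsph
  have := hrV ⟨sphere_subset_closedBall.trans (closedBall_subset_closedBall hσr) hx, hcl x hxc⟩
  rw [mem_singleton_iff] at this
  subst this
  simp at hx
  exact hσ0.ne hx
lemma exists_tendsto_nhdsGT_of_leftInverse {f : ℝ → ℂ} {e : Set ℂ} (hf : ContinuousOn f (Ioo 0 1))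
    (he : f '' Ioo 0 1 = e) {g : ℂ → ℝ} (hg : ContinuousOn g e)
    (hgf : ∀ t ∈ Ioo (0 : ℝ) 1, g (f t) = t) (hb : Bornology.IsBounded e) {V : Set ℂ}
    (hV : V.Finite) (hcl : closure e \ e ⊆ V) : ∃ v ∈ V, Tendsto f (𝓝[>] 0) (𝓝 v) := by
  refine exists_tendsto_nhdsGT_of_mapClusterPt hf (he ▸ hb) hV fun x hx => hcl ?_
  have hev : ∀ᶠ t in 𝓝[>] (0 : ℝ), t ∈ Ioo (0 : ℝ) 1 := Ioo_mem_nhdsGT one_pos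
  have hevf : ∀ᶠ t in 𝓝[>] (0 : ℝ), f t ∈ e := by
    filter_upwards [hev] with t ht using he ▸ mem_image_of_mem f ht
  refine ⟨?_, fun hxe => ?_⟩
  · rw [mem_closure_iff_frequently]
    rw [MapClusterPt, ClusterPt] at hx
    rw [Filter.frequently_iff]
    intro U hU
    obtain ⟨y, hyU, hye⟩ := (hx.nonempty_of_mem (inter_mem_inf hU (mem_map.2 hevf)))
    exact ⟨y, hyU, hye⟩
  · obtain ⟨s, hs, hsx⟩ := (he ▸ hxe : x ∈ f '' Ioo 0 1)
    have hgx : g x = s := hsx ▸ hgf s hs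
    have h1 : ∀ᶠ y in 𝓝[e] x, s / 2 < g y := by
      have : Tendsto g (𝓝[e] x) (𝓝 s) := hgx ▸ (hg x hxe).tendsto
      exact this.eventually (lt_mem_nhds (by linarith [hs.1]))
    rw [eventually_nhdsWithin_iff] at h1
    have h2 : ∀ᶠ t in 𝓝[>] (0 : ℝ), t < s / 2 :=
      nhdsWithin_le_nhds (gt_mem_nhds (half_pos hs.1))
    have h3 : ∃ᶠ t in 𝓝[>] (0 : ℝ), f t ∈ e → s / 2 < g (f t) := hx.frequently h1
    obtain ⟨t, ht, ht1, ht2, ht3⟩ := (h3.and_eventually (hevf.and (h2.and hev))).exists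
    have := ht ht1
    rw [hgf t ht3] at this
    linarith

lemma IsSimpleArc.exists_param {e V : Set ℂ} (he : IsSimpleArc e) (hb : Bornology.IsBounded e)
    (hV : V.Finite) (hcl : closure e \ e ⊆ V) : ∃ c : ℝ → ℂ, ContinuousOn c (Icc 0 1) ∧
      InjOn c (Ioo 0 1) ∧ c '' Ioo 0 1 = e ∧ c 0 ∈ V ∧ c 1 ∈ V := by
  classical
  obtain ⟨φ⟩ := he
  set f : ℝ → ℂ := fun t => if h : t ∈ Ioo (0 : ℝ) 1 then (φ.symm ⟨t, h⟩ : ℂ) else 0 with hfd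
  set g : ℂ → ℝ := fun z => if h : z ∈ e then (φ ⟨z, h⟩ : ℝ) else 0 with hgd
  have hfe : ∀ t (ht : t ∈ Ioo (0 : ℝ) 1), f t = φ.symm ⟨t, ht⟩ := fun t ht => dif_pos ht
  have hge : ∀ z (hz : z ∈ e), g z = φ ⟨z, hz⟩ := fun z hz => dif_pos hz
  have hfm : ∀ t ∈ Ioo (0 : ℝ) 1, f t ∈ e := fun t ht => by rw [hfe t ht]; exact Subtype.mem _
  have hgm : ∀ z ∈ e, g z ∈ Ioo (0 : ℝ) 1 := fun z hz => by rw [hge z hz]; exact Subtype.mem _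
  have hgf : ∀ t ∈ Ioo (0 : ℝ) 1, g (f t) = t := by
    intro t ht
    rw [hge _ (hfm t ht)]
    have : (⟨f t, hfm t ht⟩ : e) = φ.symm ⟨t, ht⟩ := Subtype.ext (hfe t ht)
    rw [this, Homeomorph.apply_symm_apply]
  have hfg : ∀ z ∈ e, f (g z) = z := by
    intro z hz
    rw [hfe _ (hgm z hz)]
    have : (⟨g z, hgm z hz⟩ : Ioo (0 : ℝ) 1) = φ ⟨z, hz⟩ := Subtype.ext (hge z hz)
    rw [this, Homeomorph.symm_apply_apply]
  have hfc : ContinuousOn f (Ioo 0 1) := by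
    rw [continuousOn_iff_continuous_domRestrict]
    have : (Ioo (0 : ℝ) 1).domRestrict f = fun t => (φ.symm t : ℂ) := by
      ext t
      exact hfe t.1 t.2
    rw [this]
    exact continuous_subtype_val.comp φ.symm.continuous
  have hgc : ContinuousOn g e := by
    rw [continuousOn_iff_continuous_domRestrict]
    have : e.domRestrict g = fun t => (φ t : ℝ) := by
      ext t
      exact hge t.1 t.2
    rw [this]
    exact continuous_subtype_val.comp φ.continuous
  have him : f '' Ioo 0 1 = e :=
    subset_antisymm (image_subset_iff.2 hfm) fun z hz => ⟨g z, hgm z hz, hfg z hz⟩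
  obtain ⟨v₀, hv₀, h0⟩ := exists_tendsto_nhdsGT_of_leftInverse hfc him hgc hgf hb hV hcl
  have hr : ∀ t ∈ Ioo (0 : ℝ) 1, 1 - t ∈ Ioo (0 : ℝ) 1 := fun t ht =>
    ⟨by linarith [ht.2], by linarith [ht.1]⟩
  obtain ⟨v₁, hv₁, h1⟩ := exists_tendsto_nhdsGT_of_leftInverse (f := fun t => f (1 - t)) (e := e)
    (g := fun z => 1 - g z) (hfc.comp (by fun_prop) hr)
    (subset_antisymm (image_subset_iff.2 fun t ht => hfm _ (hr t ht)) fun z hz =>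
      ⟨1 - g z, hr _ (hgm z hz), by simp [hfg z hz]⟩)
    (continuousOn_const.sub hgc) (fun t ht => by simp [hgf _ (hr t ht)]) hb hV hcl
  have h1' : Tendsto f (𝓝[<] 1) (𝓝 v₁) := by
    have : Tendsto (fun t : ℝ => 1 - t) (𝓝[<] 1) (𝓝[>] 0) := by
      refine tendsto_nhdsWithin_iff.2 ⟨?_, ?_⟩
      · exact (Continuous.tendsto' (by fun_prop) _ _ (by simp)).mono_left nhdsWithin_le_nhds
      · filter_upwards [self_mem_nhdsWithin] with t ht
        have : t < 1 := ht
        simpa using this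
    refine (h1.comp this).congr fun t => ?_
    simp
  have heq : ∀ t ∈ Ioo (0 : ℝ) 1, extendFrom (Ioo 0 1) f t = f t := fun t ht =>
    extendFrom_eq (subset_closure ht) (hfc t ht).tendsto
  refine ⟨extendFrom (Ioo 0 1) f, continuousOn_Icc_extendFrom_Ioo hfc h0 h1', ?_, ?_,
    ?_, ?_⟩
  · intro x hx y hy hxy
    rw [heq x hx, heq y hy] at hxy
    rw [← hgf x hx, hxy, hgf y hy]
  · rw [image_congr heq, him]
  · rwa [eq_lim_at_left_extendFrom_Ioo one_pos h0]
  · rwa [eq_lim_at_right_extendFrom_Ioo one_pos h1']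

lemma IsJordanCurve.exists_param {γ : Set ℂ} (hγ : IsJordanCurve γ) {v : ℂ} (hv : v ∈ γ) :
    ∃ c : ℝ → ℂ, Continuous c ∧ InjOn c (Ioo 0 1) ∧ c '' Ioo 0 1 = γ \ {v} ∧ c 0 = v ∧ c 1 = v := by
  obtain ⟨ψ⟩ := hγ
  set a : ℂ := (ψ ⟨v, hv⟩ : sphere (0 : ℂ) 1).1 with ha
  have han : ‖a‖ = 1 := mem_sphere_zero_iff_norm.1 (ψ ⟨v, hv⟩).2
  have ha0 : a ≠ 0 := by intro h; simp [h] at han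
  set q : ℝ → ℂ := fun t => Complex.exp ((2 * Real.pi * t : ℝ) * Complex.I) with hq
  have hqn : ∀ t, a * q t ∈ sphere (0 : ℂ) 1 := fun t => by
    rw [mem_sphere_zero_iff_norm, norm_mul, han, one_mul]
    exact Complex.norm_exp_ofReal_mul_I _
  have hqi : InjOn q (Ico 0 1) := injOn_exp_two_pi_mul_I
  have hq0 : q 0 = 1 := by simp [hq]
  have hq1 : q 1 = 1 := by simp [hq]
  set c : ℝ → ℂ := fun t => ψ.symm ⟨a * q t, hqn t⟩ with hc
  have hcv : ∀ t, q t = 1 → c t = v := by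
    intro t ht
    have : (⟨a * q t, hqn t⟩ : sphere (0 : ℂ) 1) = ψ ⟨v, hv⟩ := Subtype.ext (by simp [ht, ha])
    simp only [hc]
    rw [this, Homeomorph.symm_apply_apply]
  have hci : ∀ s t, c s = c t → q s = q t := by
    intro s t hst
    have h1 := ψ.symm.injective (Subtype.ext hst)
    exact mul_left_cancel₀ ha0 (congrArg Subtype.val h1)
  refine ⟨c, ?_, ?_, ?_, hcv 0 hq0, hcv 1 hq1⟩
  · refine continuous_subtype_val.comp (ψ.symm.continuous.comp ?_)
    exact Continuous.subtype_mk (by fun_prop) _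
  · intro s hs t ht hst
    exact hqi (Ioo_subset_Ico_self hs) (Ioo_subset_Ico_self ht) (hci s t hst)
  · ext z
    constructor
    · rintro ⟨t, ht, rfl⟩
      refine ⟨(ψ.symm _).2, fun h => ht.1.ne' ?_⟩
      refine hqi (Ioo_subset_Ico_self ht) (by simp) (hci t 0 ?_)
      rw [hcv 0 hq0]; exact h
    · rintro ⟨hz, hzv⟩
      have hzn : ‖(ψ ⟨z, hz⟩ : ℂ)‖ = 1 := mem_sphere_zero_iff_norm.1 (ψ ⟨z, hz⟩).2
      obtain ⟨t, ht, htu⟩ := exists_exp_two_pi_mul_I_eq (u := ψ ⟨z, hz⟩ / a) (by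
        rw [norm_div, hzn, han, div_one])
      have htu' : q t = ψ ⟨z, hz⟩ / a := htu
      have hcz : c t = z := by
        have : (⟨a * q t, hqn t⟩ : sphere (0 : ℂ) 1) = ψ ⟨z, hz⟩ := Subtype.ext (by
          change a * q t = _
          rw [htu']; field_simp)
        simp only [hc]
        rw [this, Homeomorph.symm_apply_apply]
      refine ⟨t, ⟨lt_of_le_of_ne ht.1 ?_, ht.2⟩, hcz⟩
      rintro rfl
      exact hzv (hcz.symm.trans (hcv 0 hq0))

lemma IsJordanCurve.exists_isArcGraph {γ : Set ℂ} (hγ : IsJordanCurve γ) :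
    ∃ V E c, IsArcGraph γ V E c ∧ ∀ q ∈ γ \ V, IsPreconnected (γ \ {q}) := by
  obtain ⟨v, hv⟩ : γ.Nonempty := by
    obtain ⟨ψ⟩ := hγ
    exact ⟨ψ.symm ⟨1, by simp⟩, Subtype.mem _⟩
  obtain ⟨c, hc, hci, hcim, hc0, hc1⟩ := hγ.exists_param hv
  refine ⟨{v}, {γ \ {v}}, fun _ => c, ⟨finite_singleton _, finite_singleton _, by simpa using hv,
    by simp, by simp, fun _ _ => hc.continuousOn, fun _ _ => hci, ?_, ?_, ?_⟩, ?_⟩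
  · rintro _ rfl; exact hcim
  · rintro _ rfl; exact hc0
  · rintro _ rfl; exact hc1
  · intro q hq
    obtain ⟨d, hd, -, hdim, -, -⟩ := hγ.exists_param hq.1
    rw [← hdim]
    exact isPreconnected_Ioo.image d hd.continuousOn

lemma IsArcGraph.isPreconnected_diff_singleton {γ V : Set ℂ} {E : Set (Set ℂ)}
    {c : Set ℂ → ℝ → ℂ} (h : IsArcGraph γ V E c) (hγ : IsPreconnected γ)
    (hdeg : ∀ v ∈ V, Even ({e ∈ E | v ∈ closure e \ e}.ncard + {e ∈ E | closure e \ e = {v}}.ncard))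
    {q : ℂ} (hq : q ∈ γ \ V) : IsPreconnected (γ \ {q}) := by
  classical
  have hclos : ∀ e ∈ E, closure e \ e = {c e 0, c e 1} := by
    intro e he
    have h1 : closure e = c e '' Icc 0 1 := by
      refine subset_antisymm (closure_minimal ?_
        (isCompact_Icc.image_of_continuousOn (h.continuousOn e he)).isClosed) ?_
      · rw [h.image_Icc he]; exact subset_union_left
      · have h2 : closure (Ioo (0 : ℝ) 1) = Icc 0 1 := closure_Ioo zero_ne_one
        conv_rhs => rw [← h.image_eq e he]
        rw [← h2]
        exact ContinuousOn.image_closure (by rw [h2]; exact h.continuousOn e he)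
    rw [h1, h.image_Icc he, union_sdiff_left]
    refine sdiff_eq_left.2 ?_
    rw [Set.disjoint_left]
    rintro _ (rfl | rfl) hx
    exacts [(h.edge_subset he hx).2 (h.left_mem e he), (h.edge_subset he hx).2 (h.right_mem e he)]
  obtain ⟨e₀, he₀, hqe₀⟩ : q ∈ ⋃₀ E := h.diff_eq ▸ hq
  obtain ⟨t₀, ht₀, rfl⟩ := (h.image_eq e₀ he₀).ge hqe₀
  set q := c e₀ t₀ with hqdef
  rw [isPreconnected_iff_subset_of_disjoint]
  intro u v hu hv hsub hdis
  by_contra! hcon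
  obtain ⟨⟨y, hy, hyu⟩, ⟨x, hx, hxv⟩⟩ := And.imp not_subset.1 not_subset.1 hcon
  have hyv : y ∈ v := (hsub hy).resolve_left hyu
  have hxu : x ∈ u := (hsub hx).resolve_right hxv
  have hsep : ∀ S ⊆ γ \ {q}, IsPreconnected S → S ⊆ u ∨ S ⊆ v := by
    intro S hS hSp
    refine isPreconnected_iff_subset_of_disjoint.1 hSp u v hu hv (hS.trans hsub) ?_
    exact subset_empty_iff.1 ((inter_subset_inter_left _ hS).trans hdis.subset)
  have hnot : ∀ z ∈ γ \ {q}, z ∈ u → z ∉ v := fun z hz h1 h2 => by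
    have : z ∈ (γ \ {q}) ∩ (u ∩ v) := ⟨hz, h1, h2⟩
    rw [hdis] at this
    exact this
  have hVq : ∀ w ∈ V, w ∈ γ \ {q} := fun w hw => ⟨h.vertex_subset hw, fun he => hq.2 (he ▸ hw)⟩
  have hIccγ : ∀ e ∈ E, c e '' Icc 0 1 ⊆ γ := fun e he => by
    conv_rhs => rw [h.eq_union]
    exact (subset_biUnion_of_mem (u := fun e => c e '' Icc 0 1) he).trans subset_union_right
  have hother : ∀ e ∈ E, e ≠ e₀ → (c e 0 ∈ u ↔ c e 1 ∈ u) := by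
    intro e he hne
    have hS : c e '' Icc 0 1 ⊆ γ \ {q} := by
      intro z hz
      refine ⟨hIccγ e he hz, ?_⟩
      rintro rfl
      rcases h.image_Icc_subset he hz with h1 | h1
      · exact (h.pairwiseDisjoint he he₀ hne).ne_of_mem h1 hqe₀ rfl
      · exact hq.2 h1
    have h0 : c e 0 ∈ c e '' Icc 0 1 := mem_image_of_mem _ (by simp)
    have h1 : c e 1 ∈ c e '' Icc 0 1 := mem_image_of_mem _ (by simp)
    rcases hsep _ hS (isPreconnected_Icc.image _ (h.continuousOn e he)) with hs | hs
    · exact ⟨fun _ => hs h1, fun _ => hs h0⟩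
    · exact ⟨fun hx => absurd (hs h0) (hnot _ (hS h0) hx),
        fun hx => absurd (hs h1) (hnot _ (hS h1) hx)⟩
  have hinj : ∀ t ∈ Icc (0 : ℝ) 1, c e₀ t = q → t = t₀ := by
    intro t ht htq
    rcases eq_or_ne t 0 with rfl | h0
    · exact absurd (htq ▸ h.left_mem e₀ he₀) hq.2
    rcases eq_or_ne t 1 with rfl | h1
    · exact absurd (htq ▸ h.right_mem e₀ he₀) hq.2
    exact h.injOn e₀ he₀ ⟨lt_of_le_of_ne ht.1 h0.symm, lt_of_le_of_ne ht.2 h1⟩ ht₀ htq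
  have hL : c e₀ '' Ico 0 t₀ ⊆ γ \ {q} := by
    rintro _ ⟨t, ht, rfl⟩
    have ht' : t ∈ Icc (0 : ℝ) 1 := ⟨ht.1, ht.2.le.trans ht₀.2.le⟩
    exact ⟨hIccγ e₀ he₀ (mem_image_of_mem _ ht'), fun hx => ht.2.ne (hinj t ht' hx)⟩
  have hR : c e₀ '' Ioc t₀ 1 ⊆ γ \ {q} := by
    rintro _ ⟨t, ht, rfl⟩
    have ht' : t ∈ Icc (0 : ℝ) 1 := ⟨ht₀.1.le.trans ht.1.le, ht.2⟩
    exact ⟨hIccγ e₀ he₀ (mem_image_of_mem _ ht'), fun hx => ht.1.ne' (hinj t ht' hx)⟩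
  have hLs := hsep _ hL (isPreconnected_Ico.image _ ((h.continuousOn e₀ he₀).mono
    fun t ht => ⟨ht.1, ht.2.le.trans ht₀.2.le⟩))
  have hRs := hsep _ hR (isPreconnected_Ioc.image _ ((h.continuousOn e₀ he₀).mono
    fun t ht => ⟨ht₀.1.le.trans ht.1.le, ht.2⟩))
  have hl0 : c e₀ 0 ∈ c e₀ '' Ico 0 t₀ := mem_image_of_mem _ ⟨le_rfl, ht₀.1⟩
  have hr1 : c e₀ 1 ∈ c e₀ '' Ioc t₀ 1 := mem_image_of_mem _ ⟨ht₀.2, le_rfl⟩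
  -- both halves of the edge through `q` on the same side would disconnect the graph
  have hsame : ∀ u' v' : Set ℂ, IsOpen u' → IsOpen v' → γ \ {q} ⊆ u' ∪ v' →
      (γ \ {q}) ∩ (u' ∩ v') = ∅ → (∃ z ∈ γ \ {q}, z ∈ v') → c e₀ '' Ico 0 t₀ ⊆ u' →
      c e₀ '' Ioc t₀ 1 ⊆ u' → False := by
    rintro u' v' hu' hv' hs' hd' ⟨z, hz, hzv⟩ hl hr
    have hIcc : ∀ w ∈ c e₀ '' Icc 0 1, w ≠ q → w ∈ u' := by
      rintro _ ⟨t, ht, rfl⟩ hne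
      rcases lt_trichotomy t t₀ with h1 | h1 | h1
      · exact hl ⟨t, ⟨ht.1, h1⟩, rfl⟩
      · exact absurd (by rw [h1]) hne
      · exact hr ⟨t, ⟨h1, ht.2⟩, rfl⟩
    have hd'' : ∀ w ∈ γ \ {q}, w ∈ u' → w ∉ v' := fun w hw h1 h2 => by
      have : w ∈ (γ \ {q}) ∩ (u' ∩ v') := ⟨hw, h1, h2⟩
      rw [hd'] at this
      exact this
    have hcomp : IsClosed (c e₀ '' Icc 0 1) :=
      (isCompact_Icc.image_of_continuousOn (h.continuousOn e₀ he₀)).isClosed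
    obtain ⟨w, hwγ, hwu, hwv, hwn⟩ := hγ (u' ∪ (γ \ e₀)ᶜ) (v' ∩ (c e₀ '' Icc 0 1)ᶜ)
      (hu'.union (h.isClosed_diff_edge he₀).isOpen_compl) (hv'.inter hcomp.isOpen_compl)
      (by
        intro w hw
        by_cases hwq : w = q
        · exact Or.inl (Or.inr fun hx => hx.2 (hwq ▸ hqe₀))
        · rcases hs' ⟨hw, hwq⟩ with h1 | h1
          · exact Or.inl (Or.inl h1)
          · exact Or.inr ⟨h1, fun hwI => hd'' w ⟨hw, hwq⟩ (hIcc w hwI hwq) h1⟩)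
      ⟨q, hq.1, Or.inr fun hx => hx.2 hqe₀⟩
      ⟨z, hz.1, hzv, fun hzI => hd'' z hz (hIcc z hzI hz.2) hzv⟩
    have hwq : w ≠ q := by
      rintro rfl
      exact hwn ((h.image_Icc he₀).ge (Or.inl hqe₀))
    rcases hwu with h1 | h1
    · exact hd'' w ⟨hwγ, hwq⟩ h1 hwv
    · refine h1 ⟨hwγ, fun hwe => hwn ((h.image_Icc he₀).ge (Or.inl hwe))⟩
  have hone : ¬ (c e₀ 0 ∈ u ↔ c e₀ 1 ∈ u) := by
    rcases hLs with hl | hl <;> rcases hRs with hr | hr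
    · exact (hsame u v hu hv hsub hdis ⟨y, hy, hyv⟩ hl hr).elim
    · exact fun hx => hnot _ (hR hr1) (hx.1 (hl hl0)) (hr hr1)
    · exact fun hx => hnot _ (hL hl0) (hx.2 (hr hr1)) (hl hl0)
    · exact (hsame v u hv hu (by rwa [union_comm]) (by rwa [inter_comm v u]) ⟨x, hx, hxu⟩ hl
        hr).elim
  -- double counting of the incidences between edges and the vertices in `u`
  set Ef := h.edges_finite.toFinset with hEf
  set Vu := h.vertex_finite.toFinset.filter (· ∈ u) with hVu
  have hcount : ∀ w, {e ∈ E | w ∈ closure e \ e}.ncard + {e ∈ E | closure e \ e = {w}}.ncard =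
      ∑ e ∈ Ef, ((if w = c e 0 then 1 else 0) + (if w = c e 1 then 1 else 0)) := by
    intro w
    have h1 : ∀ P : Set ℂ → Prop, {e ∈ E | P e}.ncard = ∑ e ∈ Ef, if P e then 1 else 0 := by
      intro P
      rw [← Finset.card_filter, ← Set.ncard_coe_finset]
      congr 1
      ext e
      simp [hEf]
    rw [h1, h1, ← Finset.sum_add_distrib]
    refine Finset.sum_congr rfl fun e he => ?_
    rw [hclos e (h.edges_finite.mem_toFinset.1 he)]
    by_cases hab : c e 0 = c e 1
    · rw [hab]
      simp only [pair_eq_singleton, mem_singleton_iff, singleton_eq_singleton_iff]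
      simp only [eq_comm]
    · have hne : ¬ ({c e 0, c e 1} : Set ℂ) = {w} := by
        intro hx
        have h0 : c e 0 ∈ ({w} : Set ℂ) := hx ▸ Or.inl rfl
        have h1 : c e 1 ∈ ({w} : Set ℂ) := hx ▸ Or.inr rfl
        exact hab (h0.trans h1.symm)
      rw [if_neg hne, add_zero]
      by_cases h0 : w = c e 0
      · subst h0
        simp [hab]
      · simp [h0]
  have htot : ∑ w ∈ Vu, ({e ∈ E | w ∈ closure e \ e}.ncard +
      {e ∈ E | closure e \ e = {w}}.ncard) =
      ∑ e ∈ Ef, ((if c e 0 ∈ u then 1 else 0) + (if c e 1 ∈ u then 1 else 0)) := by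
    rw [Finset.sum_congr rfl fun w _ => hcount w, Finset.sum_comm]
    refine Finset.sum_congr rfl fun e he => ?_
    have he' := h.edges_finite.mem_toFinset.1 he
    rw [Finset.sum_add_distrib, Finset.sum_ite_eq', Finset.sum_ite_eq']
    simp [hVu, h.left_mem e he', h.right_mem e he']
  have heven : Even (∑ w ∈ Vu, ({e ∈ E | w ∈ closure e \ e}.ncard +
      {e ∈ E | closure e \ e = {w}}.ncard)) :=
    Finset.even_sum _ fun w hw => hdeg w (h.vertex_finite.mem_toFinset.1 (Finset.mem_filter.1 hw).1)
  rw [htot, ← Finset.add_sum_erase _ _ (h.edges_finite.mem_toFinset.2 he₀)] at heven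
  have heven' : Even (∑ e ∈ Ef.erase e₀, ((if c e 0 ∈ u then 1 else 0) +
      (if c e 1 ∈ u then 1 else 0))) := by
    refine Finset.even_sum _ fun e he => ?_
    rw [Finset.mem_erase] at he
    have := hother e (h.edges_finite.mem_toFinset.1 he.2) he.1
    by_cases hc : c e 0 ∈ u
    · simp [hc, this.1 hc]
    · have hc' : c e 1 ∉ u := fun hx => hc (this.2 hx)
      simp [hc, hc']
  rw [Nat.even_add] at heven
  have hev1 := heven.2 heven'
  by_cases hc : c e₀ 0 ∈ u <;> by_cases hc' : c e₀ 1 ∈ u <;> simp [hc, hc'] at hev1 hone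

lemma IsLemniscateGraphWith.exists_isArcGraph {γ V : Set ℂ} (h : IsLemniscateGraphWith γ V)
    (hc : IsCompact γ) (hγ : IsPreconnected γ) :
    ∃ V E c, IsArcGraph γ V E c ∧ ∀ q ∈ γ \ V, IsPreconnected (γ \ {q}) := by
  have hdisj : (graphEdges γ V).PairwiseDisjoint id := by
    rintro _ ⟨x, hx, rfl⟩ _ ⟨y, hy, rfl⟩ hne
    refine Set.disjoint_left.2 fun z hz hz' => hne ?_
    rw [connectedComponentIn_eq hz, connectedComponentIn_eq hz']
  have hcover : γ \ V = ⋃₀ graphEdges γ V := by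
    refine subset_antisymm (fun x hx => ⟨_, ⟨x, hx, rfl⟩, mem_connectedComponentIn hx⟩) ?_
    rintro z ⟨_, ⟨x, hx, rfl⟩, hz⟩
    exact connectedComponentIn_subset _ _ hz
  have hsub : ∀ e ∈ graphEdges γ V, e ⊆ γ \ V := fun e he => hcover ▸ subset_sUnion_of_mem he
  have hJ : ∀ e ∈ graphEdges γ V, IsJordanCurve e → IsCompact e := by
    rintro e - ⟨ψ⟩
    have := isCompact_iff_compactSpace.1 (isCompact_sphere (0 : ℂ) 1)
    exact isCompact_iff_compactSpace.2 ψ.symm.compactSpace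
  have hclos : ∀ e ∈ graphEdges γ V, closure e ⊆ e ∪ V := by
    intro e he
    rcases h.edge_shape e he with hj | ⟨-, h2⟩
    · rw [(hJ e he hj).isClosed.closure_eq]; exact subset_union_left
    · exact sdiff_subset_iff.1 h2
  by_cases hj : ∃ e ∈ graphEdges γ V, IsJordanCurve e
  · obtain ⟨e, he, hej⟩ := hj
    have hcl : IsClosed (V ∪ ⋃₀ (graphEdges γ V \ {e})) := by
      refine isClosed_of_closure_subset ?_
      rw [closure_union, h.vertex_finite.isClosed.closure_eq,
        (h.edges_finite.subset sdiff_subset).closure_sUnion]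
      refine union_subset subset_union_left (iUnion₂_subset fun e' he' => ?_)
      exact (hclos e' he'.1).trans (union_subset
        ((subset_sUnion_of_mem he').trans subset_union_right) subset_union_left)
    have hne : e.Nonempty := by
      obtain ⟨x, hx, rfl⟩ := he
      exact ⟨x, mem_connectedComponentIn hx⟩
    have hd : Disjoint e (V ∪ ⋃₀ (graphEdges γ V \ {e})) := by
      refine disjoint_union_right.2 ⟨Set.disjoint_left.2 fun x hx => (hsub e he hx).2,
        disjoint_sUnion_right.2 fun e' he' => hdisj he he'.1 (Ne.symm he'.2)⟩
    have hγe : γ ⊆ e ∪ (V ∪ ⋃₀ (graphEdges γ V \ {e})) := by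
      intro x hx
      by_cases hxV : x ∈ V
      · exact Or.inr (Or.inl hxV)
      obtain ⟨e', he', hxe'⟩ := hcover.subset ⟨hx, hxV⟩
      by_cases hee : e' = e
      · exact Or.inl (hee ▸ hxe')
      · exact Or.inr (Or.inr ⟨e', ⟨he', hee⟩, hxe'⟩)
    have heγ : γ = e := by
      refine subset_antisymm ?_ fun x hx => (hsub e he hx).1
      have := isPreconnected_closed_iff.1 hγ e _ (hJ e he hej).isClosed hcl hγe
        (hne.mono fun x hx => ⟨(hsub e he hx).1, hx⟩)
      intro x hx
      rcases hγe hx with h1 | h1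
      · exact h1
      obtain ⟨y, -, hy⟩ := this ⟨x, hx, h1⟩
      exact absurd hy.2 (Set.disjoint_left.1 hd hy.1)
    rw [heγ]
    exact hej.exists_isArcGraph
  · push Not at hj
    have harc : ∀ e ∈ graphEdges γ V, ∃ c : ℝ → ℂ, ContinuousOn c (Icc 0 1) ∧
        InjOn c (Ioo 0 1) ∧ c '' Ioo 0 1 = e ∧ c 0 ∈ V ∧ c 1 ∈ V := fun e he => by
      obtain ⟨h1, h2⟩ := (h.edge_shape e he).resolve_left (hj e he)
      exact h1.exists_param (hc.isBounded.subset fun x hx => (hsub e he hx).1) h.vertex_finite h2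
    choose! c hcc using harc
    have hG : IsArcGraph γ V (graphEdges γ V) c :=
      ⟨h.vertex_finite, h.edges_finite, h.vertex_subset, hcover, hdisj, fun e he => (hcc e he).1,
        fun e he => (hcc e he).2.1, fun e he => (hcc e he).2.2.1, fun e he => (hcc e he).2.2.2.1,
        fun e he => (hcc e he).2.2.2.2⟩
    exact ⟨V, _, c, hG, fun q hq => hG.isPreconnected_diff_singleton hγ h.degree_even hq⟩

lemma exists_pos_forall_dist_ge {E : ℝ → ℂ} {p η g : ℝ} {V : Set ℂ} (hp : 0 < p)
    (hE : Continuous E) (hper : Function.Periodic E p)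
    (hgap : ∀ x y, E x ∈ V → E y ∈ V → x ≠ y → g ≤ |x - y|)
    (hinj : ∀ x y, E x = E y → E x ∉ V → ∃ n : ℤ, y = x + n * p)
    (hη : 0 < η) (hηg : 2 * η < g) (hηp : 2 * η < p) :
    ∃ τ > 0, ∀ x y, |y - x| ≤ p / 2 →
      (|y - x| = 2 * η ∨ (2 * η ≤ |y - x| ∧ ∀ t, E t ∈ V → η ≤ |x - t|)) → τ ≤ dist (E x) (E y) := by
  have hclosed : IsClosed {q : ℝ × ℝ | q.1 ∈ Icc 0 p ∧ |q.2 - q.1| ≤ p / 2 ∧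
      (|q.2 - q.1| = 2 * η ∨ (2 * η ≤ |q.2 - q.1| ∧ ∀ t, E t ∈ V → η ≤ |q.1 - t|))} := by
    have h1 : Continuous fun q : ℝ × ℝ => |q.2 - q.1| := by fun_prop
    refine (isClosed_Icc.preimage continuous_fst).and <| (isClosed_le h1 continuous_const).and <|
      (isClosed_eq h1 continuous_const).union <| (isClosed_le continuous_const h1).and ?_
    simp only [ofPred_forall]
    exact isClosed_iInter fun t => isClosed_iInter fun _ =>
      isClosed_le continuous_const (by fun_prop)
  have hcpt : IsCompact {q : ℝ × ℝ | q.1 ∈ Icc 0 p ∧ |q.2 - q.1| ≤ p / 2 ∧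
      (|q.2 - q.1| = 2 * η ∨ (2 * η ≤ |q.2 - q.1| ∧ ∀ t, E t ∈ V → η ≤ |q.1 - t|))} := by
    refine ((isCompact_Icc (a := 0) (b := p)).prod (isCompact_Icc (a := -p) (b := 2 * p))).of_isClosed_subset hclosed ?_
    rintro ⟨x, y⟩ ⟨hx, hy, -⟩
    rw [abs_le] at hy
    simp only [mem_Icc] at hx hy
    exact ⟨hx, by dsimp only; linarith [hx.1, hy.1], by dsimp only; linarith [hx.2, hy.2]⟩
  obtain ⟨τ, hτ, hmin⟩ := hcpt.exists_forall_le' (f := fun q : ℝ × ℝ => dist (E q.1) (E q.2))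
    (a := 0) (by fun_prop) (by
      rintro ⟨x, y⟩ ⟨-, hxy, h⟩
      refine dist_pos.2 fun heq => ?_
      dsimp only at hxy h heq
      have hpos : 2 * η ≤ |y - x| := h.elim (fun h => h.ge) fun h => h.1
      by_cases hV : E x ∈ V
      · rcases h with h | h
        · have hne : y ≠ x := by rintro rfl; rw [sub_self, abs_zero] at hpos; linarith
          linarith [hgap y x (heq ▸ hV) hV hne]
        · have := h.2 x hV
          rw [sub_self, abs_zero] at this; linarith
      · obtain ⟨n, hn⟩ := hinj x y heq hV
        have hn' : y - x = n * p := by rw [hn]; ring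
        rw [hn', abs_mul, abs_of_pos hp] at hxy hpos
        have h0 : n ≠ 0 := by rintro rfl; simp at hpos; linarith
        have h1 : (1 : ℝ) ≤ |(n : ℝ)| := by exact_mod_cast Int.one_le_abs h0
        nlinarith)
  refine ⟨τ, hτ, fun x y hxy h => ?_⟩
  set k := toIcoDiv hp 0 x
  have hk : x - k * p ∈ Ico 0 p := by
    have := sub_toIcoDiv_zsmul_mem_Ico hp 0 x
    rwa [zsmul_eq_mul, zero_add] at this
  have hEk : ∀ z, E (z - k * p) = E z := fun z => hper.sub_int_mul_eq k
  have := hmin (x - k * p, y - k * p) ⟨⟨hk.1, hk.2.le⟩, by simpa using hxy, by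
    refine h.imp (fun h => by simpa using h) fun h => ⟨by simpa using h.1, fun t ht => ?_⟩
    have := h.2 (t + k * p) (by rw [← hEk]; simpa using ht)
    rwa [show x - k * p - t = x - (t + k * p) by ring]⟩
  simpa only [hEk] using this


lemma isClosed_exists_abs_le {E G : ℝ → ℂ} (hE : Continuous E) (hG : Continuous G) (a b r s : ℝ) :
    IsClosed {x | x ∈ Icc a b ∧ ∃ y, r ≤ |y - x| ∧ |y - x| ≤ s ∧ G y = E x} := by
  have hclosed : IsClosed {q : ℝ × ℝ | q.1 ∈ Icc a b ∧ r ≤ |q.2 - q.1| ∧ |q.2 - q.1| ≤ s ∧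
      G q.2 = E q.1} := by
    have h1 : Continuous fun q : ℝ × ℝ => |q.2 - q.1| := by fun_prop
    exact (isClosed_Icc.preimage continuous_fst).and <| (isClosed_le continuous_const h1).and <|
      (isClosed_le h1 continuous_const).and (isClosed_eq (by fun_prop) (by fun_prop))
  have hcpt := ((isCompact_Icc (a := a) (b := b)).prod
    (isCompact_Icc (a := a - s) (b := b + s))).of_isClosed_subset hclosed (by
      rintro ⟨x, y⟩ ⟨hx, -, hy, -⟩
      rw [abs_le] at hy
      simp only [mem_Icc] at hx hy
      exact ⟨hx, by dsimp only; linarith [hx.1, hy.1], by dsimp only; linarith [hx.2, hy.2]⟩)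
  convert (hcpt.image continuous_fst).isClosed using 1
  ext x
  constructor
  · rintro ⟨hx, y, h⟩
    exact ⟨(x, y), ⟨hx, h⟩, rfl⟩
  · rintro ⟨⟨x, y⟩, ⟨hx, h⟩, rfl⟩
    exact ⟨hx, y, h⟩

lemma exists_abs_sub_lt_of_eq {E G : ℝ → ℂ} {p η g τ : ℝ} {V : Set ℂ} (hp : 0 < p)
    (hE : Continuous E) (hG : Continuous G) (hperG : Function.Periodic G p)
    (hgap : ∀ x y, E x ∈ V → E y ∈ V → x ≠ y → g ≤ |x - y|)
    (hη : 0 < η) (hηg : 2 * η < g) (hηp : 4 * η < p)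
    (hτ : ∀ x y, |y - x| ≤ p / 2 →
      (|y - x| = 2 * η ∨ (2 * η ≤ |y - x| ∧ ∀ t, E t ∈ V → η ≤ |x - t|)) → τ ≤ dist (E x) (E y))
    (hGE : ∀ x, dist (G x) (E x) < τ) (hran : ∀ x, ∃ y, G y = E x)
    (hinjG : ∀ x y, G x = G y → G x ∉ V → ∃ n : ℤ, y = x + n * p) {x : ℝ} (hx : E x ∉ V) :
    ∃ y, |y - x| < 2 * η ∧ G y = E x := by
  have hhalf : ∀ x, ∃ y, |y - x| ≤ p / 2 ∧ G y = E x := by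
    intro x
    obtain ⟨y, hy⟩ := hran x
    set k := toIcoDiv hp (x - p / 2) y
    have hk : y - k * p ∈ Ico (x - p / 2) (x - p / 2 + p) := by
      have := sub_toIcoDiv_zsmul_mem_Ico hp (x - p / 2) y
      rwa [zsmul_eq_mul] at this
    refine ⟨y - k * p, ?_, by rw [← hy]; exact hperG.sub_int_mul_eq k⟩
    rw [abs_le]; constructor <;> linarith [hk.1, hk.2]
  have hdist : ∀ x y, G y = E x → dist (E x) (E y) < τ := fun x y h => h ▸ hGE y
  have hne : ∀ x y, G y = E x → |y - x| ≠ 2 * η := fun x y h h' =>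
    absurd (hτ x y (by linarith) (Or.inl h')) (not_le.2 (hdist x y h))
  have hfar : ∀ x, (∀ t, E t ∈ V → η ≤ |x - t|) → ∃ y, |y - x| < 2 * η ∧ G y = E x := by
    intro x hxT
    obtain ⟨y, hy, hGy⟩ := hhalf x
    refine ⟨y, ?_, hGy⟩
    by_contra hcon
    exact absurd (hτ x y hy (Or.inr ⟨not_lt.1 hcon, hxT⟩)) (not_le.2 (hdist x y hGy))
  have hconn : ∀ a b, a ≤ b → (∀ z ∈ Icc a b, E z ∉ V) → ∀ z ∈ Icc a b, ∀ w ∈ Icc a b,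
      (∃ y, |y - z| < 2 * η ∧ G y = E z) → ∃ y, |y - w| < 2 * η ∧ G y = E w := by
    intro a b hab hS z hz w hw ⟨y, hy, hGy⟩
    by_contra hcon
    obtain ⟨y', hy', hGy'⟩ := hhalf w
    obtain ⟨u, -, ⟨hu, y₁, -, h1, hG1⟩, -, y₂, h2, h3, hG2⟩ := isPreconnected_closed_iff.1
      (isPreconnected_Icc (a := a) (b := b)) _ _ (isClosed_exists_abs_le hE hG a b 0 (2 * η))
      (isClosed_exists_abs_le hE hG a b (2 * η) (p / 2)) (by
        intro u hu
        obtain ⟨y, hy, hGy⟩ := hhalf u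
        rcases le_total (|y - u|) (2 * η) with h | h
        · exact Or.inl ⟨hu, y, abs_nonneg _, h, hGy⟩
        · exact Or.inr ⟨hu, y, h, hy, hGy⟩)
      ⟨z, hz, hz, y, abs_nonneg _, hy.le, hGy⟩
      ⟨w, hw, hw, y', not_lt.1 fun h => hcon ⟨y', h, hGy'⟩, hy', hGy'⟩
    obtain ⟨n, hn⟩ := hinjG y₁ y₂ (hG1.trans hG2.symm) (hG1 ▸ hS u hu)
    have h1' := lt_of_le_of_ne h1 (hne u y₁ hG1)
    by_cases h0 : n = 0
    · subst h0
      simp only [Int.cast_zero, zero_mul, add_zero] at hn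
      rw [hn] at h2; linarith
    have h4 : (1 : ℝ) ≤ |(n : ℝ)| := by exact_mod_cast Int.one_le_abs h0
    have h5 : |(n : ℝ)| * p = |(y₂ - u) - (y₁ - u)| := by
      rw [hn, ← abs_of_pos hp, ← abs_mul, abs_of_pos hp]; congr 1; ring
    have h6 := abs_sub (y₂ - u) (y₁ - u)
    nlinarith
  by_cases hxT : ∀ t, E t ∈ V → η ≤ |x - t|
  · exact hfar x hxT
  push Not at hxT
  obtain ⟨t, htV, ht⟩ := hxT
  have hxt : x ≠ t := by rintro rfl; exact hx htV
  have hnear : ∀ z, z ≠ t → |z - t| ≤ η → E z ∉ V := fun z hz h hzV => by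
    linarith [hgap z t hzV htV hz]
  have hend : ∀ z, |z - t| = η → ∃ y, |y - z| < 2 * η ∧ G y = E z := by
    intro z hz
    refine hfar z fun s hs => ?_
    by_cases hst : s = t
    · rw [hst, hz]
    have h1 := hgap s t hs htV hst
    have h2 := abs_sub_le s z t
    rw [abs_sub_comm s z] at h2
    linarith
  rw [abs_lt] at ht
  rcases lt_or_gt_of_ne hxt with h | h
  · refine hconn (t - η) x (by linarith) (fun z hz => hnear z (by linarith [hz.2] : z < t).ne ?_)
      (t - η) ⟨le_rfl, by linarith⟩ x ⟨by linarith, le_rfl⟩ (hend _ ?_)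
    · rw [abs_le]; constructor <;> linarith [hz.1, hz.2]
    · rw [show t - η - t = -η by ring, abs_neg, abs_of_pos hη]
  · refine hconn x (t + η) (by linarith) (fun z hz => hnear z (by linarith [hz.1] : t < z).ne' ?_)
      (t + η) ⟨by linarith, le_rfl⟩ x ⟨le_rfl, by linarith⟩ (hend _ ?_)
    · rw [abs_le]; constructor <;> linarith [hz.1, hz.2]
    · rw [show t + η - t = η by ring, abs_of_pos hη]

/-- Two nearby parametrizations of the same graph by the line, both injective modulo `p` over the
complement of `V`, differ by a change of variables close to the identity. -/
theorem exists_strictMono_lift {E : ℝ → ℂ} {p g : ℝ} {V : Set ℂ} (hp : 0 < p)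
    (hE : Continuous E) (hper : Function.Periodic E p) (hg : 0 < g)
    (hgap : ∀ x y, E x ∈ V → E y ∈ V → x ≠ y → g ≤ |x - y|)
    (hinj : ∀ x y, E x = E y → E x ∉ V → ∃ n : ℤ, y = x + n * p) (hV : V.Finite)
    {r : ℝ} (hr : 0 < r) :
    ∃ τ > 0, ∀ G : ℝ → ℂ, Continuous G → Function.Periodic G p → (∀ x, dist (G x) (E x) < τ) →
      range G = range E → (∀ x y, G x = G y → G x ∉ V → ∃ n : ℤ, y = x + n * p) →
      Dense {x | G x ∉ V} →
      ∃ Θ : ℝ → ℝ, Continuous Θ ∧ StrictMono Θ ∧ (∀ x, Θ (x + p) = Θ x + p) ∧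
        (∀ x, |Θ x - x| ≤ r) ∧ ∀ x, G (Θ x) = E x := by
  obtain ⟨η, hη, hηr, hηg, hηp⟩ : ∃ η > 0, 2 * η ≤ r ∧ 16 * η < g ∧ 16 * η < p := by
    refine ⟨min (r / 2) (min (g / 20) (p / 20)), by positivity, ?_, ?_, ?_⟩
    · linarith [min_le_left (r / 2) (min (g / 20) (p / 20))]
    · linarith [(min_le_right (r / 2) (min (g / 20) (p / 20))).trans (min_le_left _ _)]
    · linarith [(min_le_right (r / 2) (min (g / 20) (p / 20))).trans (min_le_right _ _)]
  obtain ⟨τ, hτ, hτ'⟩ := exists_pos_forall_dist_ge hp hE hper hgap hinj hη (by linarith)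
    (by linarith)
  refine ⟨τ, hτ, fun G hG hperG hGE hran hinjG hdense => ?_⟩
  set S : Set ℝ := {x | E x ∉ V} with hS
  have hSo : IsOpen S := hV.isClosed.isOpen_compl.preimage hE
  have hSd : Dense S := by
    refine dense_iff_inter_open.2 fun U hU ⟨x, hx⟩ => ?_
    by_cases hxS : x ∈ S
    · exact ⟨x, hx, hxS⟩
    obtain ⟨ε, hε, hεU⟩ := Metric.isOpen_iff.1 hU x hx
    have hm : 0 < min ε g := lt_min hε hg
    refine ⟨x + min ε g / 2, hεU ?_, fun hV' => ?_⟩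
    · rw [mem_ball, Real.dist_eq, add_sub_cancel_left, abs_of_pos (by positivity)]
      linarith [min_le_left ε g]
    · have := hgap _ x hV' (not_not.1 hxS) (by linarith)
      rw [add_sub_cancel_left, abs_of_pos (by positivity)] at this
      linarith [min_le_right ε g]
  have hsmall : ∀ x y, |y - x| < p → (∃ n : ℤ, y = x + n * p) → y = x := by
    rintro x y h ⟨n, rfl⟩
    rw [add_sub_cancel_left, abs_mul, abs_of_pos hp] at h
    have : |(n : ℝ)| < 1 := by
      by_contra hcon
      push Not at hcon
      nlinarith
    have : n = 0 := by
      rw [← Int.abs_lt_one_iff]; exact_mod_cast this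
    simp [this]
  have hex : ∀ x ∈ S, ∃ y, |y - x| < 2 * η ∧ G y = E x := fun x hx =>
    exists_abs_sub_lt_of_eq hp hE hG hperG hgap hη (by linarith) (by linarith) hτ' hGE
      (fun x => hran.ge ⟨x, rfl⟩) hinjG hx
  choose! θ hθ hGθ using hex
  have huniq : ∀ x ∈ S, ∀ y, |y - x| ≤ 2 * η → G y = E x → y = θ x := by
    intro x hx y hy hGy
    refine hsmall _ _ ?_ (hinjG _ _ ((hGθ x hx).trans hGy.symm) (by rw [hGθ x hx]; exact hx))
    have h1 := abs_sub_le y x (θ x)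
    have h2 := hθ x hx
    rw [abs_sub_comm] at h2
    linarith
  have hθinj : InjOn θ S := by
    intro x hx y hy hxy
    refine hsmall _ _ ?_ (hinj _ _ (by rw [← hGθ y hy, ← hGθ x hx, hxy]) hy)
    have h1 := abs_sub_le x (θ x) y
    have h2 := hθ x hx
    have h3 := hθ y hy
    rw [abs_sub_comm] at h2
    rw [← hxy] at h3
    linarith
  have hθper : ∀ x ∈ S, ∀ n : ℤ, θ (x + n * p) = θ x + n * p := by
    intro x hx n
    have hEn : E (x + n * p) = E x := hper.int_mul n x
    refine (huniq _ (by rw [hS, mem_ofPred_eq, hEn]; exact hx) _ ?_ ?_).symm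
    · rw [add_sub_add_right_eq_sub]; exact (hθ x hx).le
    · rw [hEn, ← hGθ x hx]; exact hperG.int_mul n _
  have hθc : ContinuousOn θ S := by
    intro x hx
    rw [ContinuousWithinAt, tendsto_iff_ultrafilter]
    intro u hu
    have hux : (u : Filter ℝ) ≤ 𝓝 x := hu.trans nhdsWithin_le_nhds
    have huS : ∀ᶠ z in (u : Filter ℝ), z ∈ S := hu self_mem_nhdsWithin
    have huI : ∀ᶠ z in (u : Filter ℝ), z ∈ ball x 1 := hux (ball_mem_nhds x one_pos)
    obtain ⟨y, -, hy⟩ := (isCompact_closedBall x (1 + 2 * η)).ultrafilter_le_nhds (u.map θ) (by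
      rw [le_principal_iff, Ultrafilter.mem_coe, Ultrafilter.mem_map]
      filter_upwards [huS, huI] with z hz hz'
      have h1 := abs_sub_le (θ z) z x
      rw [mem_ball, Real.dist_eq] at hz'
      rw [mem_preimage, mem_closedBall, Real.dist_eq]
      linarith [hθ z hz])
    have hty : Tendsto θ u (𝓝 y) := hy
    have htx : Tendsto (fun z : ℝ => z) u (𝓝 x) := hux
    have hyx : y = θ x := by
      refine huniq x hx y ?_ ?_
      · refine le_of_tendsto ((hty.sub htx).abs) ?_
        filter_upwards [huS] with z hz using (hθ z hz).le
      · refine tendsto_nhds_unique ((hG.tendsto y).comp hty) (((hE.tendsto x).comp htx).congr' ?_)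
        filter_upwards [huS] with z hz using (hGθ z hz).symm
    exact hyx ▸ hty
  have hivt : ∀ a b, a ≤ b → (∀ z ∈ Icc a b, z ∈ S) → ∀ s ∈ Icc (θ a) (θ b), ∃ w ∈ Icc a b, θ w = s :=
    fun a b hab hz s hs => intermediate_value_Icc hab (hθc.mono hz) hs
  have hθmono : StrictMonoOn θ S := by
    intro x hx y hy hxy
    by_contra hcon
    push Not at hcon
    have hx' := abs_lt.1 (hθ x hx)
    have hy' := abs_lt.1 (hθ y hy)
    by_cases h1 : ∀ z ∈ Icc y (y + 6 * η), z ∈ S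
    · have hz' := abs_lt.1 (hθ (y + 6 * η) (h1 _ ⟨by linarith, le_rfl⟩))
      obtain ⟨w, hw, hwx⟩ := hivt y (y + 6 * η) (by linarith) h1 (θ x)
        ⟨hcon, by linarith⟩
      linarith [hw.1, hθinj (h1 w hw) hx hwx]
    by_cases h2 : ∀ z ∈ Icc (x - 6 * η) x, z ∈ S
    · have hz' := abs_lt.1 (hθ (x - 6 * η) (h2 _ ⟨le_rfl, by linarith⟩))
      obtain ⟨w, hw, hwx⟩ := hivt (x - 6 * η) x (by linarith) h2 (θ y)
        ⟨by linarith, hcon⟩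
      linarith [hw.2, hθinj (h2 w hw) hy hwx]
    push Not at h1 h2
    obtain ⟨s, hs, hsV⟩ := h1
    obtain ⟨t, ht, htV⟩ := h2
    have := hgap s t (not_not.1 hsV) (not_not.1 htV) (by linarith [hs.1, ht.2])
    rw [abs_of_pos (by linarith [hs.1, ht.2])] at this
    linarith [hs.2, ht.1]
  have hne : ∀ x, (θ '' (S ∩ Iic x)).Nonempty := fun x => by
    obtain ⟨z, hz, hzS⟩ := hSd.exists_between (show x - 1 < x by linarith)
    exact ⟨_, z, ⟨hz, hzS.2.le⟩, rfl⟩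
  have hbdd : ∀ x, BddAbove (θ '' (S ∩ Iic x)) := fun x => ⟨x + 2 * η, by
    rintro _ ⟨z, ⟨hz, hzx⟩, rfl⟩
    have := abs_lt.1 (hθ z hz)
    rw [mem_Iic] at hzx
    linarith⟩
  set Θ : ℝ → ℝ := fun x => sSup (θ '' (S ∩ Iic x)) with hΘ
  have hΘm : Monotone Θ := fun x y hxy => csSup_le_csSup (hbdd y) (hne x)
    (image_mono (inter_subset_inter_right _ (Iic_subset_Iic.2 hxy)))
  have hΘS : ∀ x ∈ S, Θ x = θ x := fun x hx => le_antisymm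
    (csSup_le (hne x) (by
      rintro _ ⟨z, ⟨hz, hzx⟩, rfl⟩
      exact hθmono.monotoneOn hz hx hzx))
    (le_csSup (hbdd x) ⟨x, ⟨hx, mem_Iic.2 le_rfl⟩, rfl⟩)
  have hΘc : Continuous Θ := by
    refine hΘm.continuous_of_denseRange (hdense.mono ?_)
    intro y hy
    obtain ⟨x, hx⟩ := hran.le ⟨y, rfl⟩
    have hxS : x ∈ S := by rw [hS, mem_ofPred_eq, hx]; exact hy
    obtain ⟨n, hn⟩ := hinjG (θ x) y (by rw [hGθ x hxS, hx]) (by rw [hGθ x hxS]; exact hxS)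
    refine ⟨x + n * p, ?_⟩
    rw [hΘS _ (by rw [hS, mem_ofPred_eq, hper.int_mul n x]; exact hxS), hθper x hxS, hn]
  refine ⟨Θ, hΘc, ?_, ?_, ?_, ?_⟩
  · intro x y hxy
    obtain ⟨s, hs, hxs⟩ := hSd.exists_between hxy
    obtain ⟨t, ht, hst⟩ := hSd.exists_between hxs.2
    calc Θ x ≤ Θ s := hΘm hxs.1.le
      _ = θ s := hΘS s hs
      _ < θ t := hθmono hs ht hst.1
      _ = Θ t := (hΘS t ht).symm
      _ ≤ Θ y := hΘm hst.2.le
  · intro x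
    refine congrFun (Continuous.ext_on hSd (f := fun x => Θ (x + p)) (g := fun x => Θ x + p)
      (by fun_prop) (by fun_prop) ?_) x
    intro x hx
    have h1 := hθper x hx 1
    simp only [Int.cast_one, one_mul] at h1
    change Θ (x + p) = Θ x + p
    rw [hΘS x hx, hΘS _ (by rw [hS, mem_ofPred_eq, hper x]; exact hx), h1]
  · intro x
    have : closure S ⊆ {x | |Θ x - x| ≤ r} := closure_minimal (fun x hx => by
      rw [mem_ofPred_eq, hΘS x hx]; linarith [hθ x hx]) (isClosed_le (by fun_prop) continuous_const)
    exact this (hSd x)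
  · intro x
    refine congrFun (Continuous.ext_on hSd (f := fun x => G (Θ x)) (g := E) (by fun_prop) hE ?_) x
    intro x hx
    change G (Θ x) = E x
    rw [hΘS x hx, hGθ x hx]

lemma IsContinuumDomain.exists_forall_image {D K : Set ℂ} (hD : IsContinuumDomain D K) {z₀ : ℂ}
    (hz₀ : z₀ ∈ D) : ∃ δ > 0, ∃ R, ∀ h : ℂ → ℂ, ContinuousOn h K → (∀ z ∈ K, dist (h z) z < δ) →
      IsContinuumDomain (connectedComponentIn (h '' K)ᶜ z₀) (h '' K) ∧
      connectedComponentIn (h '' K)ᶜ z₀ ⊆ ball z₀ R ∧ z₀ ∈ connectedComponentIn (h '' K)ᶜ z₀ := by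
  have hz₀K : z₀ ∉ K := hD.subset_compl hz₀
  obtain ⟨d, hd, hdK⟩ : ∃ d > 0, ∀ z ∈ K, d ≤ dist z z₀ := by
    obtain ⟨d, hd, hdK⟩ := Metric.isOpen_iff.1 hD.isCompact.isClosed.isOpen_compl z₀ hz₀K
    exact ⟨d, hd, fun z hz => not_lt.1 fun h => hdK (mem_ball.2 h) hz⟩
  obtain ⟨r, hr⟩ := (hD.isCompact.isBounded.union hD.isBounded).subset_ball z₀
  have hr0 : 0 < r := pos_of_mem_ball (hr (Or.inr hz₀))
  refine ⟨min 1 (d / 4), by positivity, r + 2, fun h hc hh => ?_⟩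
  have hh1 : ∀ z ∈ K, dist (h z) z < 1 := fun z hz => (hh z hz).trans_le (min_le_left _ _)
  have hhd : ∀ z ∈ K, dist (h z) z < d / 4 := fun z hz => (hh z hz).trans_le (min_le_right _ _)
  have hK' : IsCompact (h '' K) := hD.isCompact.image_of_continuousOn hc
  have hfar : ∀ z ∈ K, d / 2 < dist (h z) z₀ := fun z hz => by
    have := dist_triangle_left z z₀ (h z)
    linarith [hhd z hz, hdK z hz]
  have hz₀' : z₀ ∉ h '' K := by
    rintro ⟨z, hz, hzz⟩
    have := hfar z hz
    rw [hzz, dist_self] at this; linarith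
  have hin : h '' K ⊆ closedBall z₀ (r + 1) := by
    rintro _ ⟨z, hz, rfl⟩
    have := dist_triangle (h z) z z₀
    have h2 := mem_ball.1 (hr (Or.inl hz))
    rw [mem_closedBall]
    linarith [hh1 z hz]
  have hsub : connectedComponentIn (h '' K)ᶜ z₀ ⊆ ball z₀ (r + 2) := by
    by_contra hcon
    obtain ⟨x, hx, hxr⟩ := not_subset.1 hcon
    rw [mem_ball, not_lt] at hxr
    set w : ℂ := z₀ + (r + 2 : ℝ) with hw
    have hwd : dist w z₀ = r + 2 := by
      rw [hw, dist_eq_norm, add_sub_cancel_left, Complex.norm_real, Real.norm_eq_abs,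
        abs_of_pos (by linarith)]
    have hwmem : w ∈ connectedComponentIn (h '' K)ᶜ z₀ := by
      rw [connectedComponentIn_eq hx]
      refine (isPreconnected_compl_closedBall z₀ (by linarith : 0 < r + 1)).subset_connectedComponentIn
        ?_ (compl_subset_compl.2 hin) ?_ <;> rw [mem_compl_iff, mem_closedBall] <;> linarith
    have hwK : ∀ z ∈ K, 2 < dist z w := fun z hz => by
      have h1 := mem_ball.1 (hr (Or.inl hz))
      have h2 := dist_triangle_left w z₀ z
      linarith
    have hlog := (hasLogOn_div_of_mem_connectedComponentIn hK'.isClosed hwmem).comp hc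
      (mapsTo_image h K)
    have h1 : HasLogOn (fun z => (z - z₀) / (h z - z₀)) K := by
      refine .of_norm_sub_one_lt (by
        refine ContinuousOn.div (by fun_prop) (by fun_prop) fun z hz => sub_ne_zero.2 ?_
        rintro h'
        exact hz₀' (h' ▸ mem_image_of_mem h hz)) fun z hz => ?_
      have h0 : h z - z₀ ≠ 0 := sub_ne_zero.2 fun h' => hz₀' (h' ▸ mem_image_of_mem h hz)
      rw [div_sub_one h0, norm_div, div_lt_one (norm_pos_iff.2 h0), 
        sub_sub_sub_cancel_right, ← dist_eq_norm, ← dist_eq_norm, dist_comm]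
      linarith [hhd z hz, hfar z hz]
    have h2 : HasLogOn (fun z => (h z - w) / (z - w)) K := by
      have h0 : ∀ z ∈ K, z - w ≠ 0 := fun z hz => sub_ne_zero.2 (dist_pos.1 (by linarith [hwK z hz]))
      refine .of_norm_sub_one_lt (by
        exact ContinuousOn.div (by fun_prop) (by fun_prop) h0) fun z hz => ?_
      rw [div_sub_one (h0 z hz), norm_div, div_lt_one (norm_pos_iff.2 (h0 z hz)), 
        sub_sub_sub_cancel_right, ← dist_eq_norm, ← dist_eq_norm]
      linarith [hh1 z hz, hwK z hz]
    have hwΩ := mem_connectedComponentIn_of_hasLogOn hD.isCompact hz₀K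
      (fun hwK' => by have := hwK w hwK'; rw [dist_self] at this; linarith)
      (((hlog.mul h1).mul h2).congr fun z hz => by
        have e1 : h z - z₀ ≠ 0 := sub_ne_zero.2 fun h' => hz₀' (h' ▸ mem_image_of_mem h hz)
        have e2 : h z - w ≠ 0 := sub_ne_zero.2 fun h' => by
          have h3 := hwK z hz
          have h4 := hh1 z hz
          rw [h', dist_comm] at h4; linarith
        field_simp)
    rw [← hD.eq_connectedComponentIn hz₀] at hwΩ
    have := mem_ball.1 (hr (Or.inr hwΩ))
    linarith
  exact ⟨⟨hK', hD.isPreconnected.image h hc, isBounded_ball.subset hsub, z₀, hz₀', rfl⟩, hsub,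
    mem_connectedComponentIn hz₀'⟩

lemma IsUniformlyLocallyConnected.exists_forall_image {K : Set ℂ}
    (hK : IsUniformlyLocallyConnected K) {ε : ℝ} (hε : 0 < ε) :
    ∃ l > 0, l ≤ ε ∧ ∃ δ > 0, ∀ h : ℂ → ℂ, ContinuousOn h K → (∀ z ∈ K, dist (h z) z < δ) →
      ∀ p ∈ h '' K, ∃ κ ⊆ h '' K, IsCompact κ ∧ IsPreconnected κ ∧
        h '' K ∩ closedBall p (2 * l) ⊆ κ ∧ κ ⊆ closedBall p ε := by
  obtain ⟨η, hη, hηK⟩ := hK (ε / 2) (by positivity)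
  refine ⟨min (η / 4) ε, by positivity, min_le_right _ _, min (η / 4) (ε / 4), by positivity, ?_⟩
  rintro h hc hh _ ⟨q, hq, rfl⟩
  have h1 : ∀ z ∈ K, dist (h z) z < η / 4 := fun z hz => (hh z hz).trans_le (min_le_left _ _)
  have h2 : ∀ z ∈ K, dist (h z) z < ε / 4 := fun z hz => (hh z hz).trans_le (min_le_right _ _)
  obtain ⟨κ, hκK, hκc, hκp, hκ1, hκ2⟩ := hηK q hq
  refine ⟨h '' κ, image_mono hκK, hκc.image_of_continuousOn (hc.mono hκK),
    hκp.image h (hc.mono hκK), ?_, ?_⟩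
  · rintro _ ⟨⟨z, hz, rfl⟩, hzq⟩
    refine ⟨z, hκ1 ⟨hz, ?_⟩, rfl⟩
    rw [mem_closedBall] at hzq ⊢
    have h3 := dist_triangle4 z (h z) (h q) q
    rw [dist_comm z (h z)] at h3
    linarith [h1 z hz, h1 q hq, min_le_left (η / 4) ε]
  · rintro _ ⟨z, hz, rfl⟩
    have h3 := dist_triangle4 (h z) z q (h q)
    have h4 := mem_closedBall.1 (hκ2 hz)
    rw [dist_comm q (h q)] at h3
    rw [mem_closedBall]
    linarith [h2 z (hκK hz), h2 q hq]

lemma continuousOn_invFunOn_image {K : Set ℂ} (hK : IsCompact K) {h : ℂ → ℂ}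
    (hc : ContinuousOn h K) (hi : InjOn h K) : ContinuousOn (Function.invFunOn h K) (h '' K) :=
  continuousOn_image_of_comp hK hc (continuousOn_id.congr fun _ hz => hi.leftInvOn_invFunOn hz)

lemma IsUniformlyLocallyConnected.image {K : Set ℂ} (hK : IsUniformlyLocallyConnected K)
    (hcpt : IsCompact K) {h : ℂ → ℂ} (hc : ContinuousOn h K) (hi : InjOn h K) :
    IsUniformlyLocallyConnected (h '' K) := by
  intro ε hε
  obtain ⟨ε₁, hε₁, h1⟩ := Metric.uniformContinuousOn_iff.1
    (hcpt.uniformContinuousOn_of_continuous hc) ε hε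
  obtain ⟨η₁, hη₁, h2⟩ := hK (ε₁ / 2) (by positivity)
  obtain ⟨η, hη, h3⟩ := Metric.uniformContinuousOn_iff.1
    ((hcpt.image_of_continuousOn hc).uniformContinuousOn_of_continuous
      (continuousOn_invFunOn_image hcpt hc hi)) η₁ hη₁
  refine ⟨η / 2, by positivity, ?_⟩
  rintro _ ⟨q, hq, rfl⟩
  obtain ⟨κ, hκK, hκc, hκp, hκ1, hκ2⟩ := h2 q hq
  refine ⟨h '' κ, image_mono hκK, hκc.image_of_continuousOn (hc.mono hκK),
    hκp.image h (hc.mono hκK), ?_, ?_⟩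
  · rintro _ ⟨⟨z, hz, rfl⟩, hzq⟩
    refine ⟨z, hκ1 ⟨hz, ?_⟩, rfl⟩
    have := h3 (h z) (mem_image_of_mem h hz) (h q) (mem_image_of_mem h hq)
      (by rw [mem_closedBall] at hzq; linarith)
    rw [hi.leftInvOn_invFunOn hz, hi.leftInvOn_invFunOn hq] at this
    exact this.le
  · rintro _ ⟨z, hz, rfl⟩
    exact (h1 z (hκK hz) q hq (by linarith [mem_closedBall.1 (hκ2 hz)])).le

lemma tendstoUniformlyOn_diskMap {ι : Type*} {u : Filter ι} {f : ι → ℂ → ℂ} {F : ℂ → ℂ}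
    {D : ι → Set ℂ} {z₀ : ℂ} {R : ℝ} (hf : ∀ᶠ n in u, IsDiskMap (f n) (D n))
    (hR : ∀ᶠ n in u, D n ⊆ ball z₀ R)
    (hbd : ∀ ε > 0, ∃ a > 0, ∀ᶠ n in u, ∀ t ∈ sphere (0 : ℂ) 1, ∀ w ∈ closedBall (0 : ℂ) 1,
      dist w t < a → dist (f n w) (f n t) < ε)
    (hF : ∀ w ∈ closedBall (0 : ℂ) 1, Tendsto (fun n => f n w) u (𝓝 (F w))) :
    TendstoUniformlyOn f F u (closedBall 0 1) := by
  refine tendstoUniformlyOn_of_tendsto_of_equicontinuous (isCompact_closedBall 0 1) hF ?_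
  intro x hx ε hε
  rw [mem_closedBall_zero_iff] at hx
  rcases hx.lt_or_eq with hx1 | hx1
  · set M : ℝ := max (‖z₀‖ + R) 1 with hM
    have hM1 : 1 ≤ M := le_max_right _ _
    have hr : 0 < 1 - ‖x‖ := by linarith
    refine ⟨min (1 - ‖x‖) (ε * (1 - ‖x‖) / (2 * M)), by positivity, ?_⟩
    filter_upwards [hf, hR] with n hn hnR y _ hyx
    have hsub : ball x (1 - ‖x‖) ⊆ ball (0 : ℂ) 1 := fun z hz => by
      rw [mem_ball, dist_eq_norm] at hz
      rw [mem_ball_zero_iff]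
      linarith [norm_le_norm_sub_add z x]
    have h1 := dist_le_of_differentiableOn_of_bounded (hn.differentiableOn.mono hsub) (M := M)
      (fun w hw => by
        have h2 := mem_ball.1 (hnR (hn.mem (hsub hw)))
        rw [dist_eq_norm] at h2
        have h3 := norm_le_norm_sub_add (f n w) z₀
        exact le_max_of_le_left (by linarith))
      (mem_ball.2 (hyx.trans_le (min_le_left _ _)))
    refine h1.trans_lt ?_
    have h2 := hyx.trans_le (min_le_right _ _)
    rw [lt_div_iff₀ (by positivity)] at h2
    rw [div_mul_eq_mul_div, div_lt_iff₀ hr]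
    linarith
  · obtain ⟨a, ha, h⟩ := hbd ε hε
    refine ⟨a, ha, ?_⟩
    filter_upwards [h] with n hn y hy hyx
    exact hn x (mem_sphere_zero_iff_norm.2 hx1) y hy hyx

lemma IsDiskMap.of_tendstoUniformlyOn {ι : Type*} {u : Filter ι} [u.NeBot] {f : ι → ℂ → ℂ}
    {F : ℂ → ℂ} {h : ι → ℂ → ℂ} {D : ι → Set ℂ} {Ω γ : Set ℂ} {z₀ : ℂ}
    (hΩ : IsContinuumDomain Ω γ) (hz₀ : z₀ ∈ Ω)
    (hh : ∀ δ > 0, ∀ᶠ n in u, ∀ z ∈ γ, dist (h n z) z < δ)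
    (hD : ∀ᶠ n in u, IsContinuumDomain (D n) (h n '' γ))
    (hf : ∀ᶠ n in u, IsDiskMap (f n) (D n)) (hF0 : F 0 = z₀)
    (hF : TendstoUniformlyOn f F u (closedBall 0 1)) : IsDiskMap F Ω := by
  have hc : ContinuousOn F (closedBall 0 1) :=
    hF.continuousOn (hf.mono fun n hn => hn.continuousOn).frequently
  have hloc : TendstoLocallyUniformlyOn f F u (ball 0 1) :=
    (hF.mono ball_subset_closedBall).tendstoLocallyUniformlyOn
  have hfd : ∀ᶠ n in u, DifferentiableOn ℂ (f n) (ball 0 1) := hf.mono fun n hn => hn.differentiableOn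
  have hd : DifferentiableOn ℂ F (ball 0 1) := hloc.differentiableOn hfd isOpen_ball
  have hγc : IsClosed γ := hΩ.isCompact.isClosed
  have hsph : ∀ w ∈ sphere (0 : ℂ) 1, F w ∈ γ := by
    intro w hw
    rw [← hγc.closure_eq, Metric.mem_closure_iff]
    intro ε hε
    obtain ⟨n, hn1, hn2, hn3, hn4⟩ := (((Metric.tendstoUniformlyOn_iff.1 hF (ε / 2) (by positivity)).and
      ((hh (ε / 2) (by positivity)).and (hD.and hf)))).exists
    obtain ⟨q, hq, hqw⟩ := hn3.frontier_subset (hn4.mem_frontier hw)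
    refine ⟨q, hq, ?_⟩
    have h1 := hn1 w (sphere_subset_closedBall hw)
    have h2 := hn2 q hq
    rw [hqw] at h2
    linarith [dist_triangle (F w) (f n w) q]
  have hz₀γ : z₀ ∉ γ := hΩ.subset_compl hz₀
  have hne : ∃ x ∈ ball (0 : ℂ) 1, ∃ y ∈ ball (0 : ℂ) 1, F x ≠ F y := by
    by_contra hcon
    push Not at hcon
    have h0 : (0 : ℂ) ∈ ball (0 : ℂ) 1 := mem_ball_self one_pos
    have h1 : (1 : ℂ) ∈ sphere (0 : ℂ) 1 := by simp
    have : EqOn F (fun _ => z₀) (closure (ball (0 : ℂ) 1)) := by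
      refine EqOn.of_subset_closure (fun w hw => (hcon w hw 0 h0).trans hF0)
        (by rwa [closure_ball _ one_ne_zero]) continuousOn_const subset_closure subset_rfl
    refine hz₀γ ?_
    have h2 := this (x := 1) (by rw [closure_ball _ one_ne_zero]; exact sphere_subset_closedBall h1)
    rw [← show F 1 = z₀ from h2]
    exact hsph 1 h1
  have hi : InjOn F (ball 0 1) := injOn_of_tendstoLocallyUniformlyOn isOpen_ball
    (convex_ball _ _).isPreconnected hfd (hf.mono fun n hn => hn.injOn) hloc hne
  have hball : ∀ w ∈ ball (0 : ℂ) 1, F w ∉ γ := by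
    intro w hw hwγ
    obtain ⟨r, hr, hrb⟩ := Metric.nhds_basis_closedBall.mem_iff.1 (isOpen_ball.mem_nhds hw)
    obtain ⟨ρ, hρ, hev⟩ := eventually_ball_subset_image hr
      (hfd.mono fun n hn => (hn.mono (by rwa [closure_ball _ hr.ne'])).diffContOnCl)
      (hF.mono (hrb.trans ball_subset_closedBall))
      (hc.mono ((sphere_subset_closedBall.trans hrb).trans ball_subset_closedBall))
      (fun z hz h' => by
        have := hi (hrb (sphere_subset_closedBall hz)) hw h'
        rw [this, mem_sphere, dist_self] at hz
        linarith)
    obtain ⟨n, hn1, hn2, hn3, hn4⟩ := (hev.and ((hh ρ hρ).and (hD.and hf))).exists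
    obtain ⟨x, hx, hxw⟩ := hn1 (mem_ball.2 (hn2 (F w) hwγ))
    have := hn4.mem (hrb hx)
    rw [hxw] at this
    exact hn3.subset_compl this (mem_image_of_mem _ hwγ)
  have hop : IsOpen (F '' ball 0 1) := isOpen_image_of_injOn isOpen_ball hd hi
  have hz₀' : z₀ ∈ F '' ball 0 1 := ⟨0, mem_ball_self one_pos, hF0⟩
  have him : F '' ball 0 1 = Ω := by
    refine subset_antisymm ?_ ?_
    · rw [hΩ.eq_connectedComponentIn hz₀]
      refine IsPreconnected.subset_connectedComponentIn
        ((convex_ball _ _).isPreconnected.image F (hc.mono ball_subset_closedBall)) hz₀' ?_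
      rintro _ ⟨w, hw, rfl⟩
      exact hball w hw
    · refine hΩ.isConnected.isPreconnected.subset_of_inter_frontier hop ⟨z₀, hz₀, hz₀'⟩ ?_
      refine eq_empty_of_forall_notMem ?_
      rintro z ⟨hzΩ, hzfr⟩
      rw [hop.frontier_eq] at hzfr
      have h1 : closure (F '' ball 0 1) ⊆ F '' closedBall 0 1 := closure_minimal
        (image_mono ball_subset_closedBall)
        ((isCompact_closedBall 0 1).image_of_continuousOn hc).isClosed
      obtain ⟨w, hw, rfl⟩ := h1 hzfr.1
      rw [← ball_union_sphere] at hw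
      rcases hw with hw | hw
      · exact hzfr.2 (mem_image_of_mem F hw)
      · exact hΩ.subset_compl hzΩ (hsph w hw)
  exact ⟨hc, hd, hi, him, fun w hw h' => hΩ.subset_compl h' (hsph w hw)⟩

lemma IsContinuumDomain.exists_tendstoUniformlyOn_diskMap {ι : Type*} (u : Ultrafilter ι)
    {h : ι → ℂ → ℂ} {Ω γ : Set ℂ} {z₀ : ℂ} (hΩ : IsContinuumDomain Ω γ) (hz₀ : z₀ ∈ Ω)
    (hγ : IsUniformlyLocallyConnected γ) (hc : ∀ n, ContinuousOn (h n) γ)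
    (hi : ∀ n, InjOn (h n) γ) (hh : ∀ δ > 0, ∀ᶠ n in u, ∀ z ∈ γ, dist (h n z) z < δ) :
    ∃ (f : ι → ℂ → ℂ) (F : ℂ → ℂ), (∀ᶠ n in u,
      IsContinuumDomain (connectedComponentIn (h n '' γ)ᶜ z₀) (h n '' γ)) ∧
      (∀ᶠ n in u, IsDiskMap (f n) (connectedComponentIn (h n '' γ)ᶜ z₀)) ∧
      TendstoUniformlyOn f F u (closedBall 0 1) ∧ IsDiskMap F Ω := by
  obtain ⟨δ, hδ, R, hδR⟩ := hΩ.exists_forall_image hz₀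
  have hdom := (hh δ hδ).mono fun n hn => hδR (h n) (hc n) hn
  have hex : ∀ n, (∀ z ∈ γ, dist (h n z) z < δ) →
      ∃ f, IsDiskMap f (connectedComponentIn (h n '' γ)ᶜ z₀) ∧ f 0 = z₀ := fun n hn => by
    obtain ⟨h1, -, h3⟩ := hδR (h n) (hc n) hn
    exact h1.exists_isDiskMap (hγ.image hΩ.isCompact (hc n) (hi n)) h3
  choose! f hfD hf0 using hex
  have hf := (hh δ hδ).mono hfD
  have hf0' := (hh δ hδ).mono hf0
  have hlim : ∀ w ∈ closedBall (0 : ℂ) 1, ∃ y, Tendsto (fun n => f n w) u (𝓝 y) := by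
    intro w hw
    obtain ⟨y, -, hy⟩ := (isCompact_closedBall z₀ R).ultrafilter_le_nhds (u.map fun n => f n w) (by
      rw [le_principal_iff, Ultrafilter.mem_coe, Ultrafilter.mem_map]
      filter_upwards [hf, hdom] with n hn hn'
      have h1 : f n w ∈ closure (connectedComponentIn (h n '' γ)ᶜ z₀) :=
        hn.image_closedBall ▸ mem_image_of_mem _ hw
      exact closure_minimal (hn'.2.1.trans ball_subset_closedBall) isClosed_closedBall h1)
    exact ⟨y, hy⟩
  choose! F hF using hlim
  obtain ⟨d, hd, hdγ⟩ : ∃ d > 0, ∀ z ∈ γ, d ≤ dist z z₀ := by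
    obtain ⟨d, hd, hdK⟩ := Metric.isOpen_iff.1 hΩ.isCompact.isClosed.isOpen_compl z₀
      (hΩ.subset_compl hz₀)
    exact ⟨d, hd, fun z hz => not_lt.1 fun h => hdK (mem_ball.2 h) hz⟩
  have hunif : TendstoUniformlyOn f F u (closedBall 0 1) := by
    refine tendstoUniformlyOn_diskMap hf (hdom.mono fun n hn => hn.2.1) ?_ hF
    intro ε hε
    have hm : 0 < min (ε / 10) (d / 10) := by positivity
    obtain ⟨l, hl, hle, δ', hδ', hulc⟩ := hγ.exists_forall_image hm
    obtain ⟨a, ha, hadist⟩ := IsDiskMap.exists_dist_le z₀ R hl hle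
    refine ⟨a, ha, ?_⟩
    filter_upwards [hf, hdom, hf0', hh δ' hδ', hh (d / 2) (by positivity)] with n h1 h2 h3 h4 h5
      t ht w hw hwt
    have := hadist _ _ (f n) h2.1 h2.2.1 h1 h3 (by
      rintro _ ⟨q, hq, rfl⟩
      have h6 := dist_triangle_left q z₀ (h n q)
      rw [dist_comm z₀]
      linarith [hdγ q hq, h5 q hq, min_le_right (ε / 10) (d / 10)]) (hulc (h n) (hc n) h4) t ht w hw hwt
    linarith [min_le_left (ε / 10) (d / 10)]
  have hF0 : F 0 = z₀ := tendsto_nhds_unique (hF 0 (mem_closedBall_self zero_le_one))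
    (tendsto_const_nhds.congr' (hf0'.mono fun n hn => hn.symm))
  exact ⟨f, F, hdom.mono fun n hn => hn.1, hf, hunif,
    IsDiskMap.of_tendstoUniformlyOn hΩ hz₀ hh (hdom.mono fun n hn => hn.1) hf hF0 hunif⟩

lemma IsArcGraph.isPreconnected_preimage_edge {γ V : Set ℂ} {S : Set (Set ℂ)} {c : Set ℂ → ℝ → ℂ}
    (hG : IsArcGraph γ V S c) {E : ℝ → ℂ} {p b : ℝ} (hp : 0 < p) (hE : Continuous E)
    (hper : Function.Periodic E p) (hran : range E = γ)
    (hinj : ∀ x y, E x = E y → E x ∉ V → ∃ n : ℤ, y = x + n * p) (hb : E b ∈ V)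
    {e : Set ℂ} (he : e ∈ S) : IsPreconnected {x | x ∈ Ioo b (b + p) ∧ E x ∈ e} := by
  have heV : ∀ z ∈ e, z ∉ V := fun z hz => (hG.edge_subset he hz).2
  have hmem : ∀ t ∈ Ioo (0 : ℝ) 1, c e t ∈ e := fun t ht =>
    (hG.image_eq e he).subset (mem_image_of_mem _ ht)
  have hbp : E (b + p) ∈ V := by rwa [hper b]
  have hex : ∀ t ∈ Ioo (0 : ℝ) 1, ∃ x ∈ Ioo b (b + p), E x = c e t := by
    intro t ht
    obtain ⟨x, hx⟩ : c e t ∈ range E := hran ▸ (hG.edge_subset he (hmem t ht)).1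
    set k := toIcoDiv hp b x
    have hk : x - k * p ∈ Ico b (b + p) := by
      have := sub_toIcoDiv_zsmul_mem_Ico hp b x
      rwa [zsmul_eq_mul] at this
    have hEk : E (x - k * p) = c e t := by rw [← hx]; exact hper.sub_int_mul_eq k
    refine ⟨x - k * p, ⟨lt_of_le_of_ne hk.1 fun h => ?_, hk.2⟩, hEk⟩
    rw [← h] at hEk
    exact heV _ (hmem t ht) (hEk ▸ hb)
  have huniq : ∀ x ∈ Ioo b (b + p), ∀ y ∈ Ioo b (b + p), E x = E y → E x ∉ V → y = x := by
    intro x hx y hy hxy hxV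
    obtain ⟨n, hn⟩ := hinj x y hxy hxV
    have h1 : (n : ℝ) * p < 1 * p := by linarith [hx.1, hy.2]
    have h2 : (-1 : ℝ) * p < n * p := by linarith [hx.2, hy.1]
    have h3 : n < 1 := by exact_mod_cast lt_of_mul_lt_mul_right h1 hp.le
    have h4 : -1 < n := by exact_mod_cast lt_of_mul_lt_mul_right h2 hp.le
    have h5 : n = 0 := by omega
    rw [hn, h5]; simp
  choose! x hx hEx using hex
  have hxc : ContinuousOn x (Ioo 0 1) := by
    intro t ht
    rw [ContinuousWithinAt, tendsto_iff_ultrafilter]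
    intro u hu
    have huS : ∀ᶠ s in (u : Filter ℝ), s ∈ Ioo (0 : ℝ) 1 := hu self_mem_nhdsWithin
    obtain ⟨y, hy, hyl⟩ := (isCompact_Icc (a := b) (b := b + p)).ultrafilter_le_nhds (u.map x) (by
      rw [le_principal_iff, Ultrafilter.mem_coe, Ultrafilter.mem_map]
      filter_upwards [huS] with s hs using Ioo_subset_Icc_self (hx s hs))
    have hyt : Tendsto x u (𝓝 y) := hyl
    have hct : Tendsto (c e) u (𝓝 (c e t)) :=
      ((hG.continuousOn e he).mono Ioo_subset_Icc_self t ht).mono_left hu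
    have hEy : E y = c e t := by
      refine tendsto_nhds_unique ((hE.tendsto y).comp hyt) (hct.congr' ?_)
      filter_upwards [huS] with s hs using (hEx s hs).symm
    have hyV : E y ∉ V := by rw [hEy]; exact heV _ (hmem t ht)
    have hyI : y ∈ Ioo b (b + p) := by
      refine ⟨lt_of_le_of_ne hy.1 fun h => hyV (h ▸ hb), lt_of_le_of_ne hy.2 fun h => hyV ?_⟩
      rw [h]; exact hbp
    rw [huniq y hyI (x t) (hx t ht) (by rw [hEy, hEx t ht]) hyV]
    exact hyt
  have him : {x | x ∈ Ioo b (b + p) ∧ E x ∈ e} = x '' Ioo 0 1 := by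
    ext y
    constructor
    · rintro ⟨hy, hye⟩
      obtain ⟨t, ht, hty⟩ := (hG.image_eq e he).ge hye
      exact ⟨t, ht, huniq y hy (x t) (hx t ht) (by rw [hEx t ht, hty]) (heV _ hye)⟩
    · rintro ⟨t, ht, rfl⟩
      exact ⟨hx t ht, by rw [hEx t ht]; exact hmem t ht⟩
  rw [him]
  exact isPreconnected_Ioo.image x hxc

lemma Set.Finite.exists_pos_forall_le_abs_sub {A : Set ℝ} (hA : A.Finite) :
    ∃ g > 0, ∀ x ∈ A, ∀ y ∈ A, x ≠ y → g ≤ |x - y| := by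
  have hfin : ((fun q : ℝ × ℝ => q.1 - q.2) '' A.offDiag).Finite := hA.offDiag.image _
  obtain ⟨g, hg, hgA⟩ := Metric.isOpen_iff.1 hfin.isClosed.isOpen_compl 0 (by
    rintro ⟨⟨x, y⟩, h, h0⟩
    exact h.2.2 (sub_eq_zero.1 h0))
  refine ⟨g, hg, fun x hx y hy hxy => not_lt.1 fun h => hgA (a := x - y) ?_ ⟨(x, y), ⟨hx, hy, hxy⟩, rfl⟩⟩
  rwa [mem_ball_zero_iff, Real.norm_eq_abs]

lemma IsArcGraph.exists_gap {γ V : Set ℂ} {S : Set (Set ℂ)} {c : Set ℂ → ℝ → ℂ}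
    (hG : IsArcGraph γ V S c) {E : ℝ → ℂ} {p : ℝ} (hp : 0 < p) (hE : Continuous E)
    (hper : Function.Periodic E p) (hran : range E = γ)
    (hinj : ∀ x y, E x = E y → E x ∉ V → ∃ n : ℤ, y = x + n * p)
    (hdense : Dense {x | E x ∉ V}) :
    ∃ g > 0, ∀ x y, E x ∈ V → E y ∈ V → x ≠ y → g ≤ |x - y| := by
  by_cases hne : ∃ b, E b ∈ V
  swap
  · push Not at hne
    exact ⟨1, one_pos, fun x _ hx => absurd hx (hne x)⟩
  obtain ⟨b, hb⟩ := hne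
  have hfin : {x | x ∈ Ico b (b + p) ∧ E x ∈ V}.Finite := by
    by_contra hinf
    obtain ⟨A, hA, hAc⟩ := Set.Infinite.exists_subset_card_eq hinf (hG.edges_finite.toFinset.card + 2)
    set a := A.orderEmbOfFin hAc
    have ha : ∀ i, a i ∈ Ico b (b + p) ∧ E (a i) ∈ V := fun i => hA (A.orderEmbOfFin_mem hAc i)
    have hmid : ∀ i : Fin (hG.edges_finite.toFinset.card + 1), ∃ x ∈ Ioo (a i.castSucc) (a i.succ),
        E x ∉ V := fun i => by
      obtain ⟨x, hx, hx'⟩ := hdense.exists_between (a.strictMono i.castSucc_lt_succ)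
      exact ⟨x, hx', hx⟩
    choose x hx hxV using hmid
    have hedge : ∀ i, ∃ e ∈ S, E (x i) ∈ e := fun i => by
      have : E (x i) ∈ γ \ V := ⟨hran ▸ mem_range_self _, hxV i⟩
      rw [hG.diff_eq] at this
      exact this
    choose e he hxe using hedge
    obtain ⟨i, -, j, -, hij, heq⟩ := Finset.exists_ne_map_eq_of_card_lt_of_maps_to
      (s := Finset.univ) (t := hG.edges_finite.toFinset) (f := e) (by simp)
      (fun i _ => by simpa using he i)
    have key : ∀ i j, i < j → e i = e j → False := by
      intro i j hij heq
      have hpre := (hG.isPreconnected_preimage_edge hp hE hper hran hinj hb (he i)).ordConnected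
      have hI : ∀ i, x i ∈ Ioo b (b + p) := fun i =>
        ⟨(ha _).1.1.trans_lt (hx i).1, (hx i).2.trans (ha _).1.2⟩
      have := hpre.out (x := x i) ⟨hI i, hxe i⟩ (y := x j) ⟨hI j, heq ▸ hxe j⟩
        (show a j.castSucc ∈ Icc (x i) (x j) from
          ⟨(hx i).2.le.trans (a.monotone (Fin.succ_le_castSucc_iff.2 hij)), (hx j).1.le⟩)
      exact (hG.edge_subset (he i) this.2).2 (ha _).2
    rcases lt_or_gt_of_ne hij with h | h
    exacts [key i j h heq, key j i h heq.symm]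
  obtain ⟨g, hg, hgA⟩ := (hfin.union (hfin.image (· + p))).exists_pos_forall_le_abs_sub
  refine ⟨min g p, lt_min hg hp, ?_⟩
  have key : ∀ x y, E x ∈ V → E y ∈ V → x < y → min g p ≤ y - x := by
    intro x y hx hy hxy
    by_contra hcon
    push Not at hcon
    set k := toIcoDiv hp b x
    have hk : x - k * p ∈ Ico b (b + p) := by
      have := sub_toIcoDiv_zsmul_mem_Ico hp b x
      rwa [zsmul_eq_mul] at this
    have hEk : ∀ z, E (z - k * p) = E z := fun z => hper.sub_int_mul_eq k
    have hyx : y - x < p := hcon.trans_le (min_le_right _ _)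
    have h1 := hgA (y - k * p) ?_ (x - k * p) (Or.inl ⟨hk, by rwa [hEk]⟩) (by linarith)
    · rw [sub_sub_sub_cancel_right, abs_of_pos (by linarith)] at h1
      linarith [min_le_left g p]
    · by_cases h : y - k * p < b + p
      · exact Or.inl ⟨⟨by linarith [hk.1], h⟩, by rwa [hEk]⟩
      · refine Or.inr ⟨y - k * p - p, ⟨⟨by linarith, by linarith [hk.2]⟩, ?_⟩, by simp⟩
        rw [hper.sub_eq, hEk]; exact hy
  intro x y hx hy hxy
  rcases lt_or_gt_of_ne hxy with h | h
  · rw [abs_sub_comm, abs_of_pos (by linarith)]; exact key x y hx hy h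
  · rw [abs_of_pos (by linarith)]; exact key y x hy hx h

lemma isPreconnected_unitSphere : IsPreconnected (sphere (0 : ℂ) 1) :=
  isPreconnected_sphere (by rw [Complex.rank_real_complex]; norm_num) 0 1

lemma isPreconnected_unitSphere_diff_singleton {a : ℂ} (ha : a ∈ sphere (0 : ℂ) 1) :
    IsPreconnected (sphere (0 : ℂ) 1 \ {a}) := by
  have han : ‖a‖ = 1 := mem_sphere_zero_iff_norm.1 ha
  have ha0 : a ≠ 0 := by rintro rfl; simp at han
  have : sphere (0 : ℂ) 1 \ {a} =
      (fun t : ℝ => a * Complex.exp ((2 * Real.pi * t : ℝ) * Complex.I)) '' Ioo 0 1 := by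
    ext w
    constructor
    · rintro ⟨hw, hwa⟩
      rw [mem_sphere_zero_iff_norm] at hw
      obtain ⟨t, ht, htw⟩ := exists_exp_two_pi_mul_I_eq (u := w / a) (by rw [norm_div, hw, han, div_one])
      have hw' : a * Complex.exp ((2 * Real.pi * t : ℝ) * Complex.I) = w := by
        rw [htw]; field_simp
      refine ⟨t, ⟨lt_of_le_of_ne ht.1 ?_, ht.2⟩, hw'⟩
      rintro rfl
      exact hwa (by rw [mem_singleton_iff, ← hw']; simp)
    · rintro ⟨t, ht, rfl⟩
      refine ⟨?_, fun h => ?_⟩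
      · rw [mem_sphere_zero_iff_norm, norm_mul, han, Complex.norm_exp_ofReal_mul_I, one_mul]
      · rw [mem_singleton_iff, mul_eq_left₀ ha0] at h
        have := injOn_exp_two_pi_mul_I (Ioo_subset_Ico_self ht) (left_mem_Ico.2 one_pos)
          (by dsimp only; rw [h]; simp)
        exact ht.1.ne' this
  rw [this]
  exact isPreconnected_Ioo.image _ (by fun_prop)

lemma hasLogOn_unitSphere_diff_singleton {a : ℂ} (ha : ‖a‖ = 1) :
    HasLogOn (fun z => z) (sphere (0 : ℂ) 1 \ {a}) := by
  have ha0 : a ≠ 0 := by rintro rfl; simp at ha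
  have hslit : ∀ z ∈ sphere (0 : ℂ) 1 \ {a}, -z / a ∈ Complex.slitPlane := by
    rintro z ⟨hz, hza⟩
    rw [mem_sphere_zero_iff_norm] at hz
    by_contra hcon
    rw [Complex.mem_slitPlane_iff, not_or, not_lt, not_not] at hcon
    have h1 : (-z / a).re = -1 := by
      have h2 : ‖-z / a‖ = 1 := by rw [norm_div, norm_neg, hz, ha, div_one]
      rw [← Complex.re_add_im (-z / a), hcon.2] at h2
      simp only [Complex.ofReal_zero, zero_mul, add_zero, Complex.norm_real, Real.norm_eq_abs] at h2
      rw [abs_of_nonpos hcon.1] at h2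
      linarith
    have h3 : -z / a = -1 := Complex.ext (by simpa using h1) (by simpa using hcon.2)
    rw [div_eq_iff ha0] at h3
    exact hza (by simpa using h3)
  refine ⟨fun z => Complex.log (-z / a) + Complex.log (-a), ?_, ?_⟩
  · exact (ContinuousOn.clog (by fun_prop) hslit).add continuousOn_const
  · intro z hz
    rw [Complex.exp_add, Complex.exp_log (Complex.slitPlane_ne_zero (hslit z hz)),
      Complex.exp_log (neg_ne_zero.2 ha0)]
    field_simp

/-- A self-map of the circle that is injective over the complement of `1` and surjective there has
no continuous logarithm. -/
lemma not_hasLogOn_of_injOn_compl {φ : ℂ → ℂ} (hn : ∀ w ∈ sphere (0 : ℂ) 1, ‖φ w‖ = 1)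
    (hinj : ∀ a ∈ sphere (0 : ℂ) 1, ∀ b ∈ sphere (0 : ℂ) 1, φ a = φ b → φ a ≠ 1 → a = b)
    (hsurj : ∀ u : ℂ, ‖u‖ = 1 → u ≠ 1 → ∃ w ∈ sphere (0 : ℂ) 1, φ w = u) :
    ¬ HasLogOn φ (sphere 0 1) := by
  rintro ⟨L, hL, hexp⟩
  have hre : ∀ w ∈ sphere (0 : ℂ) 1, (L w).re = 0 := fun w hw => by
    have := hn w hw
    rwa [← hexp w hw, Complex.norm_exp, Real.exp_eq_one_iff] at this
  set μ : ℂ → ℝ := fun w => (L w).im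
  have hμ : ContinuousOn μ (sphere 0 1) := Complex.continuous_im.comp_continuousOn hL
  have hφμ : ∀ w ∈ sphere (0 : ℂ) 1, φ w = Complex.exp (μ w * Complex.I) := fun w hw => by
    rw [← hexp w hw]; congr 1
    exact Complex.ext (by simp [hre w hw]) (by simp [μ])
  have hdiff : ∃ a ∈ sphere (0 : ℂ) 1, ∃ b ∈ sphere (0 : ℂ) 1, μ a < μ b := by
    obtain ⟨a, ha, hau⟩ := hsurj (-1) (by simp) (by norm_num)
    obtain ⟨b, hb, hbu⟩ := hsurj Complex.I (by simp) (by
      intro h; have := congrArg Complex.re h; simp at this)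
    have hne : μ a ≠ μ b := by
      intro h
      have h2 : φ a = φ b := by rw [hφμ a ha, hφμ b hb, h]
      rw [hau, hbu] at h2
      have := congrArg Complex.re h2; simp at this
    rcases lt_or_gt_of_ne hne with h | h
    exacts [⟨a, ha, b, hb, h⟩, ⟨b, hb, a, ha, h⟩]
  obtain ⟨a, ha, b, hb, hab⟩ := hdiff
  obtain ⟨y, hy, hyab⟩ := ((countable_range fun n : ℤ => (n : ℝ) * (2 * Real.pi)).dense_compl ℝ).exists_between hab
  have hy1 : Complex.exp (y * Complex.I) ≠ 1 := by
    intro h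
    obtain ⟨n, hn⟩ := Complex.exp_eq_one_iff.1 h
    refine hy ⟨n, ?_⟩
    have := congrArg Complex.im hn
    simp at this
    exact this.symm
  obtain ⟨w₀, hw₀, hw₀y⟩ := isPreconnected_unitSphere.intermediate_value ha hb hμ ⟨hyab.1.le, hyab.2.le⟩
  obtain ⟨w₁, hw₁, hw₁y⟩ := (isPreconnected_unitSphere_diff_singleton hw₀).intermediate_value
    (show a ∈ _ from ⟨ha, fun h => by rw [mem_singleton_iff.1 h] at hyab; exact hyab.1.ne hw₀y⟩)
    (show b ∈ _ from ⟨hb, fun h => by rw [mem_singleton_iff.1 h] at hyab; exact hyab.2.ne' hw₀y⟩)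
    (hμ.mono sdiff_subset) ⟨hyab.1.le, hyab.2.le⟩
  refine hw₁.2 (hinj w₁ hw₁.1 w₀ hw₀ ?_ ?_)
  · rw [hφμ w₁ hw₁.1, hφμ w₀ hw₀, hw₁y, hw₀y]
  · rw [hφμ w₁ hw₁.1, hw₁y]; exact hy1

lemma IsArcGraph.exists_forall_edge_subset_image {γ V : Set ℂ} {S : Set (Set ℂ)}
    {c : Set ℂ → ℝ → ℂ} (hG : IsArcGraph γ V S c) {F : ℂ → ℂ}
    (hF : ContinuousOn F (sphere 0 1)) (him : F '' sphere 0 1 = γ)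
    (hinj : ∀ a ∈ sphere (0 : ℂ) 1, ∀ b ∈ sphere (0 : ℂ) 1, F a = F b → F a ∉ V → a = b)
    {e : Set ℂ} (he : e ∈ S) :
    ∃ τ > 0, ∀ G : ℂ → ℂ, ContinuousOn G (sphere 0 1) → MapsTo G (sphere 0 1) γ →
      (∀ w ∈ sphere (0 : ℂ) 1, dist (G w) (F w) < τ) → e ⊆ G '' sphere 0 1 := by
  obtain ⟨π, hπc, hπn, hπ1, hπe, hπi, hπs⟩ := hG.exists_circle_map he
  obtain ⟨τ, hτ, hτ'⟩ := Metric.uniformContinuousOn_iff.1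
    (hG.isCompact.uniformContinuousOn_of_continuous hπc) 1 one_pos
  have hFγ : ∀ w ∈ sphere (0 : ℂ) 1, F w ∈ γ := fun w hw => him ▸ mem_image_of_mem F hw
  refine ⟨τ, hτ, fun G hGc hGγ hGF q hq => ?_⟩
  by_contra hcon
  have hmemE : ∀ z ∈ γ, π z ≠ 1 → z ∈ e := fun z hz h => by
    by_contra hze
    exact h (hπ1 z ⟨hz, hze⟩)
  have hqγ : q ∈ γ := (hG.edge_subset he hq).1
  have hlogG : HasLogOn (fun w => π (G w)) (sphere 0 1) := by
    refine (hasLogOn_unitSphere_diff_singleton (hπn q hqγ)).comp (hπc.comp hGc hGγ) ?_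
    intro w hw
    refine ⟨mem_sphere_zero_iff_norm.2 (hπn _ (hGγ hw)), fun h => hcon ⟨w, hw, ?_⟩⟩
    have h' : π (G w) = π q := h
    exact hπi (hmemE _ (hGγ hw) (h' ▸ hπe q hq)) hq h'
  refine not_hasLogOn_of_injOn_compl (φ := fun w => π (F w)) (fun w hw => hπn _ (hFγ w hw)) ?_ ?_
    (hlogG.of_norm_sub_lt (hπc.comp hGc hGγ) (hπc.comp hF hFγ) fun w hw => ?_)
  · intro a ha b hb hab h1
    have h2 := hmemE _ (hFγ a ha) h1
    exact hinj a ha b hb (hπi h2 (hmemE _ (hFγ b hb) (by rw [← hab]; exact h1)) hab)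
      (hG.edge_subset he h2).2
  · intro u hu hu1
    obtain ⟨z, hz, hzu⟩ := hπs u hu hu1
    obtain ⟨w, hw, hwz⟩ := him.ge (hG.edge_subset he hz).1
    exact ⟨w, hw, by rw [hwz, hzu]⟩
  · have h1 := hτ' _ (hFγ w hw) _ (hGγ hw) (by rw [dist_comm]; exact hGF w hw)
    rw [dist_eq_norm] at h1
    change ‖π (F w) - π (G w)‖ < ‖π (G w)‖
    rw [hπn _ (hGγ hw)]
    exact h1

lemma IsArcGraph.exists_forall_image_eq {γ V : Set ℂ} {S : Set (Set ℂ)}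
    {c : Set ℂ → ℝ → ℂ} (hG : IsArcGraph γ V S c) {F : ℂ → ℂ}
    (hF : ContinuousOn F (sphere 0 1)) (him : F '' sphere 0 1 = γ)
    (hinj : ∀ a ∈ sphere (0 : ℂ) 1, ∀ b ∈ sphere (0 : ℂ) 1, F a = F b → F a ∉ V → a = b)
    (hdense : γ ⊆ closure (γ \ V)) :
    ∃ τ > 0, ∀ G : ℂ → ℂ, ContinuousOn G (sphere 0 1) → MapsTo G (sphere 0 1) γ →
      (∀ w ∈ sphere (0 : ℂ) 1, dist (G w) (F w) < τ) → G '' sphere 0 1 = γ := by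
  have hex := fun e he => hG.exists_forall_edge_subset_image hF him hinj (e := e) he
  choose! τ hτ hτ' using hex
  obtain ⟨t, ht, htS⟩ : ∃ t > 0, ∀ e ∈ S, t ≤ τ e := by
    have hfin := hG.edges_finite.image τ
    obtain ⟨t, ht, hts⟩ := Metric.isOpen_iff.1 hfin.isClosed.isOpen_compl 0 (by
      rintro ⟨e, he, h0⟩
      exact (hτ e he).ne' h0)
    refine ⟨t, ht, fun e he => not_lt.1 fun h => hts (a := τ e) ?_ (mem_image_of_mem τ he)⟩
    rwa [mem_ball_zero_iff, Real.norm_eq_abs, abs_of_pos (hτ e he)]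
  refine ⟨t, ht, fun G hGc hGγ hGF => subset_antisymm hGγ.image_subset (hdense.trans ?_)⟩
  refine closure_minimal ?_ ((isCompact_sphere 0 1).image_of_continuousOn hGc).isClosed
  rw [hG.diff_eq]
  exact sUnion_subset fun e he => hτ' e he G hGc hGγ fun w hw => (hGF w hw).trans_le (htS e he)

lemma circleExp_mem_sphere (x : ℝ) : (Circle.exp x : ℂ) ∈ sphere (0 : ℂ) 1 :=
  mem_sphere_zero_iff_norm.2 (Circle.norm_coe _)

lemma exists_circleExp_eq {w : ℂ} (hw : w ∈ sphere (0 : ℂ) 1) : ∃ x : ℝ, (Circle.exp x : ℂ) = w := by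
  obtain ⟨x, hx⟩ := Circle.exp_surjective ⟨w, hw⟩
  exact ⟨x, by rw [hx]⟩

lemma continuous_comp_circleExp {f : ℂ → ℂ} (hf : ContinuousOn f (sphere 0 1)) :
    Continuous fun x : ℝ => f (Circle.exp x) :=
  hf.comp_continuous (continuous_subtype_val.comp Circle.exp.continuous) circleExp_mem_sphere

lemma periodic_comp_circleExp (f : ℂ → ℂ) :
    Function.Periodic (fun x : ℝ => f (Circle.exp x)) (2 * Real.pi) := fun x => by
  simp only [Circle.exp_add_two_pi]

lemma range_comp_circleExp (f : ℂ → ℂ) :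
    range (fun x : ℝ => f (Circle.exp x)) = f '' sphere 0 1 := by
  ext z
  constructor
  · rintro ⟨x, rfl⟩
    exact ⟨_, circleExp_mem_sphere x, rfl⟩
  · rintro ⟨w, hw, rfl⟩
    obtain ⟨x, rfl⟩ := exists_circleExp_eq hw
    exact ⟨x, rfl⟩

lemma eq_add_int_mul_of_comp_circleExp {f : ℂ → ℂ} {W : Set ℂ}
    (hinj : ∀ a ∈ sphere (0 : ℂ) 1, ∀ b ∈ sphere (0 : ℂ) 1, f a = f b → f a ∉ W → a = b)
    (x y : ℝ) (hxy : f (Circle.exp x) = f (Circle.exp y)) (hx : f (Circle.exp x) ∉ W) :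
    ∃ n : ℤ, y = x + n * (2 * Real.pi) :=
  Circle.exp_eq_exp.1 (Subtype.ext
    (hinj _ (circleExp_mem_sphere x) _ (circleExp_mem_sphere y) hxy hx)).symm

lemma IsDiskMap.eq_of_map_eq {f : ℂ → ℂ} {D W : Set ℂ} (h : IsDiskMap f D)
    (hW : ∀ q ∈ frontier D \ W, IsPreconnected (frontier D \ {q})) :
    ∀ a ∈ sphere (0 : ℂ) 1, ∀ b ∈ sphere (0 : ℂ) 1, f a = f b → f a ∉ W → a = b := by
  intro a ha b hb hab haW
  by_contra hne
  exact h.not_isPreconnected ha hb hne hab (hW _ ⟨h.image_sphere.le ⟨a, ha, rfl⟩, haW⟩)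

lemma IsDiskMap.dense_notMem {f : ℂ → ℂ} {D W : Set ℂ} (h : IsDiskMap f D) (hW : W.Finite) :
    Dense {x : ℝ | f (Circle.exp x) ∉ W} := by
  rw [dense_iff_inter_open]
  rintro A hA ⟨x, hx⟩
  obtain ⟨O, hO, hOA⟩ := isOpen_induced_iff.1
    (isLocalHomeomorph_circleExp.isOpenMap A hA)
  obtain ⟨w, ⟨hwO, hw⟩, hwW⟩ := h.exists_notMem_of_isOpen hW hO
    ⟨Circle.exp x, hOA.ge ⟨x, hx, rfl⟩, circleExp_mem_sphere x⟩
  obtain ⟨y, rfl⟩ := exists_circleExp_eq hw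
  obtain ⟨y', hy', hyy⟩ := hOA.le (show Circle.exp y ∈ _ from hwO)
  exact ⟨y', hy', by simpa only [mem_ofPred_eq, hyy] using hwW⟩

lemma IsDiskMap.frontier_subset_closure_diff {f : ℂ → ℂ} {D W : Set ℂ} (h : IsDiskMap f D)
    (hW : W.Finite) : frontier D ⊆ closure (frontier D \ W) := by
  have hc := continuous_comp_circleExp (h.continuousOn.mono sphere_subset_closedBall)
  rw [← h.image_sphere, ← range_comp_circleExp]
  rintro _ ⟨x, rfl⟩
  exact map_mem_closure (f := fun x : ℝ => f (Circle.exp x)) hc ((h.dense_notMem hW) x) fun y hy => ⟨⟨y, rfl⟩, hy⟩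

lemma IsContinuumDomain.exists_boundary_lift {ι : Type*} (u : Ultrafilter ι) {h : ι → ℂ → ℂ}
    {Ω V : Set ℂ} {S : Set (Set ℂ)} {c : Set ℂ → ℝ → ℂ} {z₀ : ℂ}
    (hΩ : IsContinuumDomain Ω (frontier Ω)) (hz₀ : z₀ ∈ Ω) (hG : IsArcGraph (frontier Ω) V S c)
    (hbr : ∀ q ∈ frontier Ω \ V, IsPreconnected (frontier Ω \ {q}))
    (hc : ∀ n, ContinuousOn (h n) (frontier Ω)) (hi : ∀ n, InjOn (h n) (frontier Ω))
    (hh : ∀ δ > 0, ∀ᶠ n in u, ∀ z ∈ frontier Ω, dist (h n z) z < δ) :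
    ∃ (f : ι → ℂ → ℂ) (F : ℂ → ℂ),
      (∀ᶠ n in u, IsDiskMap (f n) (connectedComponentIn (h n '' frontier Ω)ᶜ z₀)) ∧
      TendstoUniformlyOn f F u (closedBall 0 1) ∧ IsDiskMap F Ω ∧
      ∀ r > 0, ∀ᶠ n in u, ∃ Θ : ℝ → ℝ, Continuous Θ ∧ StrictMono Θ ∧
        (∀ x, Θ (x + 2 * Real.pi) = Θ x + 2 * Real.pi) ∧ (∀ x, |Θ x - x| ≤ r) ∧
        ∀ x, f n (Circle.exp (Θ x)) = h n (F (Circle.exp x)) := by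
  obtain ⟨f, F, hD, hf, hfF, hF⟩ := hΩ.exists_tendstoUniformlyOn_diskMap u hz₀
    hG.isUniformlyLocallyConnected hc hi hh
  refine ⟨f, F, hf, hfF, hF, fun r hr => ?_⟩
  have hVf : V.Finite := hG.vertex_finite
  have hFc := hF.continuousOn.mono sphere_subset_closedBall
  have hFinj := hF.eq_of_map_eq hbr
  obtain ⟨τ₁, hτ₁, hsurj⟩ := hG.exists_forall_image_eq hFc hF.image_sphere hFinj
    (hF.frontier_subset_closure_diff hVf)
  obtain ⟨g, hg, hgap⟩ := hG.exists_gap (E := fun x : ℝ => F (Circle.exp x)) Real.two_pi_pos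
    (continuous_comp_circleExp hFc) (periodic_comp_circleExp F)
    ((range_comp_circleExp F).trans hF.image_sphere) (eq_add_int_mul_of_comp_circleExp hFinj)
    (hF.dense_notMem hVf)
  obtain ⟨τ₂, hτ₂, hlift⟩ := exists_strictMono_lift (E := fun x : ℝ => F (Circle.exp x))
    Real.two_pi_pos (continuous_comp_circleExp hFc) (periodic_comp_circleExp F) hg hgap
    (eq_add_int_mul_of_comp_circleExp hFinj) hVf hr
  have hτ : 0 < min τ₁ τ₂ / 2 := half_pos (lt_min hτ₁ hτ₂)
  filter_upwards [hD, hf, hh _ hτ, Metric.tendstoUniformlyOn_iff.1 hfF _ hτ] with n hDn hfn hhn hfFn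
  set γ := frontier Ω with hγ
  set k := Function.invFunOn (h n) γ with hk
  have hkh : ∀ z ∈ γ, k (h n z) = z := fun z hz => (hi n).leftInvOn_invFunOn hz
  have hhk : ∀ y ∈ h n '' γ, h n (k y) = y := fun y hy => Function.invFunOn_eq hy
  have hkγ : ∀ y ∈ h n '' γ, k y ∈ γ := fun y hy => Function.invFunOn_mem hy
  have hfs : ∀ w ∈ sphere (0 : ℂ) 1, f n w ∈ h n '' γ := fun w hw =>
    hDn.frontier_subset (hfn.image_sphere.le ⟨w, hw, rfl⟩)
  have hfc := hfn.continuousOn.mono sphere_subset_closedBall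
  have hGc : ContinuousOn (fun w => k (f n w)) (sphere 0 1) :=
    (continuousOn_invFunOn_image hΩ.isCompact (hc n) (hi n)).comp hfc hfs
  have hdist : ∀ w ∈ sphere (0 : ℂ) 1, dist (k (f n w)) (F w) < min τ₁ τ₂ := fun w hw => by
    have h1 := hhn _ (hkγ _ (hfs w hw))
    rw [hhk _ (hfs w hw)] at h1
    have h2 := hfFn w (sphere_subset_closedBall hw)
    rw [dist_comm] at h1 h2
    linarith [dist_triangle (k (f n w)) (f n w) (F w)]
  have him := hsurj _ hGc (fun w hw => hkγ _ (hfs w hw))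
    fun w hw => (hdist w hw).trans_le (min_le_left _ _)
  have hfr : frontier (connectedComponentIn (h n '' γ)ᶜ z₀) = h n '' γ := by
    refine Subset.antisymm hDn.frontier_subset ?_
    rintro _ ⟨z, hz, rfl⟩
    obtain ⟨w, hw, hwz⟩ := him.ge hz
    rw [← hfn.image_sphere]
    refine ⟨w, hw, ?_⟩
    simp only at hwz
    rw [← hwz, hhk _ (hfs w hw)]
  have hWbr : ∀ q ∈ frontier (connectedComponentIn (h n '' γ)ᶜ z₀) \ h n '' V,
      IsPreconnected (frontier (connectedComponentIn (h n '' γ)ᶜ z₀) \ {q}) := by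
    rw [hfr]
    rintro _ ⟨⟨q, hq, rfl⟩, hqV⟩
    have : h n '' γ \ {h n q} = h n '' (γ \ {q}) := by
      rw [(hi n).image_sdiff_subset (singleton_subset_iff.2 hq), image_singleton]
    rw [this]
    exact (hbr q ⟨hq, fun h => hqV ⟨q, h, rfl⟩⟩).image _ ((hc n).mono sdiff_subset)
  have hkV : ∀ y ∈ h n '' γ, k y ∉ V → y ∉ h n '' V := by
    rintro _ hy hV ⟨v, hv, rfl⟩
    exact hV (by rwa [hkh v (hG.vertex_subset hv)])
  have hGinj : ∀ a ∈ sphere (0 : ℂ) 1, ∀ b ∈ sphere (0 : ℂ) 1,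
      k (f n a) = k (f n b) → k (f n a) ∉ V → a = b := by
    intro a ha b hb hab haV
    refine hfn.eq_of_map_eq hWbr a ha b hb ?_ (hkV _ (hfs a ha) haV)
    rw [← hhk _ (hfs a ha), hab, hhk _ (hfs b hb)]
  have hGdense : Dense {x : ℝ | k (f n (Circle.exp x)) ∉ V} := by
    refine (hfn.dense_notMem (hVf.image (h n))).mono fun x hx => ?_
    rw [mem_ofPred_eq] at hx ⊢
    exact fun hV => hx ⟨_, hV, hhk _ (hfs _ (circleExp_mem_sphere x))⟩
  obtain ⟨Θ, h1, h2, h3, h4, h5⟩ := hlift (fun x => k (f n (Circle.exp x)))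
    (continuous_comp_circleExp hGc) (periodic_comp_circleExp fun w => k (f n w))
    (fun x => (hdist _ (circleExp_mem_sphere x)).trans_le (min_le_right _ _))
    (by rw [range_comp_circleExp fun w => k (f n w), range_comp_circleExp F, him, hF.image_sphere])
    (eq_add_int_mul_of_comp_circleExp (f := fun w => k (f n w)) hGinj)
    hGdense
  refine ⟨Θ, h1, h2, h3, h4, fun x => ?_⟩
  rw [← h5 x, hhk _ (hfs _ (circleExp_mem_sphere _))]

lemma exists_homeomorph_add {P : ℂ → ℂ} (hP : LipschitzWith (1 / 2) P) :
    ∃ A : ℂ ≃ₜ ℂ, ∀ w, A w = w + P w := by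
  have h : ApproximatesLinearOn (fun w => w + P w)
      ((ContinuousLinearEquiv.refl ℝ ℂ : ℂ ≃L[ℝ] ℂ) : ℂ →L[ℝ] ℂ) univ (1 / 2) := by
    intro a _ b _
    have h1 : a + P a - (b + P b) - (a - b) = P a - P b := by ring
    change ‖a + P a - (b + P b) - (a - b)‖ ≤ _
    rw [h1]
    exact hP.norm_sub_le a b
  refine ⟨h.toHomeomorph _ (Or.inr ?_), fun w => rfl⟩
  have h1 : ‖((ContinuousLinearEquiv.refl ℝ ℂ).symm : ℂ →L[ℝ] ℂ)‖₊ = 1 := by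
    rw [← NNReal.coe_inj]
    simp
  rw [h1]
  norm_num

lemma exists_homeomorph_of_near_id {ρ ρ' σ : ℝ} (h1 : ρ < ρ') (h2 : ρ' < σ) :
    ∃ κ₀ > 0, ∀ κ ≤ κ₀, ∀ g : ℂ → ℂ, DifferentiableOn ℂ g (ball 0 σ) →
      (∀ w ∈ ball (0 : ℂ) σ, ‖g w - w‖ ≤ κ) → 0 ≤ κ →
      ∃ A : ℂ ≃ₜ ℂ, (∀ w, ‖w‖ ≤ ρ → A w = g w) ∧ (∀ w, ρ' ≤ ‖w‖ → A w = w) ∧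
        ∀ w, ‖A w - w‖ ≤ κ := by
  set m := σ - ρ' with hm
  set q := ρ' - ρ with hq
  have hm0 : 0 < m := sub_pos.2 h2
  have hq0 : 0 < q := sub_pos.2 h1
  refine ⟨1 / (2 * (2 / m + 1 / q)), by positivity, fun κ hκ g hg hgκ hκ0 => ?_⟩
  have hκ' : κ * (2 / m + 1 / q) ≤ 1 / 2 := by
    rw [le_div_iff₀ (by positivity)] at hκ
    linarith
  set e : ℂ → ℂ := fun w => g w - w with he
  have hed : DifferentiableOn ℂ e (ball 0 σ) := hg.sub differentiableOn_id
  have hsub : closedBall (0 : ℂ) ρ' ⊆ ball 0 σ := closedBall_subset_ball h2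
  have hderiv : ∀ w ∈ closedBall (0 : ℂ) ρ', ‖deriv e w‖ ≤ κ * (2 / m) := by
    intro w hw
    have hw' : ‖w‖ ≤ ρ' := mem_closedBall_zero_iff.1 hw
    have hs : closedBall w (m / 2) ⊆ ball 0 σ := by
      intro z hz
      rw [mem_closedBall, dist_eq_norm] at hz
      rw [mem_ball_zero_iff]
      have := norm_add_le (z - w) w
      rw [sub_add_cancel] at this
      linarith
    have := Complex.norm_deriv_le_of_forall_mem_sphere_norm_le (f := e) (C := κ) (half_pos hm0)
      (hed.mono hs |>.diffContOnCl_ball subset_rfl)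
      fun z hz => hgκ z (hs (sphere_subset_closedBall hz))
    convert this using 1
    field_simp
  have hlip : ∀ a ∈ closedBall (0 : ℂ) ρ', ∀ b ∈ closedBall (0 : ℂ) ρ',
      ‖e b - e a‖ ≤ κ * (2 / m) * ‖b - a‖ := fun a ha b hb =>
    Convex.norm_image_sub_le_of_norm_deriv_le
      (fun x hx => hed.differentiableAt (isOpen_ball.mem_nhds (hsub hx))) hderiv
      (convex_closedBall _ _) ha hb
  set χ : ℂ → ℝ := fun w => max 0 (min 1 ((ρ' - ‖w‖) / q)) with hχ
  have hχ0 : ∀ w, 0 ≤ χ w := fun w => le_max_left _ _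
  have hχ1 : ∀ w, χ w ≤ 1 := fun w => max_le zero_le_one (min_le_left _ _)
  have hχz : ∀ w, ρ' ≤ ‖w‖ → χ w = 0 := fun w hw => by
    refine max_eq_left ((min_le_right _ _).trans ?_)
    exact div_nonpos_of_nonpos_of_nonneg (by linarith) hq0.le
  have hχo : ∀ w, ‖w‖ ≤ ρ → χ w = 1 := fun w hw => by
    have : 1 ≤ (ρ' - ‖w‖) / q := by rw [le_div_iff₀ hq0]; linarith
    simp only [hχ]
    rw [min_eq_left this, max_eq_right zero_le_one]
  have hχl : ∀ a b, |χ a - χ b| ≤ 1 / q * ‖a - b‖ := fun a b => by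
    calc |χ a - χ b| ≤ |min 1 ((ρ' - ‖a‖) / q) - min 1 ((ρ' - ‖b‖) / q)| := by
          simpa using abs_max_sub_max_le_max 0 (min 1 ((ρ' - ‖a‖) / q)) 0 (min 1 ((ρ' - ‖b‖) / q))
      _ ≤ |(ρ' - ‖a‖) / q - (ρ' - ‖b‖) / q| := by
          simpa using abs_min_sub_min_le_max 1 ((ρ' - ‖a‖) / q) 1 ((ρ' - ‖b‖) / q)
      _ = 1 / q * |‖b‖ - ‖a‖| := by
          rw [← sub_div, abs_div, abs_of_pos hq0]
          ring_nf
      _ ≤ 1 / q * ‖a - b‖ := by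
          gcongr
          rw [norm_sub_rev]
          exact abs_norm_sub_norm_le b a
  set P : ℂ → ℂ := fun w => χ w * e w with hPdef
  have hPz : ∀ w, ρ' ≤ ‖w‖ → P w = 0 := fun w hw => by simp [hPdef, hχz w hw]
  have hPκ : ∀ w, ‖P w‖ ≤ κ := fun w => by
    rcases le_total ρ' ‖w‖ with h | h
    · rwa [hPz w h, norm_zero]
    · rw [hPdef, norm_mul, Complex.norm_real, Real.norm_of_nonneg (hχ0 w)]
      calc χ w * ‖e w‖ ≤ 1 * κ := by
            gcongr
            · exact hχ1 w
            · exact hgκ w (hsub (mem_closedBall_zero_iff.2 h))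
        _ = κ := one_mul _
  have hkey : ∀ a b, ‖b‖ ≤ ρ' → ‖P a - P b‖ ≤ 1 / 2 * ‖a - b‖ := fun a b hb => by
    have hbm := mem_closedBall_zero_iff.2 hb
    have heb : ‖e b‖ ≤ κ := hgκ b (hsub hbm)
    rcases le_total ρ' ‖a‖ with ha | ha
    · have : P a - P b = ((χ a - χ b : ℝ) : ℂ) * e b := by
        rw [hPz a ha, hχz a ha]; simp [hPdef]
      rw [this, norm_mul, Complex.norm_real, Real.norm_eq_abs]
      calc _ ≤ (1 / q * ‖a - b‖) * κ := by gcongr; exact hχl a b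
        _ = κ * (1 / q) * ‖a - b‖ := by ring
        _ ≤ 1 / 2 * ‖a - b‖ := by
          gcongr
          refine le_trans ?_ hκ'
          gcongr
          exact le_add_of_nonneg_left (by positivity)
    · have : P a - P b = ((χ a - χ b : ℝ) : ℂ) * e b + χ a * (e a - e b) := by
        simp only [hPdef]; push_cast; ring
      rw [this]
      refine (norm_add_le _ _).trans ?_
      rw [norm_mul, norm_mul, Complex.norm_real, Real.norm_eq_abs, Complex.norm_real,
        Real.norm_of_nonneg (hχ0 a)]
      calc _ ≤ (1 / q * ‖a - b‖) * κ + 1 * (κ * (2 / m) * ‖a - b‖) := by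
            gcongr
            · exact hχl a b
            · exact hχ1 a
            · exact hlip b hbm a (mem_closedBall_zero_iff.2 ha)
        _ = κ * (2 / m + 1 / q) * ‖a - b‖ := by ring
        _ ≤ 1 / 2 * ‖a - b‖ := by gcongr
  have hL : LipschitzWith (1 / 2) P := by
    refine LipschitzWith.of_dist_le_mul fun a b => ?_
    rw [dist_eq_norm, dist_eq_norm]
    push_cast
    rcases le_total ρ' ‖b‖ with hb | hb
    · rcases le_total ρ' ‖a‖ with ha | ha
      · rw [hPz a ha, hPz b hb, sub_zero, norm_zero]
        positivity
      · rw [norm_sub_rev, norm_sub_rev a b]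
        exact hkey b a ha
    · exact hkey a b hb
  obtain ⟨A, hA⟩ := exists_homeomorph_add hL
  refine ⟨A, fun w hw => ?_, fun w hw => ?_, fun w => ?_⟩
  · rw [hA, hPdef]
    simp [hχo w hw, he]
  · rw [hA, hPz w hw, add_zero]
  · rw [hA, add_sub_cancel_left]
    exact hPκ w

lemma IsDiskMap.eventually_exists_near_id {ι : Type*} {l : Filter ι} {f : ι → ℂ → ℂ} {F : ℂ → ℂ}
    {D : ι → Set ℂ} {Ω : Set ℂ} (hF : IsDiskMap F Ω) (hf : ∀ᶠ n in l, IsDiskMap (f n) (D n))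
    (hfF : TendstoUniformlyOn f F l (closedBall 0 1)) {σ κ : ℝ} (hσ : σ < 1) (hκ : 0 < κ) :
    ∀ᶠ n in l, ∃ g : ℂ → ℂ, DifferentiableOn ℂ g (ball 0 σ) ∧
      ∀ w ∈ ball (0 : ℂ) σ, ‖g w - w‖ ≤ κ ∧ g w ∈ ball (0 : ℂ) 1 ∧ f n (g w) = F w := by
  have hsub : closedBall (0 : ℂ) σ ⊆ ball 0 1 := closedBall_subset_ball hσ
  have hloc : ∀ x ∈ closedBall (0 : ℂ) σ, ∃ N ∈ 𝓝[closedBall 0 σ] x, ∀ᶠ n in l, ∀ y ∈ N,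
      ∃ z ∈ ball (0 : ℂ) 1, f n z = F y ∧ ‖z - y‖ ≤ κ := by
    intro x hx
    have hx1 := hsub hx
    obtain ⟨r₀, hr₀, hr₀s⟩ := Metric.isOpen_iff.1 isOpen_ball x hx1
    set r := min (κ / 2) (r₀ / 2) with hr
    have hr0 : 0 < r := by positivity
    have hrs : closedBall x r ⊆ ball 0 1 :=
      (closedBall_subset_ball ((min_le_right _ _).trans_lt (half_lt_self hr₀))).trans hr₀s
    have hrs' : closedBall x r ⊆ closedBall 0 1 := hrs.trans ball_subset_closedBall
    obtain ⟨ρ, hρ, hρn⟩ := eventually_ball_subset_image (l := l) (F := f) (f := F) (x := x) hr0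
      (hf.mono fun n hn => (hn.differentiableOn.mono hrs).diffContOnCl_ball subset_rfl)
      (hfF.mono hrs') (hF.continuousOn.mono (sphere_subset_closedBall.trans hrs'))
      fun z hz h => by
        have := hF.injOn (hrs (sphere_subset_closedBall hz)) hx1 h
        rw [this, mem_sphere, dist_self] at hz
        exact hr0.ne hz
    have hFx : ContinuousAt F x :=
      (hF.differentiableOn.differentiableAt (isOpen_ball.mem_nhds hx1)).continuousAt
    refine ⟨F ⁻¹' ball (F x) ρ ∩ ball x (κ / 2), mem_nhdsWithin_of_mem_nhds (inter_mem
      (hFx.preimage_mem_nhds (ball_mem_nhds _ hρ)) (ball_mem_nhds _ (half_pos hκ))), ?_⟩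
    filter_upwards [hρn] with n hn
    rintro y ⟨hy, hyx⟩
    obtain ⟨z, hz, hzy⟩ := hn hy
    refine ⟨z, hrs hz, hzy, ?_⟩
    rw [← dist_eq_norm]
    have h1 : dist z x ≤ κ / 2 := (mem_closedBall.1 hz).trans (min_le_left _ _)
    have h2 := mem_ball'.1 hyx
    linarith [dist_triangle z x y]
  have hall : ∀ᶠ n in l, ∀ y ∈ closedBall (0 : ℂ) σ,
      ∃ z ∈ ball (0 : ℂ) 1, f n z = F y ∧ ‖z - y‖ ≤ κ := by
    refine (isCompact_closedBall (0 : ℂ) σ).induction_on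
      (p := fun s => ∀ᶠ n in l, ∀ y ∈ s, ∃ z ∈ ball (0 : ℂ) 1, f n z = F y ∧ ‖z - y‖ ≤ κ)
      (by simp) (fun s t hst ht => ht.mono fun n hn y hy => hn y (hst hy)) ?_ hloc
    intro s t hs ht
    filter_upwards [hs, ht] with n hn hn' y hy
    exact hy.elim (hn y) (hn' y)
  filter_upwards [hall, hf] with n hn hfn
  obtain ⟨k, hk, -, hkf, hfk⟩ := hfn.exists_inverse
  have hmaps : ∀ w ∈ ball (0 : ℂ) σ, F w ∈ D n := fun w hw => by
    obtain ⟨z, hz, hzw, -⟩ := hn w (ball_subset_closedBall hw)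
    exact hzw ▸ hfn.mem hz
  refine ⟨fun w => k (F w), hk.comp (hF.differentiableOn.mono
    (ball_subset_closedBall.trans hsub)) hmaps, fun w hw => ?_⟩
  obtain ⟨z, hz, hzw, hzκ⟩ := hn w (ball_subset_closedBall hw)
  simp only [← hzw, hkf z hz]
  exact ⟨hzκ, hz, trivial⟩

lemma exists_continuousOn_comp_circleExp {d : ℝ → ℝ} (hd : Continuous d)
    (hp : Function.Periodic d (2 * Real.pi)) :
    ∃ κ : ℂ → ℝ, ContinuousOn κ {0}ᶜ ∧ ∀ r : ℝ, 0 < r → ∀ x, κ (r * Circle.exp x) = d x := by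
  set L : Real.Angle → ℝ := hp.lift with hL
  have hLc : Continuous L := hd.quotient_lift _
  have hLx : ∀ x : ℝ, L (x : Real.Angle) = d x := fun x => hp.lift_coe x
  refine ⟨fun w => L (Complex.arg w : Real.Angle), fun w hw => ?_, fun r hr x => ?_⟩
  · exact (hLc.continuousAt.comp (Complex.continuousAt_arg_coe_angle hw)).continuousWithinAt
  · have h := Complex.arg_mul_cos_add_sin_mul_I_coe_angle hr (x : Real.Angle)
    have h2 : (r : ℂ) * (Circle.exp x : ℂ) =
        r * (Real.Angle.cos (x : Real.Angle) + Real.Angle.sin (x : Real.Angle) * Complex.I) := by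
      rw [Circle.coe_exp, Complex.exp_mul_I, Real.Angle.cos_coe, Real.Angle.sin_coe,
        Complex.ofReal_cos, Complex.ofReal_sin]
    simp only
    rw [h2, h, hLx]

lemma exists_eq_mul_circleExp (w : ℂ) : ∃ x : ℝ, w = ‖w‖ * Circle.exp x :=
  ⟨Complex.arg w, by rw [Circle.coe_exp, Complex.norm_mul_exp_arg_mul_I]⟩

lemma norm_mul_circleExp {r : ℝ} (hr : 0 ≤ r) (x : ℝ) : ‖(r : ℂ) * Circle.exp x‖ = r := by
  rw [norm_mul, Circle.norm_coe, mul_one, Complex.norm_of_nonneg hr]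

lemma add_int_mul_of_add {Θ : ℝ → ℝ} {p : ℝ} (hp : ∀ x, Θ (x + p) = Θ x + p) (x : ℝ) (n : ℤ) :
    Θ (x + n * p) = Θ x + n * p := by
  have h : Function.Periodic (fun x => Θ x - x) p := fun x => by simp only [hp]; ring
  have := h.int_mul n x
  linarith

lemma exists_angular_map {Θ : ℝ → ℝ} {ρ r : ℝ} (hΘ : Continuous Θ) (hmono : StrictMono Θ)
    (hp : ∀ x, Θ (x + 2 * Real.pi) = Θ x + 2 * Real.pi) (hr : ∀ x, |Θ x - x| ≤ r)
    (hρ : 0 < ρ) (hρ1 : ρ < 1) :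
    ∃ B : ℂ → ℂ, Continuous B ∧ Function.Bijective B ∧ (∀ w, ‖B w‖ = ‖w‖) ∧
      (∀ w, ‖w‖ ≤ ρ → B w = w) ∧ (∀ x, B (Circle.exp x) = Circle.exp (Θ x)) ∧
      ∀ w, ‖B w - w‖ ≤ r * ‖w‖ := by
  obtain ⟨κ, hκc, hκ⟩ := exists_continuousOn_comp_circleExp (d := fun x => Θ x - x)
    (hΘ.sub continuous_id) fun x => by simp only [hp]; ring
  set s : ℝ → ℝ := fun t => max 0 (min 1 ((t - ρ) / (1 - ρ))) with hs
  have hρ' : 0 < 1 - ρ := sub_pos.2 hρ1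
  have hsc : Continuous s := by fun_prop
  have hs0 : ∀ t, 0 ≤ s t := fun t => le_max_left _ _
  have hs1 : ∀ t, s t ≤ 1 := fun t => max_le zero_le_one (min_le_left _ _)
  have hsρ : ∀ t ≤ ρ, s t = 0 := fun t ht =>
    max_eq_left ((min_le_right _ _).trans (div_nonpos_of_nonpos_of_nonneg (by linarith) hρ'.le))
  have hs11 : s 1 = 1 := by simp [hs, div_self hρ'.ne']
  set B : ℂ → ℂ := fun w => w * Circle.exp (s ‖w‖ * κ w) with hB
  set ψ : ℝ → ℝ → ℝ := fun t x => x + s t * (Θ x - x) with hψ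
  have hBx : ∀ t : ℝ, 0 < t → ∀ x, B (t * Circle.exp x) = t * Circle.exp (ψ t x) := by
    intro t ht x
    simp only [hB, hκ t ht, norm_mul_circleExp ht.le, hψ, Circle.exp_add, Circle.coe_mul]
    ring
  have hψm : ∀ t, StrictMono (ψ t) := by
    intro t x y hxy
    have h1 : ψ t y - ψ t x = (1 - s t) * (y - x) + s t * (Θ y - Θ x) := by simp only [hψ]; ring
    have h2 : 0 < Θ y - Θ x := sub_pos.2 (hmono hxy)
    have h3 : 0 < y - x := sub_pos.2 hxy
    have : 0 < ψ t y - ψ t x := by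
      rw [h1]
      rcases (hs0 t).eq_or_lt with h | h
      · rw [← h]; simpa using h3
      · have := mul_pos h h2
        have := mul_nonneg (sub_nonneg.2 (hs1 t)) h3.le
        linarith
    linarith
  have hψp : ∀ t x, ψ t (x + 2 * Real.pi) = ψ t x + 2 * Real.pi := fun t x => by
    simp only [hψ, hp]; ring
  have hψs : ∀ t, Function.Surjective (ψ t) := by
    intro t
    have hc : Continuous (ψ t) := by fun_prop
    have hb : ∀ x, x - r ≤ ψ t x ∧ ψ t x ≤ x + r := fun x => by
      have h1 : |s t * (Θ x - x)| ≤ r := by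
        rw [abs_mul, abs_of_nonneg (hs0 t)]
        exact (mul_le_of_le_one_left (abs_nonneg _) (hs1 t)).trans (hr x)
      have := abs_le.1 h1
      constructor <;> simp only [hψ] <;> linarith
    refine hc.surjective ?_ ?_
    · exact tendsto_atTop_mono (fun x => (hb x).1) (tendsto_atTop_add_const_right _ _ tendsto_id)
    · exact tendsto_atBot_mono (fun x => (hb x).2) (tendsto_atBot_add_const_right _ _ tendsto_id)
  have hBn : ∀ w, ‖B w‖ = ‖w‖ := fun w => by
    simp only [hB]; rw [norm_mul, Circle.norm_coe, mul_one]
  have hBρ : ∀ w, ‖w‖ ≤ ρ → B w = w := fun w hw => by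
    simp only [hB]; rw [hsρ _ hw, zero_mul, Circle.exp_zero, Circle.coe_one, mul_one]
  refine ⟨B, ?_, ⟨?_, ?_⟩, hBn, hBρ, fun x => ?_, fun w => ?_⟩
  · rw [continuous_iff_continuousAt]
    intro w
    rcases eq_or_ne w 0 with rfl | hw
    · refine continuousAt_id.congr ?_
      filter_upwards [ball_mem_nhds (0 : ℂ) hρ] with w hw
      exact (hBρ w (mem_ball_zero_iff.1 hw).le).symm
    · have h1 : ContinuousAt κ w := hκc.continuousAt (isOpen_compl_singleton.mem_nhds hw)
      have h2 : ContinuousAt (fun w => s ‖w‖ * κ w) w :=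
        (hsc.comp continuous_norm).continuousAt.mul h1
      exact continuousAt_id.mul (ContinuousAt.comp (f := fun w : ℂ => s ‖w‖ * κ w)
        (g := fun x : ℝ => (Circle.exp x : ℂ))
        (continuous_subtype_val.comp Circle.exp.continuous).continuousAt h2)
  · intro a b hab
    have hn : ‖a‖ = ‖b‖ := by rw [← hBn a, hab, hBn]
    rcases eq_or_ne a 0 with ha | ha
    · rw [ha, norm_zero] at hn
      rw [ha, norm_eq_zero.1 hn.symm]
    obtain ⟨x, hx⟩ := exists_eq_mul_circleExp a
    obtain ⟨y, hy⟩ := exists_eq_mul_circleExp b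
    have ht : 0 < ‖a‖ := norm_pos_iff.2 ha
    rw [← hn] at hy
    rw [hx, hy, hBx _ ht, hBx _ ht] at hab
    have h1 : (Circle.exp (ψ ‖a‖ x) : ℂ) = Circle.exp (ψ ‖a‖ y) :=
      mul_left_cancel₀ (Complex.ofReal_ne_zero.2 ht.ne') hab
    obtain ⟨n, hn⟩ := Circle.exp_eq_exp.1 (Subtype.ext h1)
    rw [← add_int_mul_of_add (hψp ‖a‖)] at hn
    rw [hx, hy, Circle.exp_eq_exp.2 ⟨n, (hψm _).injective hn⟩]
  · intro w
    rcases eq_or_ne w 0 with rfl | hw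
    · exact ⟨0, hBρ 0 (by rw [norm_zero]; exact hρ.le)⟩
    obtain ⟨y, hy⟩ := exists_eq_mul_circleExp w
    obtain ⟨x, hx⟩ := hψs ‖w‖ y
    exact ⟨‖w‖ * Circle.exp x, by rw [hBx _ (norm_pos_iff.2 hw), hx, ← hy]⟩
  · have := hBx 1 one_pos x
    simp only [Complex.ofReal_one, one_mul] at this
    rw [this]
    simp [hψ, hs11]
  · rcases eq_or_ne w 0 with rfl | hw
    · rw [hBρ 0 (by rw [norm_zero]; exact hρ.le)]; simp
    obtain ⟨x, hx⟩ := exists_eq_mul_circleExp w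
    have h1 : κ w = Θ x - x := by rw [hx, hκ _ (norm_pos_iff.2 hw)]
    have h2 : B w - w = w * (Complex.exp (Complex.I * ((s ‖w‖ * κ w : ℝ) : ℂ)) - 1) := by
      simp only [hB, Circle.coe_exp]; rw [mul_comm Complex.I]; ring
    rw [h2, norm_mul, mul_comm]
    gcongr
    refine Real.norm_exp_I_mul_ofReal_sub_one_le.trans ?_
    rw [h1, Real.norm_eq_abs, abs_mul, abs_of_nonneg (hs0 _)]
    exact (mul_le_of_le_one_left (abs_nonneg _) (hs1 _)).trans (hr x)

lemma IsDiskMap.exists_homeomorph {F f h Φ : ℂ → ℂ} {Ω D : Set ℂ} (hF : IsDiskMap F Ω)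
    (hf : IsDiskMap f D) (hi : InjOn h (frontier Ω)) (hΦc : ContinuousOn Φ (closedBall 0 1))
    (hΦ : BijOn Φ (closedBall 0 1) (closedBall 0 1)) (hΦs : MapsTo Φ (sphere 0 1) (sphere 0 1))
    (hΦb : MapsTo Φ (ball 0 1) (ball 0 1))
    (hbd : ∀ w ∈ sphere (0 : ℂ) 1, f (Φ w) = h (F w)) :
    ∃ H : closure Ω ≃ₜ closure D, ∀ z : closure Ω, ∀ w ∈ closedBall (0 : ℂ) 1,
      F w = z → (H z : ℂ) = f (Φ w) := by
  have hcases : ∀ w ∈ closedBall (0 : ℂ) 1, w ∈ ball (0 : ℂ) 1 ∨ w ∈ sphere (0 : ℂ) 1 :=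
    fun w hw => by rwa [← mem_union, ball_union_sphere]
  have hwd : ∀ a ∈ closedBall (0 : ℂ) 1, ∀ b ∈ closedBall (0 : ℂ) 1, F a = F b →
      f (Φ a) = f (Φ b) := by
    intro a ha b hb hab
    rcases hcases a ha with ha' | ha' <;> rcases hcases b hb with hb' | hb'
    · rw [hF.injOn ha' hb' hab]
    · exact absurd (hab ▸ hF.mem ha') (hF.notMem b hb')
    · exact absurd (hab ▸ hF.mem hb') (hF.notMem a ha')
    · rw [hbd a ha', hbd b hb', hab]
  have hinj : ∀ a ∈ closedBall (0 : ℂ) 1, ∀ b ∈ closedBall (0 : ℂ) 1, f (Φ a) = f (Φ b) →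
      F a = F b := by
    intro a ha b hb hab
    rcases hcases a ha with ha' | ha' <;> rcases hcases b hb with hb' | hb'
    · rw [hΦ.injOn ha hb (hf.injOn (hΦb ha') (hΦb hb') hab)]
    · exact absurd (hab ▸ hf.mem (hΦb ha')) (hf.notMem _ (hΦs hb'))
    · exact absurd (hab ▸ hf.mem (hΦb hb')) (hf.notMem _ (hΦs ha'))
    · rw [hbd a ha', hbd b hb'] at hab
      exact hi (hF.mem_frontier ha') (hF.mem_frontier hb') hab
  set k : ℂ → ℂ := fun z => f (Φ (Function.invFunOn F (closedBall 0 1) z)) with hk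
  have hkF : ∀ w ∈ closedBall (0 : ℂ) 1, k (F w) = f (Φ w) := fun w hw =>
    hwd _ (Function.invFunOn_mem ⟨w, hw, rfl⟩) _ hw (Function.invFunOn_eq ⟨w, hw, rfl⟩)
  have hkc : ContinuousOn k (closure Ω) := by
    rw [← hF.image_closedBall]
    refine continuousOn_image_of_comp (isCompact_closedBall _ _) hF.continuousOn ?_
    exact (hf.continuousOn.comp hΦc hΦ.mapsTo).congr hkF
  have hkb : BijOn k (closure Ω) (closure D) := by
    rw [← hF.image_closedBall, ← hf.image_closedBall]
    refine ⟨?_, ?_, ?_⟩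
    · rintro _ ⟨w, hw, rfl⟩
      exact ⟨Φ w, hΦ.mapsTo hw, (hkF w hw).symm⟩
    · rintro _ ⟨a, ha, rfl⟩ _ ⟨b, hb, rfl⟩ hab
      rw [hkF a ha, hkF b hb] at hab
      exact hinj a ha b hb hab
    · rintro _ ⟨v, hv, rfl⟩
      obtain ⟨w, hw, rfl⟩ := hΦ.surjOn hv
      exact ⟨F w, ⟨w, hw, rfl⟩, hkF w hw⟩
  have hcomp : IsCompact (closure Ω) := by
    rw [← hF.image_closedBall]
    exact (isCompact_closedBall _ _).image_of_continuousOn hF.continuousOn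
  have : CompactSpace (closure Ω) := isCompact_iff_compactSpace.1 hcomp
  have hec : Continuous (hkb.equiv k) :=
    (continuousOn_iff_continuous_domRestrict.1 hkc).subtype_mk _
  refine ⟨hec.homeoOfEquivCompactToT2, fun z w hw hz => ?_⟩
  rw [← hkF w hw, hz]
  rfl

lemma norm_lt_iff_of_eq_id {A : ℂ ≃ₜ ℂ} {ρ t : ℝ} (hρ : ρ ≤ t)
    (hA : ∀ w, ρ ≤ ‖w‖ → A w = w) (w : ℂ) : ‖A w‖ < t ↔ ‖w‖ < t := by
  constructor
  · intro hw
    by_contra! h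
    rw [hA w (hρ.trans h)] at hw
    exact absurd hw (not_lt.2 h)
  · intro hw
    by_contra! h
    rw [A.injective (hA _ (hρ.trans h))] at h
    exact absurd hw (not_lt.2 h)

lemma IsDiskMap.eventually_exists_homeomorph {ι : Type*} {l : Filter ι} {f h : ι → ℂ → ℂ}
    {F : ℂ → ℂ} {D : ι → Set ℂ} {Ω U : Set ℂ} (hF : IsDiskMap F Ω)
    (hf : ∀ᶠ n in l, IsDiskMap (f n) (D n)) (hfF : TendstoUniformlyOn f F l (closedBall 0 1))
    (hi : ∀ n, InjOn (h n) (frontier Ω))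
    (hΘ : ∀ r > 0, ∀ᶠ n in l, ∃ Θ : ℝ → ℝ, Continuous Θ ∧ StrictMono Θ ∧
      (∀ x, Θ (x + 2 * Real.pi) = Θ x + 2 * Real.pi) ∧ (∀ x, |Θ x - x| ≤ r) ∧
      ∀ x, f n (Circle.exp (Θ x)) = h n (F (Circle.exp x)))
    (hU : IsOpen U) (hΩU : frontier Ω ⊆ U) {ε : ℝ} (hε : 0 < ε) :
    ∀ᶠ n in l, ∃ H : closure Ω ≃ₜ closure (D n),
      (∀ z : closure Ω, (z : ℂ) ∈ frontier Ω → (H z : ℂ) = h n z) ∧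
      (∀ z : closure Ω, dist (H z : ℂ) z ≤ ε / 2) ∧
      ∀ z : closure Ω, (z : ℂ) ∉ U → (H z : ℂ) = z := by
  obtain ⟨ρ, ⟨hρ0, hρ1⟩, hρ⟩ : ∃ ρ ∈ Ioo (0 : ℝ) 1,
      closedBall (0 : ℂ) 1 ∩ F ⁻¹' Uᶜ ⊆ ball 0 ρ := by
    refine exists_pos_lt_subset_ball one_pos
      (hF.continuousOn.preimage_isClosed_of_isClosed isClosed_closedBall hU.isClosed_compl) ?_
    rintro w ⟨hw, hwU⟩
    rw [← ball_union_sphere] at hw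
    exact hw.resolve_right fun hs => hwU (hΩU (hF.mem_frontier hs))
  set ρ' := (2 * ρ + 1) / 3 with hρ'
  set σ := (ρ + 2) / 3 with hσ
  have hρ'1 : ρ' < 1 := by linarith
  obtain ⟨κ₀, hκ₀, hA⟩ := exists_homeomorph_of_near_id (ρ := ρ) (ρ' := ρ') (σ := σ)
    (by linarith) (by linarith)
  obtain ⟨η, hη, hFη⟩ := Metric.uniformContinuousOn_iff.1
    ((isCompact_closedBall (0 : ℂ) 1).uniformContinuousOn_of_continuous hF.continuousOn)
    (ε / 4) (by positivity)
  set κ := min κ₀ (η / 4) with hκ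
  have hκ0 : 0 < κ := by positivity
  filter_upwards [hf, Metric.tendstoUniformlyOn_iff.1 hfF (ε / 4) (by positivity),
    hΘ (η / 4) (by positivity),
    hF.eventually_exists_near_id hf hfF (σ := σ) (by linarith) hκ0]
    with n hfn hfFn ⟨Θ, hΘc, hΘm, hΘp, hΘr, hΘh⟩ ⟨g, hgd, hg⟩
  obtain ⟨A, hAg, hAid, hAκ⟩ := hA κ (min_le_left _ _) g hgd (fun w hw => (hg w hw).1) hκ0.le
  obtain ⟨B, hBc, hBb, hBn, hBid, hBΘ, hBr⟩ := exists_angular_map (ρ := ρ') hΘc hΘm hΘp hΘr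
    (by positivity) hρ'1
  have hlt : ∀ w, ‖B (A w)‖ < 1 ↔ ‖w‖ < 1 := fun w => by
    rw [hBn]; exact norm_lt_iff_of_eq_id hρ'1.le hAid w
  have hout : ∀ w, 1 ≤ ‖w‖ → ‖B (A w)‖ = ‖w‖ := fun w hw => by
    rw [hBn, hAid w (hρ'1.le.trans hw)]
  have hle : ∀ w, ‖B (A w)‖ ≤ 1 ↔ ‖w‖ ≤ 1 := fun w => by
    rcases lt_or_ge ‖w‖ 1 with hw | hw
    · exact ⟨fun _ => hw.le, fun _ => ((hlt w).2 hw).le⟩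
    · rw [hout w hw]
  have hbd : ∀ w ∈ sphere (0 : ℂ) 1, f n (B (A w)) = h n (F w) := fun w hw => by
    rw [hAid w (by rw [mem_sphere_zero_iff_norm.1 hw]; exact hρ'1.le)]
    obtain ⟨x, rfl⟩ := exists_circleExp_eq hw
    rw [hBΘ, hΘh]
  obtain ⟨H, hH⟩ := hF.exists_homeomorph hfn (hi n) (Φ := fun w => B (A w))
    (hBc.comp A.continuous).continuousOn
    ⟨fun w hw => mem_closedBall_zero_iff.2 ((hle w).2 (mem_closedBall_zero_iff.1 hw)),
      (hBb.injective.comp A.injective).injOn, fun v hv => by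
        obtain ⟨w, rfl⟩ := (hBb.surjective.comp A.surjective) v
        exact ⟨w, mem_closedBall_zero_iff.2 ((hle w).1 (mem_closedBall_zero_iff.1 hv)), rfl⟩⟩
    (fun w hw => by
      rw [mem_sphere_zero_iff_norm] at hw ⊢
      rw [hout w hw.ge, hw])
    (fun w hw => mem_ball_zero_iff.2 ((hlt w).2 (mem_ball_zero_iff.1 hw))) hbd
  refine ⟨H, fun z hz => ?_, fun z => ?_, fun z hz => ?_⟩
  · obtain ⟨w, hw, hwz⟩ := hF.image_sphere.ge hz
    rw [hH z w (sphere_subset_closedBall hw) hwz, hbd w hw, hwz]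
  · obtain ⟨w, hw, hwz⟩ := hF.image_closedBall.ge z.2
    rw [hH z w hw hwz, ← hwz]
    have hw1 := mem_closedBall_zero_iff.1 hw
    have hB1 : B (A w) ∈ closedBall (0 : ℂ) 1 := mem_closedBall_zero_iff.2 ((hle w).2 hw1)
    have h1 : dist (B (A w)) w < η := by
      refine (dist_triangle _ (A w) _).trans_lt ?_
      rw [dist_eq_norm, dist_eq_norm]
      have h2 : ‖A w‖ ≤ 1 := by rw [← hBn]; exact (hle w).2 hw1
      have h3 : η / 4 * ‖A w‖ ≤ η / 4 := mul_le_of_le_one_right (by positivity) h2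
      have h4 : κ ≤ η / 4 := min_le_right _ _
      linarith [hBr (A w), hAκ w]
    have h2 := hFη _ hB1 _ hw h1
    have h3 := hfFn _ hB1
    rw [dist_comm] at h3
    linarith [dist_triangle (f n (B (A w))) (F (B (A w))) (F w)]
  · obtain ⟨w, hw, hwz⟩ := hF.image_closedBall.ge z.2
    have hwρ : ‖w‖ < ρ := mem_ball_zero_iff.1 (hρ ⟨hw, by rwa [mem_preimage, hwz]⟩)
    have hAw : ‖A w‖ < ρ' := (norm_lt_iff_of_eq_id le_rfl hAid w).2 (by linarith)
    rw [hH z w hw hwz, hBid _ hAw.le, hAg w hwρ.le,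
      (hg w (mem_ball_zero_iff.2 (by linarith))).2.2, hwz]

lemma IsContinuumDomain.of_isSimplyConnected {Ω : Set ℂ} (ho : IsOpen Ω)
    (hsc : IsSimplyConnected Ω) (hb : Bornology.IsBounded Ω) {z₀ : ℂ} (hz₀ : z₀ ∈ Ω) :
    IsContinuumDomain Ω (frontier Ω) := by
  have hdisj : Disjoint (frontier Ω) Ω := disjoint_frontier_iff_isOpen.2 ho
  have hz : z₀ ∉ frontier Ω := fun h => hdisj.le_bot ⟨h, hz₀⟩
  have hpc : IsPathConnected Ω := hsc.isPathConnected
  refine ⟨hb.isCompact_closure.of_isClosed_subset isClosed_frontier frontier_subset_closure,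
    isPreconnected_frontier_of_isSimplyConnected ho hsc hb, hb, z₀, hz, ?_⟩
  refine Subset.antisymm (hpc.isConnected.isPreconnected.subset_connectedComponentIn hz₀
    fun z hz hzf => hdisj.le_bot ⟨hzf, hz⟩) ?_
  refine isPreconnected_connectedComponentIn.subset_left_of_subset_union ho
    (isClosed_closure (s := Ω)).isOpen_compl (disjoint_compl_right.mono_left subset_closure) ?_
    ⟨z₀, mem_connectedComponentIn hz, hz₀⟩
  intro z hz
  have hzf := connectedComponentIn_subset _ _ hz
  by_cases hzc : z ∈ closure Ω
  · left
    by_contra hzΩ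
    exact hzf ⟨hzc, fun h => hzΩ (interior_subset h)⟩
  · exact Or.inr hzc

/-- Small displacements of the boundary of a lemniscate domain extend to
`ε`-homeomorphisms of its closure onto the closure of the perturbed domain,
equal to the identity outside the given neighborhood `U` of the boundary. -/
theorem boundary_homeomorphism_extension
    (Ω : Set ℂ) (hΩ : IsLemniscateDomain Ω) (hbdd : Bornology.IsBounded Ω)
    (z₀ : ℂ) (hz₀ : z₀ ∈ Ω) (ε : ℝ) (hε : 0 < ε)
    (U : Set ℂ) (hU : IsOpen U) (hγU : frontier Ω ⊆ U) :
    ∃ δ > 0, ∀ h : ℂ → ℂ,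
      ContinuousOn h (frontier Ω) → Set.InjOn h (frontier Ω) →
      (∀ z ∈ frontier Ω, dist (h z) z < δ) →
      ∃ H : (closure Ω : Set ℂ) ≃ₜ
            (closure (connectedComponentIn (h '' frontier Ω)ᶜ z₀) : Set ℂ),
        (∀ z : (closure Ω : Set ℂ), (z : ℂ) ∈ frontier Ω → (H z : ℂ) = h z) ∧
        (∃ c < ε, ∀ z : (closure Ω : Set ℂ), dist ((H z : ℂ)) (z : ℂ) ≤ c) ∧
        (∀ z : (closure Ω : Set ℂ), (z : ℂ) ∉ U → (H z : ℂ) = z) := by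
  obtain ⟨ho, hsc, W, hW⟩ := hΩ
  have hD := IsContinuumDomain.of_isSimplyConnected ho hsc hbdd hz₀
  obtain ⟨V, S, c, hG, hbr⟩ := hW.exists_isArcGraph hD.isCompact hD.isPreconnected
  by_contra! hcon
  choose h hc hi hh hbad using fun n : ℕ => hcon (1 / ((n : ℝ) + 1)) (by positivity)
  have hlim : ∀ δ > 0, ∀ᶠ n in (hyperfilter ℕ : Filter ℕ),
      ∀ z ∈ frontier Ω, dist (h n z) z < δ := by
    intro δ hδ
    have h1 : ∀ᶠ n : ℕ in atTop, 1 / ((n : ℝ) + 1) < δ :=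
      tendsto_one_div_add_atTop_nhds_zero_nat.eventually_lt_const hδ
    filter_upwards [(Nat.hyperfilter_le_atTop h1)] with n hn z hz
    exact (hh n z hz).trans hn
  obtain ⟨f, F, hf, hfF, hF, hΘ⟩ := hD.exists_boundary_lift (hyperfilter ℕ) hz₀ hG hbr hc hi hlim
  obtain ⟨n, H, h1, h2, h3⟩ :=
    (hF.eventually_exists_homeomorph hf hfF hi hΘ hU hγU hε).exists
  obtain ⟨z, hzU, hz⟩ := hbad n H h1 ⟨ε / 2, half_lt_self hε, h2⟩
  exact hz (h3 z hzU)

end
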